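/- Let n be a positive integer, U an open neighborhood of 0 in ℂ^n, and f_1, …, f_n holomorphic functions on U. Let ν be a positive integer with ν < n, and suppose there exist holomorphic functions g_1, …, g_ν on a neighborhood of 0, each of the form g_k = c_{k1} f_1 + ⋯ + c_{kn} f_n with holomorphic coefficients c_{kj} near 0, together with a constant C > 0 and a neighborhood W of 0 such that |f_j(z)| ≤ C (|g_1(z)| + ⋯ + |g_ν(z)|) for all z ∈ W and all j = 1, …, n (so that the ideal generated by f_1, …, f_n at 0 admits a reduction generated by ν < n elements, i.e., has analytic spread at most ν). Then the Jacobian J(f_1, …, f_n) belongs to the ideal (f_1, …, f_n) locally at 0: there exist an open neighborhood Ũ ⊆ U of 0 and holomorphic functions a_1, …, a_n on Ũ such that J(f_1, …, f_n) = a_1 f_1 + ⋯ + a_n f_n on Ũ. -/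

import Mathlib

namespace JacIdeal
open MeasureTheory Metric Set Filter Topology

/-- Averaging over the circle as a continuous linear map. -/
lemma exists_circle_clm {A : Type} [NormedCommRing A] [NormedAlgebra ℂ A] [CompleteSpace A]
    (c : ℂ) (r : ℝ) (hr : 0 < r) :
    ∃ Λ : C(sphere c r, A) →L[ℂ] A, ∀ (u : C(sphere c r, A)) (v : ℂ → A),
      (∀ w : sphere c r, u w = v w) → Λ u = (2 * Real.pi * Complex.I : ℂ)⁻¹ • ∮ w in C(c, r), v w := by
  let p : ℝ → sphere c r := fun θ => ⟨circleMap c r θ, circleMap_mem_sphere c hr.le θ⟩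
  have hp : Continuous p := Continuous.subtype_mk (continuous_circleMap c r) _
  have hd : Continuous (deriv (circleMap c r)) := by
    have : deriv (circleMap c r) = fun θ => circleMap 0 r θ * Complex.I := by
      ext θ; exact deriv_circleMap c r θ
    rw [this]
    exact (continuous_circleMap 0 r).mul continuous_const
  have hIg : ∀ u : C(sphere c r, A), IntervalIntegrable
      (fun θ => deriv (circleMap c r) θ • u (p θ)) volume 0 (2 * Real.pi) := fun u =>
    (hd.smul (u.continuous.comp hp)).intervalIntegrable _ _
  let Λ0 : C(sphere c r, A) →ₗ[ℂ] A :=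
    { toFun := fun u => (2 * Real.pi * Complex.I : ℂ)⁻¹ •
        ∫ θ in (0:ℝ)..2 * Real.pi, deriv (circleMap c r) θ • u (p θ)
      map_add' := by
        intro u v
        rw [← smul_add, ← intervalIntegral.integral_add (hIg u) (hIg v)]
        simp [smul_add]
      map_smul' := by
        intro a u
        simp only [ContinuousMap.coe_smul, Pi.smul_apply, RingHom.id_apply]
        have h : ∀ θ : ℝ, deriv (circleMap c r) θ • a • u (p θ)
            = a • deriv (circleMap c r) θ • u (p θ) := fun θ => smul_comm _ _ _
        simp only [h, intervalIntegral.integral_smul]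
        exact smul_comm _ _ _ }
  refine ⟨Λ0.mkContinuous (‖(2 * Real.pi * Complex.I : ℂ)⁻¹‖ * (r * |2 * Real.pi - 0|)) ?_, ?_⟩
  · intro u
    change ‖(2 * Real.pi * Complex.I : ℂ)⁻¹ •
        (∫ θ in (0:ℝ)..2 * Real.pi, deriv (circleMap c r) θ • u (p θ))‖ ≤ _
    rw [norm_smul, mul_assoc ‖_‖]
    refine mul_le_mul_of_nonneg_left ?_ (norm_nonneg _)
    have := intervalIntegral.norm_integral_le_of_norm_le_const (a := (0:ℝ)) (b := 2 * Real.pi)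
      (f := fun θ => deriv (circleMap c r) θ • u (p θ)) (C := r * ‖u‖) ?_
    · refine this.trans (le_of_eq ?_); ring
    · intro θ _
      rw [norm_smul, deriv_circleMap]
      simp only [norm_mul, Complex.norm_I, mul_one, norm_circleMap_zero, abs_of_pos hr]
      gcongr
      exact u.norm_coe_le_norm _
  · intro u v huv
    change (2 * Real.pi * Complex.I : ℂ)⁻¹ •
        (∫ θ in (0:ℝ)..2 * Real.pi, deriv (circleMap c r) θ • u (p θ)) = _
    rw [circleIntegral]
    congr 2
    ext θ
    rw [huv]

theorem osgood_aux (N : ℕ) : ∀ (A : Type) [NormedCommRing A] [NormedAlgebra ℂ A] [CompleteSpace A]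
    (f : (Fin N → ℂ) → A) (c : Fin N → ℂ) (r : ℝ), 0 < r →
    ContinuousOn f (closedBall c r) →
    (∀ z ∈ closedBall c r, ∀ i, z i ∈ ball (c i) r →
      f z = (2 * Real.pi * Complex.I : ℂ)⁻¹ •
        ∮ w in C(c i, r), (w - z i)⁻¹ • f (Function.update z i w)) →
    AnalyticAt ℂ f c := by
  induction N with
  | zero =>
    intro A _ _ _ f c r hr _ _
    have : f = fun _ => f c := by
      ext z; rw [Subsingleton.elim z c]
    rw [this]; exact analyticAt_const
  | succ N ih =>
    intro A _ _ _ f c r hr hcont hC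
    obtain ⟨Λ, hΛ⟩ := exists_circle_clm (A := A) (c 0) r hr
    have hmem : ∀ (w : ℂ) (z : Fin N → ℂ), w ∈ closedBall (c 0) r → z ∈ closedBall (Fin.tail c) r →
        (Fin.cons w z : Fin (N+1) → ℂ) ∈ closedBall c r := by
      intro w z hw hz
      rw [mem_closedBall, dist_pi_le_iff hr.le] at *
      intro i
      refine Fin.cases ?_ (fun j => ?_) i
      · simpa using hw
      · simpa [Fin.tail] using hz j
    let F : C(closedBall (Fin.tail c) r × sphere (c 0) r, A) :=
      ⟨fun q => f (Fin.cons q.2.1 q.1.1), by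
        refine hcont.comp_continuous ?_ ?_
        · refine continuous_pi (fun i => ?_)
          refine Fin.cases ?_ (fun j => ?_) i
          · simp only [Fin.cons_zero]; fun_prop
          · simp only [Fin.cons_succ]
            exact (continuous_apply j).comp (continuous_subtype_val.comp continuous_fst)
        · intro q
          exact hmem _ _ (sphere_subset_closedBall q.2.2) q.1.2⟩
    classical
    let G : (Fin N → ℂ) → C(sphere (c 0) r, A) := fun z =>
      if h : z ∈ closedBall (Fin.tail c) r then F.curry ⟨z, h⟩ else 0
    have hG : ∀ z ∈ closedBall (Fin.tail c) r, ∀ w, G z w = f (Fin.cons w.1 z) := by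
      intro z hz w
      simp only [G, hz, dif_pos]
      rfl
    have hGc : ContinuousOn G (closedBall (Fin.tail c) r) := by
      rw [continuousOn_iff_continuous_domRestrict]
      have : (closedBall (Fin.tail c) r).domRestrict G = F.curry := by
        funext z; exact dif_pos z.2
      rw [this]; exact F.curry.continuous
    have hupd : ∀ z ∈ closedBall (Fin.tail c) r, ∀ i, ∀ w ∈ sphere (Fin.tail c i) r,
        Function.update z i w ∈ closedBall (Fin.tail c) r := by
      intro z hz i w hw
      rw [mem_closedBall, dist_pi_le_iff hr.le] at *
      intro j
      by_cases hj : j = i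
      · subst hj; simpa using (mem_sphere.1 hw).le
      · simpa [Function.update_of_ne hj] using hz j
    have hGC : ∀ z ∈ closedBall (Fin.tail c) r, ∀ i, z i ∈ ball (Fin.tail c i) r →
      G z = (2 * Real.pi * Complex.I : ℂ)⁻¹ •
        ∮ w in C(Fin.tail c i, r), (w - z i)⁻¹ • G (Function.update z i w) := by
      intro z hz i hzi
      ext x
      have h1 := hC (Fin.cons x.1 z) (hmem _ _ (sphere_subset_closedBall x.2) hz) i.succ
        (by simpa [Fin.tail] using hzi)
      rw [hG z hz, h1]
      have hci : CircleIntegrable (fun w => (w - z i)⁻¹ • G (Function.update z i w))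
          (Fin.tail c i) r := by
        refine ContinuousOn.circleIntegrable hr.le ?_
        refine ContinuousOn.fun_smul ?_ ?_
        · refine ContinuousOn.inv₀ (by fun_prop) ?_
          intro w hw h
          rw [sub_eq_zero] at h
          rw [mem_sphere] at hw
          rw [h] at hw
          exact absurd hw (ne_of_lt hzi)
        · refine hGc.comp ?_ (fun w hw => hupd z hz i w hw)
          exact ((continuous_const (y := z)).update i continuous_id).continuousOn
      have h2 := (ContinuousMap.evalCLM ℂ (M := A) x).intervalIntegral_comp_comm
        hci.out
      rw [ContinuousMap.smul_apply]
      refine congrArg _ ?_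
      refine Eq.trans ?_ h2
      refine intervalIntegral.integral_congr (fun θ _ => ?_)
      have hm := hupd z hz i _ (circleMap_mem_sphere (Fin.tail c i) hr.le θ)
      simp only [ContinuousMap.evalCLM_apply, ContinuousMap.smul_apply, hG _ hm]
      rw [Fin.cons_update]
      rfl
    have hGa := ih _ G (Fin.tail c) r hr hGc hGC
    -- the inverse
    let ι : C(sphere (c 0) r, A) := ⟨fun w => algebraMap ℂ A w.1, by fun_prop⟩
    have hunit : ∀ z ∈ ball (c 0) r, ∃ u : (C(sphere (c 0) r, A))ˣ,
        (u : C(sphere (c 0) r, A)) = ι - algebraMap ℂ _ z ∧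
        ∀ w, (Ring.inverse (u : C(sphere (c 0) r, A))) w = algebraMap ℂ A (w.1 - z)⁻¹ := by
      intro z hz
      have hne : ∀ w : sphere (c 0) r, w.1 - z ≠ 0 := by
        intro w h
        have hw := w.2
        rw [sub_eq_zero] at h
        rw [mem_sphere, h] at hw
        exact absurd hw (ne_of_lt hz)
      let v : C(sphere (c 0) r, A) := ⟨fun w => algebraMap ℂ A (w.1 - z)⁻¹, by
        have : Continuous fun w : sphere (c 0) r => (w.1 - z)⁻¹ :=
          Continuous.inv₀ (by fun_prop) hne
        fun_prop⟩
      have hm : (ι - algebraMap ℂ _ z) * v = 1 := by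
        ext w
        have : (ι - algebraMap ℂ C(sphere (c 0) r, A) z) w = algebraMap ℂ A (w.1 - z) := by
          simp [ι, Algebra.algebraMap_eq_smul_one, sub_smul]
        rw [ContinuousMap.mul_apply, this]
        change algebraMap ℂ A (w.1 - z) * algebraMap ℂ A (w.1 - z)⁻¹ = 1
        rw [← map_mul, mul_inv_cancel₀ (hne w), map_one]
      refine ⟨⟨ι - algebraMap ℂ _ z, v, hm, by rw [mul_comm]; exact hm⟩, rfl, ?_⟩
      intro w
      rw [Ring.inverse_unit]
      rfl
    have hrep : f =ᶠ[𝓝 c] fun z => Λ (Ring.inverse (ι - algebraMap ℂ _ (z 0)) * G (Fin.tail z)) := by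
      filter_upwards [ball_mem_nhds c hr] with z hz
      have hz' := ball_subset_closedBall hz
      have hz0 : z 0 ∈ ball (c 0) r := by
        rw [mem_ball] at *
        exact lt_of_le_of_lt (dist_le_pi_dist z c 0) hz
      have hzt : Fin.tail z ∈ closedBall (Fin.tail c) r := by
        rw [mem_closedBall, dist_pi_le_iff hr.le] at *
        intro j
        exact hz' j.succ
      rw [hC z hz' 0 hz0]
      obtain ⟨u, hu1, hu2⟩ := hunit _ hz0
      symm
      apply hΛ
      intro w
      rw [ContinuousMap.mul_apply, ← hu1, hu2, hG _ hzt]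
      rw [Algebra.smul_def]
      congr 2
      ext i
      refine Fin.cases ?_ (fun j => ?_) i
      · simp
      · simp [Fin.tail]
    refine AnalyticAt.congr ?_ hrep.symm
    obtain ⟨u, hu1, -⟩ := hunit (c 0) (mem_ball_self hr)
    have hproj : AnalyticAt ℂ (fun z : Fin (N+1) → ℂ => z 0) c :=
      (ContinuousLinearMap.proj (R := ℂ) (φ := fun _ : Fin (N+1) => ℂ) 0).analyticAt c
    have htail : AnalyticAt ℂ (fun z : Fin (N+1) → ℂ => Fin.tail z) c :=
      (ContinuousLinearMap.pi fun i : Fin N => ContinuousLinearMap.proj (R := ℂ) (φ := fun _ : Fin (N+1) => ℂ) i.succ).analyticAt c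
    have ha1 : AnalyticAt ℂ (fun z : Fin (N+1) → ℂ => ι - algebraMap ℂ C(sphere (c 0) r, A) (z 0)) c := by
      refine analyticAt_const.sub ?_
      exact ((Algebra.linearMap ℂ C(sphere (c 0) r, A)).toContinuousLinearMap.analyticAt _).comp hproj
    have ha2 : AnalyticAt ℂ (fun z : Fin (N+1) → ℂ => Ring.inverse (ι - algebraMap ℂ C(sphere (c 0) r, A) (z 0))) c := by
      refine AnalyticAt.fun_comp (g := Ring.inverse) ?_ ha1
      rw [← hu1]
      exact analyticAt_inverse u
    have ha3 : AnalyticAt ℂ (fun z : Fin (N+1) → ℂ => G (Fin.tail z)) c :=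
      AnalyticAt.fun_comp (g := G) hGa htail
    exact (Λ.analyticAt _).comp (ha2.mul ha3)

theorem osgood {N : ℕ} {V : Set (Fin N → ℂ)} (hV : IsOpen V) {f : (Fin N → ℂ) → ℂ}
    (hc : ContinuousOn f V)
    (hd : ∀ z ∈ V, ∀ i, DifferentiableAt ℂ (fun w => f (Function.update z i w)) (z i)) :
    AnalyticOnNhd ℂ f V := by
  intro c hcV
  obtain ⟨r, hr, hrV⟩ := Metric.isOpen_iff.1 hV c hcV
  have hsub : closedBall c (r/2) ⊆ V := (closedBall_subset_ball (by linarith)).trans hrV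
  refine osgood_aux N ℂ f c (r/2) (by positivity) (hc.mono hsub) ?_
  intro z hz i hzi
  have hup : ∀ w ∈ closedBall (c i) (r/2), Function.update z i w ∈ closedBall c (r/2) := by
    intro w hw
    rw [mem_closedBall, dist_pi_le_iff (by positivity)] at *
    intro j
    by_cases hj : j = i
    · subst hj; simpa using hw
    · simpa [Function.update_of_ne hj] using hz j
  have hdiff : DifferentiableOn ℂ (fun w => f (Function.update z i w)) (closedBall (c i) (r/2)) := by
    intro w hw
    have := hd _ (hsub (hup w hw)) i
    simp only [Function.update_idem, Function.update_self] at this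
    exact this.differentiableWithinAt
  have h2 : DiffContOnCl ℂ (fun w => f (Function.update z i w)) (ball (c i) (r/2)) := by
    refine DifferentiableOn.diffContOnCl ?_
    rwa [closure_ball _ (by positivity)]
  have h3 := h2.circleIntegral_sub_inv_smul hzi
  rw [h3]
  simp only [Function.update_eq_self, smul_eq_mul]
  rw [← mul_assoc, inv_mul_cancel₀, one_mul]
  simp [Real.pi_ne_zero]

lemma hasDerivAt_integral_holo {T : Type*} [MeasurableSpace T] {μ : Measure T} {c : ℂ} {r : ℝ}
    (hr : 0 < r) (g : T → ℂ → ℂ) (W : T → ℝ) (hW : Integrable W μ)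
    (hm : ∀ x ∈ ball c r, AEStronglyMeasurable (fun t => g t x) μ)
    (hd : ∀ᵐ t ∂μ, DifferentiableOn ℂ (g t) (ball c r))
    (hb : ∀ᵐ t ∂μ, ∀ x ∈ ball c r, ‖g t x‖ ≤ W t) :
    DifferentiableAt ℂ (fun x => ∫ t, g t x ∂μ) c := by
  have hc0 : c ∈ ball c r := mem_ball_self hr
  have hr4 : 0 < r / 4 := by positivity
  have key := hasDerivAt_integral_of_dominated_loc_of_deriv_le (μ := μ) (𝕜 := ℂ) (F := fun x t => g t x)
    (F' := fun x t => deriv (g t) x) (x₀ := c) (s := ball c (r/4)) (bound := fun t => W t / (r/4))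
    (ball_mem_nhds c hr4) ?_ ?_ ?_ ?_ ?_ ?_
  · exact key.2.differentiableAt
  · filter_upwards [ball_mem_nhds c hr] with x hx using hm x hx
  · refine hW.mono' (hm c hc0) ?_
    filter_upwards [hb] with t ht using ht c hc0
  · have hseq : Tendsto (fun m : ℕ => (r / (m + 2) : ℝ)) atTop (𝓝 0) := by
      have h1 : Tendsto (fun m : ℕ => (m : ℝ) + 2) atTop atTop :=
        tendsto_atTop_add_const_right _ _ tendsto_natCast_atTop_atTop
      exact h1.const_div_atTop r
    have hseq' : Tendsto (fun m : ℕ => ((r / (m + 2) : ℝ) : ℂ)) atTop (𝓝[≠] 0) := by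
      rw [tendsto_nhdsWithin_iff]
      constructor
      · have := (Complex.continuous_ofReal.tendsto 0).comp hseq
        exact this
      · filter_upwards with m
        simp only [mem_compl_iff, mem_singleton_iff, Complex.ofReal_eq_zero]
        have : (0:ℝ) < m + 2 := by positivity
        positivity
    refine aestronglyMeasurable_of_tendsto_ae atTop
      (f := fun (m : ℕ) t => ((r / (m + 2) : ℝ) : ℂ)⁻¹ • (g t (c + ((r / (m + 2) : ℝ) : ℂ)) - g t c)) ?_ ?_
    · intro m
      have hmm : c + ((r / (m + 2) : ℝ) : ℂ) ∈ ball c r → AEStronglyMeasurable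
          (fun t => ((r / (m + 2) : ℝ) : ℂ)⁻¹ • (g t (c + ((r / (m + 2) : ℝ) : ℂ)) - g t c)) μ :=
        fun h => ((hm _ h).sub (hm c hc0)).const_smul (((r / (m + 2) : ℝ) : ℂ)⁻¹)
      refine hmm ?_
      simp only [mem_ball, dist_self_add_left, Complex.norm_real]
      have h2 : (0:ℝ) < m + 2 := by positivity
      rw [Real.norm_of_nonneg (by positivity), div_lt_iff₀ h2]
      nlinarith [(Nat.cast_nonneg m : (0:ℝ) ≤ m)]
    · filter_upwards [hd] with t ht
      have h1 : HasDerivAt (g t) (deriv (g t) c) c :=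
        ((ht c hc0).differentiableAt (ball_mem_nhds c hr)).hasDerivAt
      have h2 := (hasDerivAt_iff_tendsto_slope_zero.1 h1).comp hseq'
      exact h2
  · filter_upwards [hd, hb] with t ht hbt x hx
    refine Complex.norm_deriv_le_of_forall_mem_sphere_norm_le hr4 ?_ ?_
    · refine DifferentiableOn.diffContOnCl ?_
      rw [closure_ball _ (by positivity)]
      refine ht.mono ?_
      intro y hy
      rw [mem_ball, mem_closedBall] at *
      linarith [dist_triangle y x c]
    · intro y hy
      refine hbt y ?_
      rw [mem_ball, mem_sphere] at *
      linarith [dist_triangle y x c]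
  · exact hW.div_const _
  · filter_upwards [hd] with t ht x hx
    refine ((ht x ?_).differentiableAt (isOpen_ball.mem_nhds ?_)).hasDerivAt <;>
    exact ball_subset_ball (by linarith) hx

theorem analyticOnNhd_integral_pi {T : Type*} [MeasurableSpace T] {μ : Measure T} {N : ℕ}
    {V : Set (Fin N → ℂ)} (hV : IsOpen V) (F : T → (Fin N → ℂ) → ℂ) (W : T → ℝ)
    (hW : Integrable W μ)
    (hm : ∀ x ∈ V, AEStronglyMeasurable (fun t => F t x) μ)
    (hd : ∀ᵐ t ∂μ, DifferentiableOn ℂ (F t) V)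
    (hb : ∀ᵐ t ∂μ, ∀ x ∈ V, ‖F t x‖ ≤ W t) :
    AnalyticOnNhd ℂ (fun x => ∫ t, F t x ∂μ) V := by
  refine osgood hV ?_ ?_
  · refine continuousOn_of_dominated (bound := W) hm ?_ hW ?_
    · intro x hx
      filter_upwards [hb] with t ht using ht x hx
    · filter_upwards [hd] with t ht using ht.continuousOn
  · intro z hz i
    obtain ⟨r, hr, hrV⟩ := Metric.isOpen_iff.1 hV z hz
    have hup : ∀ w ∈ ball (z i) r, Function.update z i w ∈ V := by
      intro w hw
      apply hrV
      rw [mem_ball, dist_pi_lt_iff hr]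
      intro j
      by_cases hj : j = i
      · subst hj; simpa using hw
      · simpa [Function.update_of_ne hj] using hr
    refine hasDerivAt_integral_holo hr (fun t w => F t (Function.update z i w)) W hW
      (fun x hx => hm _ (hup x hx)) ?_ ?_
    · filter_upwards [hd] with t ht
      refine ht.comp ?_ hup
      intro w _
      exact (hasDerivAt_update z i w).differentiableAt.differentiableWithinAt
    · filter_upwards [hb] with t ht x hx using ht _ (hup x hx)

theorem analyticOnNhd_integral {T : Type*} [MeasurableSpace T] {μ : Measure T}
    {E : Type*} [NormedAddCommGroup E] [NormedSpace ℂ E] [FiniteDimensional ℂ E]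
    {V : Set E} (hV : IsOpen V) (F : T → E → ℂ) (W : T → ℝ)
    (hW : Integrable W μ)
    (hm : ∀ x ∈ V, AEStronglyMeasurable (fun t => F t x) μ)
    (hd : ∀ᵐ t ∂μ, DifferentiableOn ℂ (F t) V)
    (hb : ∀ᵐ t ∂μ, ∀ x ∈ V, ‖F t x‖ ≤ W t) :
    AnalyticOnNhd ℂ (fun x => ∫ t, F t x ∂μ) V := by
  let e : E ≃L[ℂ] (Fin (Module.finrank ℂ E) → ℂ) :=
    ContinuousLinearEquiv.ofFinrankEq (by simp)
  have h := analyticOnNhd_integral_pi (μ := μ) (V := e.symm ⁻¹' V)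
    (hV.preimage e.symm.continuous) (fun t x => F t (e.symm x)) W hW
    (fun x hx => hm _ hx) ?_ ?_
  · intro x hx
    have h1 := (h (e x) (by simpa using hx))
    have h2 : AnalyticAt ℂ (fun x => e x) x := e.toContinuousLinearMap.analyticAt x
    have h3 := AnalyticAt.fun_comp (f := fun x => e x) h1 h2
    simpa using h3
  · filter_upwards [hd] with t ht
    exact ht.comp e.symm.differentiable.differentiableOn (fun x hx => hx)
  · filter_upwards [hb] with t ht x hx using ht _ hx

end JacIdeal

namespace JacIdeal
open MeasureTheory Metric Set Filter Topology

/-- The operator `L ↦ (L e_j + i L (i e_j)) / 2`. -/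
noncomputable def dbarL {n : ℕ} (j : Fin n) (L : (Fin n → ℂ) →L[ℝ] ℂ) : ℂ :=
  (1 / 2) * (L (Pi.single j 1) + Complex.I * L (Pi.single j Complex.I))

/-- The Cauchy-Riemann operator in the `j`-th variable. -/
noncomputable def dbar {n : ℕ} (j : Fin n) (u : (Fin n → ℂ) → ℂ) (ζ : Fin n → ℂ) : ℂ :=
  dbarL j (fderiv ℝ u ζ)

/-- `u` is real differentiable at `ζ` with Cauchy-Riemann derivatives `D`. -/
def HasDbar {n : ℕ} (u : (Fin n → ℂ) → ℂ) (D : Fin n → ℂ) (ζ : Fin n → ℂ) : Prop :=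
  DifferentiableAt ℝ u ζ ∧ ∀ j, dbar j u ζ = D j

variable {n : ℕ} {u v : (Fin n → ℂ) → ℂ} {D D' : Fin n → ℂ} {ζ : Fin n → ℂ}

lemma HasDbar.of_hasFDerivAt {L : (Fin n → ℂ) →L[ℝ] ℂ} (h : HasFDerivAt u L ζ)
    (hD : ∀ j, dbarL j L = D j) : HasDbar u D ζ :=
  ⟨h.differentiableAt, fun j => by rw [dbar, h.fderiv, hD]⟩

lemma HasDbar.congr_D (h : HasDbar u D ζ) (hD : ∀ j, D j = D' j) : HasDbar u D' ζ :=
  ⟨h.1, fun j => by rw [h.2, hD]⟩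

lemma DifferentiableAt.hasDbar (h : DifferentiableAt ℝ u ζ) : HasDbar u (fun j => dbar j u ζ) ζ :=
  ⟨h, fun _ => rfl⟩

lemma HasDbar.const (c : ℂ) : HasDbar (fun _ => c) (fun _ => 0) ζ :=
  HasDbar.of_hasFDerivAt (hasFDerivAt_const c ζ) (by simp [dbarL])

lemma HasDbar.add (hu : HasDbar u D ζ) (hv : HasDbar v D' ζ) :
    HasDbar (fun ζ => u ζ + v ζ) (fun j => D j + D' j) ζ :=
  HasDbar.of_hasFDerivAt (hu.1.hasFDerivAt.add hv.1.hasFDerivAt) (fun j => by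
    rw [← hu.2, ← hv.2]; simp [dbar, dbarL]; ring)

lemma HasDbar.sub (hu : HasDbar u D ζ) (hv : HasDbar v D' ζ) :
    HasDbar (fun ζ => u ζ - v ζ) (fun j => D j - D' j) ζ :=
  HasDbar.of_hasFDerivAt (hu.1.hasFDerivAt.sub hv.1.hasFDerivAt) (fun j => by
    rw [← hu.2, ← hv.2]; simp [dbar, dbarL]; ring)

lemma HasDbar.mul (hu : HasDbar u D ζ) (hv : HasDbar v D' ζ) :
    HasDbar (fun ζ => u ζ * v ζ) (fun j => u ζ * D' j + v ζ * D j) ζ :=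
  HasDbar.of_hasFDerivAt (hu.1.hasFDerivAt.mul hv.1.hasFDerivAt) (fun j => by
    rw [← hu.2, ← hv.2]; simp [dbar, dbarL]; ring)

lemma HasDbar.sum {ι : Type*} {s : Finset ι} {u : ι → (Fin n → ℂ) → ℂ} {D : ι → Fin n → ℂ}
    (h : ∀ i ∈ s, HasDbar (u i) (D i) ζ) :
    HasDbar (fun ζ => ∑ i ∈ s, u i ζ) (fun j => ∑ i ∈ s, D i j) ζ := by
  classical
  induction s using Finset.induction_on with
  | empty => simpa using HasDbar.const 0
  | insert a s ha ih =>
    simp only [Finset.sum_insert ha]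
    exact (h a (by simp)).add (ih fun i hi => h i (by simp [hi]))

lemma HasDbar.prod_zero {ι : Type*} {s : Finset ι} {u : ι → (Fin n → ℂ) → ℂ} {D : ι → Fin n → ℂ}
    (M : Fin n → ℂ) (h : ∀ i ∈ s, HasDbar (u i) (D i) ζ) (hM : ∀ i ∈ s, ∑ j, M j * D i j = 0) :
    ∃ D', HasDbar (fun ζ => ∏ i ∈ s, u i ζ) D' ζ ∧ ∑ j, M j * D' j = 0 := by
  classical
  induction s using Finset.induction_on with
  | empty => exact ⟨fun _ => 0, by simpa using HasDbar.const 1, by simp⟩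
  | insert a s ha ih =>
    obtain ⟨D', h1, h2⟩ := ih (fun i hi => h i (by simp [hi])) (fun i hi => hM i (by simp [hi]))
    simp only [Finset.prod_insert ha]
    refine ⟨_, (h a (by simp)).mul h1, ?_⟩
    have h3 := hM a (by simp)
    calc _ = u a ζ * ∑ j, M j * D' j + (∏ i ∈ s, u i ζ) * ∑ j, M j * D a j := by
            simp only [Finset.mul_sum, ← Finset.sum_add_distrib]
            exact Finset.sum_congr rfl fun j _ => by ring
      _ = 0 := by rw [h2, h3]; simp

lemma HasDbar.holo (h : DifferentiableAt ℂ u ζ) : HasDbar u (fun _ => 0) ζ := by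
  refine HasDbar.of_hasFDerivAt (h.hasFDerivAt.restrictScalars ℝ) (fun j => ?_)
  have : (Pi.single j Complex.I : Fin n → ℂ) = Complex.I • Pi.single j 1 := by
    rw [← Pi.single_smul]; simp
  simp only [dbarL, ContinuousLinearMap.coe_restrictScalars', this, map_smul, smul_eq_mul]
  rw [← mul_assoc, Complex.I_mul_I]; ring

lemma HasDbar.conj_holo (h : DifferentiableAt ℂ u ζ) :
    HasDbar (fun ζ => (starRingEnd ℂ) (u ζ))
      (fun j => (starRingEnd ℂ) (fderiv ℂ u ζ (Pi.single j 1))) ζ := by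
  have h1 : HasFDerivAt (fun ζ => (starRingEnd ℂ) (u ζ))
      ((Complex.conjCLE : ℂ →L[ℝ] ℂ).comp ((fderiv ℂ u ζ).restrictScalars ℝ)) ζ :=
    (Complex.conjCLE : ℂ →L[ℝ] ℂ).hasFDerivAt.comp ζ (h.hasFDerivAt.restrictScalars ℝ)
  refine HasDbar.of_hasFDerivAt h1 (fun j => ?_)
  have : (Pi.single j Complex.I : Fin n → ℂ) = Complex.I • Pi.single j 1 := by
    rw [← Pi.single_smul]; simp
  simp only [dbarL, ContinuousLinearMap.coe_comp, Function.comp_apply,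
    ContinuousLinearMap.coe_restrictScalars', this, map_smul, smul_eq_mul,
    ContinuousLinearEquiv.coe_coe, Complex.conjCLE_apply, map_mul, Complex.conj_I]
  linear_combination (-(1/2 : ℂ) * (starRingEnd ℂ) (fderiv ℂ u ζ (Pi.single j 1))) * Complex.I_mul_I

lemma HasDbar.comp_real {ρ : (Fin n → ℂ) → ℝ} {h : ℝ → ℂ} {h' : ℂ}
    (hρ : HasDbar (fun ζ => (ρ ζ : ℂ)) D ζ) (hh : HasDerivAt h h' (ρ ζ)) :
    HasDbar (fun ζ => h (ρ ζ)) (fun j => h' * D j) ζ := by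
  have h0 : DifferentiableAt ℝ ρ ζ := by
    have := Complex.reCLM.differentiableAt.comp ζ hρ.1
    exact this
  have h1 : HasFDerivAt (fun ζ => (ρ ζ : ℂ)) (Complex.ofRealCLM.comp (fderiv ℝ ρ ζ)) ζ :=
    Complex.ofRealCLM.hasFDerivAt.comp ζ h0.hasFDerivAt
  have h2 := hh.hasFDerivAt.comp ζ h0.hasFDerivAt
  refine HasDbar.of_hasFDerivAt h2 (fun j => ?_)
  rw [← hρ.2, dbar, h1.fderiv]
  simp [dbarL]
  ring

lemma HasDbar.inv (hu : HasDbar u D ζ) (h0 : u ζ ≠ 0) :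
    HasDbar (fun ζ => (u ζ)⁻¹) (fun j => - D j / (u ζ)^2) ζ := by
  have h1 : HasFDerivAt (fun ζ => (u ζ)⁻¹) _ ζ :=
    ((hasDerivAt_inv h0).hasFDerivAt.restrictScalars ℝ).comp ζ hu.1.hasFDerivAt
  refine HasDbar.of_hasFDerivAt h1 (fun j => ?_)
  rw [← hu.2]
  simp [dbar, dbarL]
  ring

lemma HasDbar.fconj_eq (h : HasDbar u D ζ) : ∀ j, dbar j u ζ = D j := h.2

lemma HasDbar.congr (h : HasDbar u D ζ) (huv : v =ᶠ[𝓝 ζ] u) : HasDbar v D ζ :=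
  ⟨h.1.congr_of_eventuallyEq huv, fun j => by rw [dbar, huv.fderiv_eq]; exact h.2 j⟩

lemma dbar_congr (huv : v =ᶠ[𝓝 ζ] u) (j : Fin n) : dbar j v ζ = dbar j u ζ := by
  rw [dbar, huv.fderiv_eq]; rfl

/-- `dbarL j` as a continuous linear map. -/
noncomputable def dbarLC (j : Fin n) : ((Fin n → ℂ) →L[ℝ] ℂ) →L[ℝ] ℂ :=
  (1 / 2 : ℝ) • (ContinuousLinearMap.apply ℝ ℂ (Pi.single j 1) +
    (ContinuousLinearMap.mul ℝ ℂ Complex.I).comp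
      (ContinuousLinearMap.apply ℝ ℂ (Pi.single j Complex.I)))

lemma dbarLC_apply (j : Fin n) (L : (Fin n → ℂ) →L[ℝ] ℂ) : dbarLC j L = dbarL j L := by
  simp [dbarLC, dbarL]
  ring

lemma dbar_contDiffAt {k : Fin n} {m : ℕ∞} (h : ContDiffAt ℝ (m + 1) u ζ) :
    ContDiffAt ℝ m (dbar k u) ζ := by
  have h1 : ContDiffAt ℝ m (fderiv ℝ u) ζ := h.fderiv_right le_rfl
  have h2 : dbar k u = fun ζ => dbarLC k (fderiv ℝ u ζ) := by
    ext ζ; rw [dbarLC_apply, dbar]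
  rw [h2]
  exact (dbarLC k).contDiff.contDiffAt.comp ζ h1

lemma dbar_comm (h : ContDiffAt ℝ 2 u ζ) (j k : Fin n) :
    dbar j (dbar k u) ζ = dbar k (dbar j u) ζ := by
  have h1 : DifferentiableAt ℝ (fderiv ℝ u) ζ :=
    (h.fderiv_right (m := 1) (by norm_num)).differentiableAt (by norm_num)
  have hs : IsSymmSndFDerivAt ℝ u ζ := h.isSymmSndFDerivAt (by simp)
  have h2 : ∀ k : Fin n, fderiv ℝ (dbar k u) ζ = (dbarLC k).comp (fderiv ℝ (fderiv ℝ u) ζ) := by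
    intro k
    have h2 : dbar k u = fun ζ => dbarLC k (fderiv ℝ u ζ) := by
      ext ζ; rw [dbarLC_apply, dbar]
    rw [h2]
    exact ((dbarLC k).hasFDerivAt.comp ζ h1.hasFDerivAt).fderiv
  rw [dbar, dbar, h2, h2]
  simp only [dbarL, ContinuousLinearMap.coe_comp, Function.comp_apply, dbarLC_apply]
  rw [hs (Pi.single j 1) (Pi.single k 1), hs (Pi.single j 1) (Pi.single k Complex.I),
    hs (Pi.single j Complex.I) (Pi.single k 1), hs (Pi.single j Complex.I) (Pi.single k Complex.I)]
  ring

/-- Determinant as a real continuous multilinear map of the rows. -/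
noncomputable def detCM (n : ℕ) : ContinuousMultilinearMap ℝ (fun _ : Fin n => Fin n → ℂ) ℂ :=
  ContinuousMultilinearMap.restrictScalars ℝ
    (⟨(Matrix.detRowAlternating (n := Fin n) (R := ℂ)).toMultilinearMap,
      Continuous.matrix_det (A := fun x : Fin n → Fin n → ℂ => (x : Matrix (Fin n) (Fin n) ℂ)) continuous_id⟩ :
    ContinuousMultilinearMap ℂ (fun _ : Fin n => Fin n → ℂ) ℂ)

lemma detCM_apply (M : Matrix (Fin n) (Fin n) ℂ) : detCM n M = M.det := rfl

lemma HasDbar.det {M : (Fin n → ℂ) → Matrix (Fin n) (Fin n) ℂ} {D : Fin n → Fin n → Fin n → ℂ}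
    (h : ∀ i l, HasDbar (fun ζ => M ζ i l) (D i l) ζ) :
    HasDbar (fun ζ => (M ζ).det)
      (fun j => ∑ i, ((M ζ).updateRow i (fun l => D i l j)).det) ζ := by
  let R : (Fin n → ℂ) → Fin n → Fin n → ℂ := fun ζ i l => M ζ i l
  have h0 : HasFDerivAt R (ContinuousLinearMap.pi fun i =>
      ContinuousLinearMap.pi fun l => fderiv ℝ (fun ζ => M ζ i l) ζ) ζ := by
    rw [hasFDerivAt_pi]
    intro i
    rw [hasFDerivAt_pi]
    intro l
    exact (h i l).1.hasFDerivAt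
  have h1 := ((detCM n).hasFDerivAt (R ζ)).comp ζ h0
  have key : ∀ i j, ((M ζ).updateRow i (fun l => D i l j)).det = (1/2 : ℂ) *
      (((M ζ).updateRow i (fun l => fderiv ℝ (fun ζ => M ζ i l) ζ (Pi.single j 1))).det
      + Complex.I * ((M ζ).updateRow i (fun l => fderiv ℝ (fun ζ => M ζ i l) ζ (Pi.single j Complex.I))).det) := by
    intro i j
    have : (fun l => D i l j) = (1/2 : ℂ) • ((fun l => fderiv ℝ (fun ζ => M ζ i l) ζ (Pi.single j 1))
        + Complex.I • (fun l => fderiv ℝ (fun ζ => M ζ i l) ζ (Pi.single j Complex.I))) := by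
      ext l
      rw [← (h i l).2 j]
      simp [dbar, dbarL]
    rw [this, Matrix.det_updateRow_smul, Matrix.det_updateRow_add, Matrix.det_updateRow_smul]
  refine HasDbar.of_hasFDerivAt h1 (fun j => ?_)
  simp only [key, ← Finset.mul_sum, Finset.sum_add_distrib]
  simp only [dbarL, ContinuousLinearMap.coe_comp, Function.comp_apply,
    ContinuousMultilinearMap.linearDeriv_apply]
  rfl

lemma det_updateRow_eq_sum (M : Matrix (Fin n) (Fin n) ℂ) (k : Fin n) (v : Fin n → ℂ) :
    (M.updateRow k v).det = ∑ l, v l * M.adjugate l k := by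
  rw [Matrix.det_eq_sum_mul_adjugate_row _ k]
  refine Finset.sum_congr rfl fun l _ => ?_
  rw [Matrix.updateRow_self, Matrix.adjugate_apply, Matrix.adjugate_apply, Matrix.updateRow_idem]

lemma hasDbar_adj {S : Fin n → (Fin n → ℂ) → ℂ} (hS : ∀ i, ContDiffAt ℝ 2 (S i) ζ) (i j : Fin n) :
    HasDbar (fun ζ => (Matrix.of fun i j => dbar j (S i) ζ).adjugate j i)
      (fun m => ∑ k, (((Matrix.of fun i j => dbar j (S i) ζ).updateRow i (Pi.single j 1)).updateRow k
        (fun l => if k = i then 0 else dbar m (dbar l (S k)) ζ)).det) ζ := by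
  simp only [Matrix.adjugate_apply]
  refine HasDbar.det (M := fun ζ => (Matrix.of fun i j => dbar j (S i) ζ).updateRow i (Pi.single j 1))
    (D := fun k l m => if k = i then 0 else dbar m (dbar l (S k)) ζ) ?_
  intro k l
  by_cases hk : k = i
  · subst hk
    simp only [Matrix.updateRow_self, if_true]
    exact HasDbar.const _
  · simp only [Matrix.updateRow_ne hk, if_neg hk, Matrix.of_apply]
    exact DifferentiableAt.hasDbar ((dbar_contDiffAt (m := 1) (by simpa [one_add_one_eq_two] using hS k)).differentiableAt (by norm_num))

lemma piola {S : Fin n → (Fin n → ℂ) → ℂ} (hS : ∀ i, ContDiffAt ℝ 2 (S i) ζ) (i : Fin n) :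
    ∑ j, dbar j (fun ζ => (Matrix.of fun i j => dbar j (S i) ζ).adjugate j i) ζ = 0 := by
  simp only [fun j => (hasDbar_adj hS i j).2 j]
  rw [Finset.sum_comm]
  refine Finset.sum_eq_zero fun k _ => ?_
  by_cases hk : k = i
  · simp only [if_pos hk]
    refine Finset.sum_eq_zero fun j _ => ?_
    refine Matrix.det_eq_zero_of_row_eq_zero k fun l => ?_
    rw [Matrix.updateRow_self]
  · simp only [if_neg hk]
    set M := Matrix.of fun i j => dbar j (S i) ζ
    simp_rw [fun j => det_updateRow_eq_sum (M.updateRow i (Pi.single j 1)) k, Matrix.adjugate_apply]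
    set A : Fin n → Fin n → ℂ := fun j l => ((M.updateRow i (Pi.single j 1)).updateRow k (Pi.single l 1)).det
    have hA : ∀ j l, A l j = - A j l := by
      intro j l
      have h1 : (M.updateRow i (Pi.single l 1)).updateRow k (Pi.single j 1) =
        ((M.updateRow i (Pi.single j 1)).updateRow k (Pi.single l 1)).submatrix (Equiv.swap i k) id := by
        ext a b
        rw [Matrix.submatrix_apply, id]
        by_cases ha : a = i
        · subst ha
          rw [Equiv.swap_apply_left, Matrix.updateRow_self, Matrix.updateRow_ne (Ne.symm hk), Matrix.updateRow_self]
        · by_cases hak : a = k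
          · subst hak
            rw [Equiv.swap_apply_right, Matrix.updateRow_self, Matrix.updateRow_ne (Ne.symm hk), Matrix.updateRow_self]
          · rw [Equiv.swap_apply_of_ne_of_ne ha hak, Matrix.updateRow_ne hak, Matrix.updateRow_ne ha,
              Matrix.updateRow_ne hak, Matrix.updateRow_ne ha]
      simp only [A]
      rw [h1, Matrix.det_permute, Equiv.Perm.sign_swap (Ne.symm hk)]
      simp
    have hX : ∑ j, ∑ l, dbar j (dbar l (S k)) ζ * A j l = - ∑ j, ∑ l, dbar j (dbar l (S k)) ζ * A j l := by
      conv_lhs => rw [Finset.sum_comm]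
      rw [← Finset.sum_neg_distrib]
      refine Finset.sum_congr rfl fun j _ => ?_
      rw [← Finset.sum_neg_distrib]
      refine Finset.sum_congr rfl fun l _ => ?_
      rw [hA, dbar_comm (hS k)]
      ring
    exact self_eq_neg.1 hX

end JacIdeal

namespace JacIdeal
open MeasureTheory Metric Set Filter Topology

variable {n : ℕ}

lemma integral_fderiv_zero {V : (Fin n → ℂ) → ℂ} (hV : ContDiff ℝ 1 V) (hc : HasCompactSupport V)
    (w : Fin n → ℂ) : ∫ ζ, fderiv ℝ V ζ w = 0 := by
  have hcont : Continuous fun ζ => fderiv ℝ V ζ w :=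
    (hV.continuous_fderiv (by norm_num)).clm_apply continuous_const
  have hcs : HasCompactSupport fun ζ => fderiv ℝ V ζ w := hc.fderiv_apply (𝕜 := ℝ) w
  have h := integral_mul_fderiv_eq_neg_fderiv_mul_of_integrable (μ := (volume : Measure (Fin n → ℂ))) (𝕜 := ℂ)
    (f := fun _ => (1:ℂ)) (g := V) (v := w) ?_ ?_ ?_ ?_ ?_
  · simpa using h
  · simp
  · simpa using hcont.integrable_of_hasCompactSupport hcs
  · simpa using hV.continuous.integrable_of_hasCompactSupport hc
  · fun_prop
  · exact fun x _ => hV.differentiable (by norm_num) x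

lemma integral_dbar_zero {V : (Fin n → ℂ) → ℂ} (hV : ContDiff ℝ 1 V) (hc : HasCompactSupport V)
    (j : Fin n) : ∫ ζ, dbar j V ζ = 0 := by
  have hIg : ∀ w : Fin n → ℂ, Integrable (fun ζ => fderiv ℝ V ζ w) volume := fun w =>
    ((hV.continuous_fderiv (by norm_num)).clm_apply continuous_const).integrable_of_hasCompactSupport
      (hc.fderiv_apply (𝕜 := ℝ) w)
  simp only [dbar, dbarL]
  rw [integral_const_mul, integral_add (hIg _) ((hIg _).const_mul _), integral_const_mul,
    integral_fderiv_zero hV hc, integral_fderiv_zero hV hc]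
  simp

/-- zero extension -/
lemma contDiff_indicator {Ω K : Set (Fin n → ℂ)} (hΩ : IsOpen Ω) (hK : IsCompact K) (hKΩ : K ⊆ Ω)
    {m : ℕ∞}
    {V : (Fin n → ℂ) → ℂ} (hV : ∀ ζ ∈ Ω, ContDiffAt ℝ m V ζ) (h0 : ∀ ζ ∈ Ω, ζ ∉ K → V ζ = 0) :
    ContDiff ℝ m (Ω.indicator V) ∧ HasCompactSupport (Ω.indicator V) ∧
    (∀ ζ ∈ Ω, Ω.indicator V =ᶠ[𝓝 ζ] V) ∧ (∀ ζ ∉ K, Ω.indicator V =ᶠ[𝓝 ζ] fun _ => 0) := by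
  have h1 : ∀ ζ ∈ Ω, Ω.indicator V =ᶠ[𝓝 ζ] V := by
    intro ζ hζ
    filter_upwards [hΩ.mem_nhds hζ] with x hx
    exact indicator_of_mem hx V
  have h2 : ∀ ζ ∉ K, Ω.indicator V =ᶠ[𝓝 ζ] fun _ => 0 := by
    intro ζ hζ
    filter_upwards [hK.isClosed.isOpen_compl.mem_nhds hζ] with x hx
    by_cases hxΩ : x ∈ Ω
    · rw [indicator_of_mem hxΩ, h0 x hxΩ hx]
    · exact indicator_of_notMem hxΩ V
  refine ⟨?_, ?_, h1, h2⟩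
  · rw [contDiff_iff_contDiffAt]
    intro ζ
    by_cases hζ : ζ ∈ Ω
    · exact (hV ζ hζ).congr_of_eventuallyEq (h1 ζ hζ)
    · exact contDiffAt_const.congr_of_eventuallyEq (h2 ζ fun h => hζ (hKΩ h))
  · refine HasCompactSupport.intro hK fun ζ hζ => ?_
    exact (h2 ζ hζ).self_of_nhds

lemma dbar_zero_of_eventuallyEq {V : (Fin n → ℂ) → ℂ} {ζ : Fin n → ℂ} (h : V =ᶠ[𝓝 ζ] fun _ => 0) (j : Fin n) :
    dbar j V ζ = 0 := by
  rw [dbar_congr h]; exact (HasDbar.const 0).2 j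

lemma integral_dbar_zero_on {Ω K : Set (Fin n → ℂ)} (hΩ : IsOpen Ω) (hK : IsCompact K) (hKΩ : K ⊆ Ω)
    {V : (Fin n → ℂ) → ℂ} (hV : ∀ ζ ∈ Ω, ContDiffAt ℝ 1 V ζ) (h0 : ∀ ζ ∈ Ω, ζ ∉ K → V ζ = 0)
    (j : Fin n) : IntegrableOn (dbar j V) Ω ∧ ∫ ζ in Ω, dbar j V ζ = 0 := by
  obtain ⟨h1, h2, h3, h4⟩ := contDiff_indicator (m := 1) hΩ hK hKΩ hV h0
  have heq : Ω.indicator (dbar j V) = dbar j (Ω.indicator V) := by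
    ext ζ
    by_cases hζ : ζ ∈ Ω
    · rw [indicator_of_mem hζ, dbar_congr (h3 ζ hζ)]
    · rw [indicator_of_notMem hζ, dbar_zero_of_eventuallyEq (h4 ζ fun h => hζ (hKΩ h))]
  constructor
  · rw [← integrable_indicator_iff hΩ.measurableSet, heq]
    refine Continuous.integrable_of_hasCompactSupport ?_ ?_
    · exact (contDiff_iff_contDiffAt.2 fun ζ =>
        dbar_contDiffAt (k := j) (m := 0) (by simpa using h1.contDiffAt)).continuous
    · refine HasCompactSupport.intro hK fun ζ hζ => ?_
      exact dbar_zero_of_eventuallyEq (h4 ζ hζ) j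
  · rw [← integral_indicator hΩ.measurableSet, heq, integral_dbar_zero h1 h2]

/-- The matrix of Cauchy-Riemann derivatives. -/
noncomputable def dbarM (S : Fin n → (Fin n → ℂ) → ℂ) (ζ : Fin n → ℂ) : Matrix (Fin n) (Fin n) ℂ :=
  Matrix.of fun i j => dbar j (S i) ζ

lemma contDiffAt_det {m : ℕ∞} {M : (Fin n → ℂ) → Matrix (Fin n) (Fin n) ℂ} {ζ : Fin n → ℂ}
    (h : ∀ i l, ContDiffAt ℝ m (fun ζ => M ζ i l) ζ) : ContDiffAt ℝ m (fun ζ => (M ζ).det) ζ := by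
  simp only [Matrix.det_apply]
  refine ContDiffAt.sum fun σ _ => ?_
  refine ContDiffAt.const_smul _ ?_
  exact contDiffAt_prod fun i _ => h _ _

lemma contDiffAt_adj {S : Fin n → (Fin n → ℂ) → ℂ} {ζ : Fin n → ℂ}
    (hS : ∀ i, ContDiffAt ℝ 2 (S i) ζ) (i j : Fin n) :
    ContDiffAt ℝ 1 (fun ζ => (dbarM S ζ).adjugate j i) ζ := by
  simp only [Matrix.adjugate_apply]
  refine contDiffAt_det (m := 1) fun k l => ?_
  by_cases hk : k = i
  · subst hk
    simp only [Matrix.updateRow_self]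
    exact contDiffAt_const
  · simp only [Matrix.updateRow_ne hk, dbarM, Matrix.of_apply]
    exact dbar_contDiffAt (m := 1) (by simpa [one_add_one_eq_two] using hS k)

theorem integral_det_zero {Ω K : Set (Fin n → ℂ)} (hΩ : IsOpen Ω) (hK : IsCompact K) (hKΩ : K ⊆ Ω)
    {S T : Fin n → (Fin n → ℂ) → ℂ} (hS : ∀ ζ ∈ Ω, ∀ i, ContDiffAt ℝ 2 (S i) ζ)
    (hT : ∀ ζ ∈ Ω, ∀ i, ContDiffAt ℝ 1 (T i) ζ)
    (h0 : ∀ ζ ∈ Ω, ζ ∉ K → ∀ j, ∑ i, (dbarM S ζ).adjugate j i * T i ζ = 0) :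
    IntegrableOn (fun ζ => ∑ i, ((dbarM S ζ).updateRow i (fun j => dbar j (T i) ζ)).det) Ω ∧
    ∫ ζ in Ω, ∑ i, ((dbarM S ζ).updateRow i (fun j => dbar j (T i) ζ)).det = 0 := by
  have hV : ∀ j, ∀ ζ ∈ Ω, ContDiffAt ℝ 1 (fun ζ => ∑ i, (dbarM S ζ).adjugate j i * T i ζ) ζ := by
    intro j ζ hζ
    exact ContDiffAt.sum fun i _ => (contDiffAt_adj (hS ζ hζ) i j).mul (hT ζ hζ i)
  have hI := fun j => integral_dbar_zero_on hΩ hK hKΩ (hV j) (fun ζ hζ hk => h0 ζ hζ hk j) j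
  have heq : ∀ ζ ∈ Ω, ∑ j, dbar j (fun ζ => ∑ i, (dbarM S ζ).adjugate j i * T i ζ) ζ =
      ∑ i, ((dbarM S ζ).updateRow i (fun j => dbar j (T i) ζ)).det := by
    intro ζ hζ
    have h1 : ∀ j, dbar j (fun ζ => ∑ i, (dbarM S ζ).adjugate j i * T i ζ) ζ =
        ∑ i, ((dbarM S ζ).adjugate j i * dbar j (T i) ζ +
          T i ζ * dbar j (fun ζ => (dbarM S ζ).adjugate j i) ζ) := by
      intro j
      refine (HasDbar.sum (D := fun i j' => (dbarM S ζ).adjugate j i * dbar j' (T i) ζ +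
          T i ζ * dbar j' (fun ζ => (dbarM S ζ).adjugate j i) ζ) fun i _ => ?_).2 j
      exact (DifferentiableAt.hasDbar ((contDiffAt_adj (hS ζ hζ) i j).differentiableAt (by norm_num))).mul
        (DifferentiableAt.hasDbar ((hT ζ hζ i).differentiableAt (by norm_num)))
    simp only [h1]
    rw [Finset.sum_comm]
    refine Finset.sum_congr rfl fun i _ => ?_
    rw [Finset.sum_add_distrib, ← Finset.mul_sum, det_updateRow_eq_sum]
    have := piola (hS ζ hζ) i
    rw [show ∑ j, dbar j (fun ζ => (dbarM S ζ).adjugate j i) ζ = 0 from this, mul_zero, add_zero]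
    exact Finset.sum_congr rfl fun j _ => mul_comm _ _
  constructor
  · refine IntegrableOn.congr_fun ?_ heq hΩ.measurableSet
    exact integrable_finsetSum _ fun j _ => (hI j).1
  · rw [← setIntegral_congr_fun hΩ.measurableSet heq, integral_finsetSum _ fun j _ => (hI j).1]
    exact Finset.sum_eq_zero fun j _ => (hI j).2

end JacIdeal

namespace JacIdeal
open MeasureTheory Metric Set Filter Topology

variable {n : ℕ}

/-- The holomorphic Jacobian determinant. -/
noncomputable def hJ (u : Fin n → (Fin n → ℂ) → ℂ) (ζ : Fin n → ℂ) : ℂ :=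
  Matrix.det (Matrix.of fun i j : Fin n => fderiv ℂ (u i) ζ (Pi.single j 1))

lemma analyticAt_det {E : Type*} [NormedAddCommGroup E] [NormedSpace ℂ E]
    {M : E → Matrix (Fin n) (Fin n) ℂ} {ζ : E}
    (h : ∀ i l, AnalyticAt ℂ (fun ζ => M ζ i l) ζ) : AnalyticAt ℂ (fun ζ => (M ζ).det) ζ := by
  simp only [Matrix.det_apply']
  refine Finset.analyticAt_fun_sum _ fun σ _ => ?_
  refine analyticAt_const.mul ?_
  exact Finset.analyticAt_fun_prod _ fun i _ => h _ _

lemma analyticAt_partial {u : (Fin n → ℂ) → ℂ} {ζ : Fin n → ℂ} (h : AnalyticAt ℂ u ζ)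
    (v : Fin n → ℂ) :
    AnalyticAt ℂ (fun ζ => fderiv ℂ u ζ v) ζ := by
  exact ((ContinuousLinearMap.apply ℂ ℂ v).analyticAt _).comp h.fderiv

lemma analyticAt_hJ {u : Fin n → (Fin n → ℂ) → ℂ} {ζ : Fin n → ℂ} (h : ∀ i, AnalyticAt ℂ (u i) ζ) :
    AnalyticAt ℂ (hJ u) ζ :=
  analyticAt_det (M := fun ζ => Matrix.of fun i j : Fin n => fderiv ℂ (u i) ζ (Pi.single j 1))
    fun i l => analyticAt_partial (h i) _

lemma AnalyticAt.contDiffAtR {u : (Fin n → ℂ) → ℂ} {ζ : Fin n → ℂ} (h : AnalyticAt ℂ u ζ) {m : WithTop ℕ∞} :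
    ContDiffAt ℝ m u ζ := (h.restrictScalars (𝕜 := ℝ)).contDiffAt

lemma AnalyticAt.contDiffAt_conj {u : (Fin n → ℂ) → ℂ} {ζ : Fin n → ℂ} (h : AnalyticAt ℂ u ζ)
    {m : WithTop ℕ∞} :
    ContDiffAt ℝ m (fun ζ => (starRingEnd ℂ) (u ζ)) ζ :=
  (Complex.conjCLE : ℂ →L[ℝ] ℂ).contDiff.contDiffAt.comp ζ (AnalyticAt.contDiffAtR h)

lemma AnalyticAt.contDiffAt_normSq {u : (Fin n → ℂ) → ℂ} {ζ : Fin n → ℂ} (h : AnalyticAt ℂ u ζ)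
    {m : WithTop ℕ∞} :
    ContDiffAt ℝ m (fun ζ => ‖u ζ‖^2) ζ := (AnalyticAt.contDiffAtR h).norm_sq ℝ

lemma hasDbar_normSq {u : (Fin n → ℂ) → ℂ} {ζ : Fin n → ℂ} (h : DifferentiableAt ℂ u ζ) :
    HasDbar (fun ζ => ((‖u ζ‖^2 : ℝ) : ℂ))
      (fun j => u ζ * (starRingEnd ℂ) (fderiv ℂ u ζ (Pi.single j 1))) ζ := by
  have h1 := (HasDbar.holo h).mul (HasDbar.conj_holo h)
  have h2 : (fun ζ => ((‖u ζ‖^2 : ℝ) : ℂ)) = fun ζ => u ζ * (starRingEnd ℂ) (u ζ) := by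
    ext ζ; rw [Complex.mul_conj']; push_cast; rfl
  rw [h2]
  exact h1.congr_D fun j => by simp

lemma ofReal_contDiffAt {ρ : (Fin n → ℂ) → ℝ} {ζ : Fin n → ℂ} {m : WithTop ℕ∞}
    (h : ContDiffAt ℝ m ρ ζ) :
    ContDiffAt ℝ m (fun ζ => (ρ ζ : ℂ)) ζ := Complex.ofRealCLM.contDiff.contDiffAt.comp ζ h

lemma hasDbar_rpow {u : (Fin n → ℂ) → ℂ} {ζ : Fin n → ℂ} (h : DifferentiableAt ℂ u ζ) {δ : ℝ} (hδ : 0 < δ)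
    (p : ℝ) :
    HasDbar (fun ζ => (((‖u ζ‖^2 + δ) ^ p : ℝ) : ℂ))
      (fun j => ((p * (‖u ζ‖^2 + δ) ^ (p - 1) : ℝ) : ℂ) *
        (u ζ * (starRingEnd ℂ) (fderiv ℂ u ζ (Pi.single j 1)))) ζ := by
  refine HasDbar.comp_real (h := fun x => (((x + δ) ^ p : ℝ) : ℂ)) (hasDbar_normSq h) ?_
  have h1 : HasDerivAt (fun x : ℝ => (x + δ) ^ p) (p * (‖u ζ‖^2 + δ) ^ (p - 1)) (‖u ζ‖^2) := by
    have := ((hasDerivAt_id (‖u ζ‖^2)).add_const δ).rpow_const (p := p) (Or.inl (by simp; positivity))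
    simpa using this
  exact h1.ofReal_comp

lemma contDiffAt_rpow {u : (Fin n → ℂ) → ℂ} {ζ : Fin n → ℂ} (h : AnalyticAt ℂ u ζ) {δ : ℝ} (hδ : 0 < δ)
    (p : ℝ) {m : WithTop ℕ∞} : ContDiffAt ℝ m (fun ζ => (‖u ζ‖^2 + δ) ^ p) ζ :=
  ContDiffAt.rpow_const_of_ne ((AnalyticAt.contDiffAt_normSq h).add contDiffAt_const)
    (by positivity)

lemma dbarM_conj {u : Fin n → (Fin n → ℂ) → ℂ} {ζ : Fin n → ℂ} (h : ∀ i, AnalyticAt ℂ (u i) ζ) (i j : Fin n) :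
    dbarM (fun i ζ => (starRingEnd ℂ) (u i ζ)) ζ i j =
      (starRingEnd ℂ) (fderiv ℂ (u i) ζ (Pi.single j 1)) :=
  (HasDbar.conj_holo (h i).differentiableAt).2 j

lemma dbarM_conj_eq {u : Fin n → (Fin n → ℂ) → ℂ} {ζ : Fin n → ℂ} (h : ∀ i, AnalyticAt ℂ (u i) ζ) :
    dbarM (fun i ζ => (starRingEnd ℂ) (u i ζ)) ζ =
      (starRingEnd ℂ).mapMatrix (Matrix.of fun i j : Fin n => fderiv ℂ (u i) ζ (Pi.single j 1)) := by
  ext i j; rw [dbarM_conj h]; rfl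

lemma det_dbarM_conj {u : Fin n → (Fin n → ℂ) → ℂ} {ζ : Fin n → ℂ} (h : ∀ i, AnalyticAt ℂ (u i) ζ) :
    (dbarM (fun i ζ => (starRingEnd ℂ) (u i ζ)) ζ).det = (starRingEnd ℂ) (hJ u ζ) := by
  rw [dbarM_conj_eq h, ← RingHom.map_det]; rfl

lemma adj_dbarM_conj {u : Fin n → (Fin n → ℂ) → ℂ} {ζ : Fin n → ℂ} (h : ∀ i, AnalyticAt ℂ (u i) ζ)
    (k l : Fin n) :
    (dbarM (fun i ζ => (starRingEnd ℂ) (u i ζ)) ζ).adjugate l k =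
      (starRingEnd ℂ) (hJ (Function.update u k (fun ζ => ζ l)) ζ) := by
  have h' : ∀ i, AnalyticAt ℂ (Function.update u k (fun ζ => ζ l) i) ζ := by
    intro i
    by_cases hi : i = k
    · subst hi
      rw [Function.update_self]
      exact (ContinuousLinearMap.proj (R := ℂ) (φ := fun _ : Fin n => ℂ) l).analyticAt ζ
    · rw [Function.update_of_ne hi]; exact h i
  rw [← det_dbarM_conj h', Matrix.adjugate_apply]
  congr 1
  ext i j
  by_cases hi : i = k
  · subst hi
    rw [Matrix.updateRow_self, dbarM_conj h', Function.update_self]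
    have : fderiv ℂ (fun ζ : Fin n → ℂ => ζ l) ζ
        = ContinuousLinearMap.proj (R := ℂ) (φ := fun _ : Fin n => ℂ) l :=
      (ContinuousLinearMap.proj (R := ℂ) (φ := fun _ : Fin n => ℂ) l).fderiv
    rw [this]
    simp [Pi.single_apply, eq_comm, apply_ite]
  · rw [Matrix.updateRow_ne hi, dbarM_conj h', Function.update_of_ne hi, dbarM_conj h]

lemma sum_adj_mul {M : Matrix (Fin n) (Fin n) ℂ} (i k : Fin n) :
    ∑ l, M.adjugate l k * M i l = if i = k then M.det else 0 := by
  have := congrFun (congrFun (Matrix.mul_adjugate M) i) k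
  rw [Matrix.mul_apply] at this
  simp only [mul_comm (M.adjugate _ _)]
  rw [this]
  simp [Matrix.one_apply]

lemma pointwise_ineq {w χ φ b : ℝ} {J X F : ℂ} (hw : 0 ≤ w) (hχ : 0 ≤ χ) (hφ : 0 ≤ φ) (hb : 0 ≤ b)
    (hF : ‖F‖^2 ≤ b * φ * ‖J‖^2) :
    (1/2) * (w * χ^2 * φ * ‖J‖^2) - 2 * (w * b * ‖X‖^2) ≤
      ((w * χ^2 * φ * ‖J‖^2 : ℝ) + 2 * χ * w * F * X : ℂ).re := by
  have h1 : -(2 * χ * w * ‖F‖ * ‖X‖) ≤ (2 * χ * w * F * X : ℂ).re := by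
    have := (abs_le.1 (Complex.abs_re_le_norm (2 * χ * w * F * X : ℂ))).1
    have h2 : ‖(2 * χ * w * F * X : ℂ)‖ = 2 * χ * w * ‖F‖ * ‖X‖ := by
      simp [abs_of_nonneg hw, abs_of_nonneg hχ]
    linarith
  rw [Complex.add_re, Complex.ofReal_re]
  have h3 : 2 * χ * w * ‖F‖ * ‖X‖ ≤ (1/2) * (w * χ^2 * φ * ‖J‖^2) + 2 * (w * b * ‖X‖^2) := by
    set s := Real.sqrt b
    set t := Real.sqrt φ
    have hs : s^2 = b := Real.sq_sqrt hb
    have ht : t^2 = φ := Real.sq_sqrt hφ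
    have hF' : ‖F‖ ≤ s * t * ‖J‖ := by
      refine abs_le_of_sq_le_sq' ?_ (by positivity) |>.2
      calc ‖F‖^2 ≤ b * φ * ‖J‖^2 := hF
        _ = _ := by rw [← hs, ← ht]; ring
    calc 2 * χ * w * ‖F‖ * ‖X‖ ≤ 2 * χ * w * (s * t * ‖J‖) * ‖X‖ := by gcongr
      _ ≤ _ := by
        rw [← hs, ← ht]
        nlinarith [mul_nonneg hw (sq_nonneg (χ * t * ‖J‖ - 2 * s * ‖X‖))]
  linarith

end JacIdeal

namespace JacIdeal
open MeasureTheory Metric Set Filter Topology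

variable {n : ℕ}

/-- weight -/
noncomputable def wt (u : Fin n → (Fin n → ℂ) → ℂ) (T : Finset (Fin n)) (p δ : ℝ) (ζ : Fin n → ℂ) : ℝ :=
  ∏ i ∈ T, (‖u i ζ‖^2 + δ) ^ p

lemma wt_pos (u : Fin n → (Fin n → ℂ) → ℂ) (T : Finset (Fin n)) (p : ℝ) {δ : ℝ} (hδ : 0 < δ) (ζ : Fin n → ℂ) :
    0 < wt u T p δ ζ := Finset.prod_pos fun i _ => by positivity

/-- the test function -/
noncomputable def testF (u : Fin n → (Fin n → ℂ) → ℂ) (k : Fin n) (a δ : ℝ) (ζ : Fin n → ℂ) : ℂ :=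
  ((a * (‖u k ζ‖^2 + δ) ^ (a - 1) : ℝ) : ℂ) * (starRingEnd ℂ) (u k ζ) * hJ u ζ

noncomputable def phiF (u : Fin n → (Fin n → ℂ) → ℂ) (k : Fin n) (a δ : ℝ) (ζ : Fin n → ℂ) : ℝ :=
  a * (‖u k ζ‖^2 + δ) ^ (a - 1) + a * ((a - 1) * (‖u k ζ‖^2 + δ) ^ (a - 1 - 1)) * ‖u k ζ‖^2

lemma phiF_eq (u : Fin n → (Fin n → ℂ) → ℂ) (k : Fin n) (a : ℝ) {δ : ℝ} (hδ : 0 < δ) (ζ : Fin n → ℂ) :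
    phiF u k a δ ζ = a * (‖u k ζ‖^2 + δ) ^ (a - 1 - 1) * (a * ‖u k ζ‖^2 + δ) := by
  have hN : 0 < ‖u k ζ‖^2 + δ := by positivity
  have : (‖u k ζ‖^2 + δ) ^ (a - 1) = (‖u k ζ‖^2 + δ) ^ (a - 1 - 1) * (‖u k ζ‖^2 + δ) := by
    rw [← Real.rpow_add_one hN.ne']; congr 1; ring
  rw [phiF, this]; ring

lemma phiF_ge (u : Fin n → (Fin n → ℂ) → ℂ) (k : Fin n) {a : ℝ} (ha : 0 < a) (ha1 : a < 1) {δ : ℝ} (hδ : 0 < δ)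
    (ζ : Fin n → ℂ) :
    a^2 * (‖u k ζ‖^2 + δ) ^ (a - 1) ≤ phiF u k a δ ζ := by
  have hN : 0 < ‖u k ζ‖^2 + δ := by positivity
  have : (‖u k ζ‖^2 + δ) ^ (a - 1) = (‖u k ζ‖^2 + δ) ^ (a - 1 - 1) * (‖u k ζ‖^2 + δ) := by
    rw [← Real.rpow_add_one hN.ne']; congr 1; ring
  rw [phiF_eq u k a hδ, this]
  have h2 : 0 < (‖u k ζ‖^2 + δ) ^ (a - 1 - 1) := by positivity
  have : a * (‖u k ζ‖^2 + δ) ≤ a * ‖u k ζ‖^2 + δ := by nlinarith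
  calc _ = a * (‖u k ζ‖^2 + δ) ^ (a - 1 - 1) * (a * (‖u k ζ‖^2 + δ)) := by ring
    _ ≤ _ := by gcongr

lemma testF_le (u : Fin n → (Fin n → ℂ) → ℂ) (k : Fin n) {a : ℝ} (ha : 0 < a) {δ : ℝ} (hδ : 0 < δ)
    (ζ : Fin n → ℂ) :
    ‖testF u k a δ ζ‖^2 ≤ (‖u k ζ‖^2 + δ) ^ a * phiF u k a δ ζ * ‖hJ u ζ‖^2 := by
  have hN : 0 < ‖u k ζ‖^2 + δ := by positivity
  rw [phiF_eq u k a hδ, testF, norm_mul, norm_mul, Complex.norm_real, RCLike.norm_conj,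
    Real.norm_of_nonneg (by positivity), mul_pow, mul_pow]
  refine mul_le_mul_of_nonneg_right ?_ (by positivity)
  have e1 : (‖u k ζ‖^2 + δ) ^ a = (‖u k ζ‖^2 + δ) ^ (a - 1 - 1) * (‖u k ζ‖^2 + δ) * (‖u k ζ‖^2 + δ) := by
    rw [← Real.rpow_add_one hN.ne', ← Real.rpow_add_one hN.ne']; congr 1; ring
  have e2 : (‖u k ζ‖^2 + δ) ^ (a - 1) = (‖u k ζ‖^2 + δ) ^ (a - 1 - 1) * (‖u k ζ‖^2 + δ) := by
    rw [← Real.rpow_add_one hN.ne']; congr 1; ring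
  rw [e1, e2]
  generalize (‖u k ζ‖^2 + δ) ^ (a - 1 - 1) = q
  have : (q * (‖u k ζ‖^2 + δ))^2 * (a * (a * ‖u k ζ‖^2)) ≤
      (q * (‖u k ζ‖^2 + δ))^2 * (a * (a * ‖u k ζ‖^2 + δ)) := by
    gcongr; linarith
  calc _ = (q * (‖u k ζ‖^2 + δ))^2 * (a * (a * ‖u k ζ‖^2)) := by ring
    _ ≤ _ := this
    _ = _ := by ring

lemma step_identity {u : Fin n → (Fin n → ℂ) → ℂ} {ζ : Fin n → ℂ} (h : ∀ i, AnalyticAt ℂ (u i) ζ)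
    (T : Finset (Fin n)) (k : Fin n) (hk : k ∉ T) (a p : ℝ) {δ : ℝ} (hδ : 0 < δ)
    {χ : (Fin n → ℂ) → ℝ} (hχ : DifferentiableAt ℝ χ ζ) :
    ∑ l, dbar l (fun ζ => (wt u T p δ ζ : ℂ) * ((χ ζ : ℂ) * (χ ζ : ℂ) * testF u k a δ ζ)) ζ *
      (dbarM (fun i ζ => (starRingEnd ℂ) (u i ζ)) ζ).adjugate l k =
    ((wt u T p δ ζ * (χ ζ)^2 * phiF u k a δ ζ * ‖hJ u ζ‖^2 : ℝ) : ℂ) +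
      2 * (χ ζ : ℂ) * (wt u T p δ ζ : ℂ) * testF u k a δ ζ *
      ∑ l, dbar l (fun ζ => (χ ζ : ℂ)) ζ * (dbarM (fun i ζ => (starRingEnd ℂ) (u i ζ)) ζ).adjugate l k := by
  set M := dbarM (fun i ζ => (starRingEnd ℂ) (u i ζ)) ζ with hM
  have hda : ∀ i, DifferentiableAt ℂ (u i) ζ := fun i => (h i).differentiableAt
  have hsum : ∀ i, ∑ l, M.adjugate l k * (starRingEnd ℂ) (fderiv ℂ (u i) ζ (Pi.single l 1)) =
      if i = k then M.det else 0 := by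
    intro i
    rw [← sum_adj_mul]
    refine Finset.sum_congr rfl fun l _ => ?_
    rw [hM, dbarM_conj h]
  obtain ⟨Dw, hw, hw0⟩ := HasDbar.prod_zero (s := T)
    (u := fun i ζ => (((‖u i ζ‖^2 + δ) ^ p : ℝ) : ℂ)) (fun l => M.adjugate l k)
    (fun i _ => hasDbar_rpow (hda i) hδ p) (by
      intro i hi
      have hik : i ≠ k := fun e => hk (e ▸ hi)
      have := hsum i
      rw [if_neg hik] at this
      calc _ = ((p * (‖u i ζ‖^2 + δ) ^ (p - 1) : ℝ) : ℂ) * u i ζ *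
          ∑ l, M.adjugate l k * (starRingEnd ℂ) (fderiv ℂ (u i) ζ (Pi.single l 1)) := by
            rw [Finset.mul_sum]
            exact Finset.sum_congr rfl fun l _ => by ring
        _ = 0 := by rw [this, mul_zero])
  have hw' : HasDbar (fun ζ => (wt u T p δ ζ : ℂ)) Dw ζ := by
    have : (fun ζ => (wt u T p δ ζ : ℂ)) = fun ζ => ∏ i ∈ T, (((‖u i ζ‖^2 + δ) ^ p : ℝ) : ℂ) := by
      ext ζ; simp [wt]
    rw [this]; exact hw
  have hχ' : HasDbar (fun ζ => (χ ζ : ℂ)) (fun l => dbar l (fun ζ => (χ ζ : ℂ)) ζ) ζ :=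
    DifferentiableAt.hasDbar (Complex.ofRealCLM.differentiableAt.comp ζ hχ)
  have hF : HasDbar (testF u k a δ)
      (fun l => ((phiF u k a δ ζ : ℝ) : ℂ) * hJ u ζ * (starRingEnd ℂ) (fderiv ℂ (u k) ζ (Pi.single l 1))) ζ := by
    have h1 : HasDbar (fun ζ => ((a * (‖u k ζ‖^2 + δ) ^ (a - 1) : ℝ) : ℂ)) _ ζ :=
      ((HasDbar.const (a : ℂ)).mul (hasDbar_rpow (hda k) hδ (a - 1))).congr
        (Eventually.of_forall fun ζ => by push_cast; rfl)
    have h2 := (h1.mul (HasDbar.conj_holo (hda k))).mul (HasDbar.holo (analyticAt_hJ h).differentiableAt)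
    refine HasDbar.congr_D h2 fun l => ?_
    have e : u k ζ * (starRingEnd ℂ) (u k ζ) = ((‖u k ζ‖^2 : ℝ) : ℂ) := by
      rw [Complex.mul_conj']; push_cast; rfl
    simp only [phiF]
    push_cast at e ⊢
    linear_combination (hJ u ζ * a * (a - 1) * ((((‖u k ζ‖^2 + δ) ^ (a - 1 - 1) : ℝ) : ℂ)) *
      (starRingEnd ℂ) (fderiv ℂ (u k) ζ (Pi.single l 1))) * e
  have hall := hw'.mul ((hχ'.mul hχ').mul hF)
  simp only [hall.2]
  have hk1 := hsum k
  rw [if_pos rfl, hM, det_dbarM_conj h, ← hM] at hk1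
  have e2 : hJ u ζ * (starRingEnd ℂ) (hJ u ζ) = ((‖hJ u ζ‖^2 : ℝ) : ℂ) := by
    rw [Complex.mul_conj']; push_cast; rfl
  have expand : ∀ l, ((wt u T p δ ζ : ℂ) * ((χ ζ : ℂ) * (χ ζ : ℂ) * (((phiF u k a δ ζ : ℝ) : ℂ) * hJ u ζ * (starRingEnd ℂ) (fderiv ℂ (u k) ζ (Pi.single l 1))) +
      testF u k a δ ζ * ((χ ζ : ℂ) * dbar l (fun ζ => (χ ζ : ℂ)) ζ + (χ ζ : ℂ) * dbar l (fun ζ => (χ ζ : ℂ)) ζ)) +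
      (χ ζ : ℂ) * (χ ζ : ℂ) * testF u k a δ ζ * Dw l) * M.adjugate l k =
      (wt u T p δ ζ : ℂ) * (χ ζ : ℂ) ^ 2 * (phiF u k a δ ζ : ℝ) * hJ u ζ *
        (M.adjugate l k * (starRingEnd ℂ) (fderiv ℂ (u k) ζ (Pi.single l 1))) +
      2 * (χ ζ : ℂ) * (wt u T p δ ζ : ℂ) * testF u k a δ ζ * (dbar l (fun ζ => (χ ζ : ℂ)) ζ * M.adjugate l k) +
      (χ ζ : ℂ) * (χ ζ : ℂ) * testF u k a δ ζ * (M.adjugate l k * Dw l) := fun l => by ring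
  simp only [expand, Finset.sum_add_distrib, ← Finset.mul_sum]
  rw [hw0, hk1]
  push_cast at e2 ⊢
  linear_combination ((wt u T p δ ζ : ℂ) * (χ ζ : ℂ) ^ 2 * (phiF u k a δ ζ : ℝ)) * e2

lemma contDiffAt_wt {u : Fin n → (Fin n → ℂ) → ℂ} {ζ : Fin n → ℂ} (h : ∀ i, AnalyticAt ℂ (u i) ζ)
    (T : Finset (Fin n)) (p : ℝ) {δ : ℝ} (hδ : 0 < δ) {m : WithTop ℕ∞} :
    ContDiffAt ℝ m (wt u T p δ) ζ :=
  contDiffAt_prod fun i _ => contDiffAt_rpow (h i) hδ p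

lemma contDiffAt_testF {u : Fin n → (Fin n → ℂ) → ℂ} {ζ : Fin n → ℂ} (h : ∀ i, AnalyticAt ℂ (u i) ζ)
    (k : Fin n) (a : ℝ) {δ : ℝ} (hδ : 0 < δ) {m : WithTop ℕ∞} :
    ContDiffAt ℝ m (testF u k a δ) ζ :=
  ((ofReal_contDiffAt (contDiffAt_const.mul (contDiffAt_rpow (h k) hδ (a - 1)))).mul
    (AnalyticAt.contDiffAt_conj (h k))).mul (AnalyticAt.contDiffAtR (analyticAt_hJ h))

lemma contDiffAt_phiF {u : Fin n → (Fin n → ℂ) → ℂ} {ζ : Fin n → ℂ} (h : ∀ i, AnalyticAt ℂ (u i) ζ)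
    (k : Fin n) (a : ℝ) {δ : ℝ} (hδ : 0 < δ) {m : WithTop ℕ∞} :
    ContDiffAt ℝ m (phiF u k a δ) ζ :=
  (contDiffAt_const.mul (contDiffAt_rpow (h k) hδ (a - 1))).add
    ((contDiffAt_const.mul (contDiffAt_const.mul (contDiffAt_rpow (h k) hδ (a - 1 - 1)))).mul
      (AnalyticAt.contDiffAt_normSq (h k)))

theorem caccioppoli {R : ℝ} {a : ℝ} (ha : 0 < a) (ha1 : a < 1) (T : Finset (Fin n)) :
    ∀ (u : Fin n → (Fin n → ℂ) → ℂ), (∀ i, AnalyticOnNhd ℂ (u i) (ball 0 R)) →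
    ∀ r : ℝ, 0 < r → r < R → ∃ C : ℝ, ∀ δ : ℝ, 0 < δ → δ ≤ 1 →
      ∫ ζ in closedBall (0 : Fin n → ℂ) r, wt u T (a - 1) δ ζ * ‖hJ u ζ‖^2 ≤ C := by
  induction T using Finset.induction_on with
  | empty =>
    intro u hu r hr hrR
    refine ⟨∫ ζ in closedBall (0 : Fin n → ℂ) r, ‖hJ u ζ‖^2, fun δ _ _ => ?_⟩
    simp [wt]
  | insert k T hk ih =>
    intro u hu r hr hrR
    set r1 := (r + R) / 2 with hr1
    have hrr1 : r < r1 := by rw [hr1]; linarith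
    have hr1R : r1 < R := by rw [hr1]; linarith
    have hr10 : 0 < r1 := hr.trans hrr1
    let χ : ContDiffBump (0 : Fin n → ℂ) := ⟨r, r1, hr, hrr1⟩
    have hχC : ∀ {m : ℕ∞}, ContDiff ℝ m χ := χ.contDiff
    have hK1Ω : closedBall (0 : Fin n → ℂ) r1 ⊆ ball 0 R := closedBall_subset_ball hr1R
    have hK1 : IsCompact (closedBall (0 : Fin n → ℂ) r1) := isCompact_closedBall _ _
    have huA : ∀ ζ ∈ ball (0 : Fin n → ℂ) R, ∀ i, AnalyticAt ℂ (u i) ζ := fun ζ hζ i => hu i ζ hζ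
    -- bounds
    have hdχc : ∀ l, Continuous (fun ζ => dbar l (fun ζ => (χ ζ : ℂ)) ζ) := fun l =>
      (contDiff_iff_contDiffAt.2 fun ζ => dbar_contDiffAt (k := l) (m := 0)
        (ofReal_contDiffAt (hχC (m := 0 + 1)).contDiffAt)).continuous
    have hB : ∃ B : ℝ, 0 ≤ B ∧ ∀ l, ∀ ζ ∈ closedBall (0 : Fin n → ℂ) r1,
        ‖dbar l (fun ζ => (χ ζ : ℂ)) ζ‖ ≤ B := by
      choose B hB using fun l => hK1.exists_bound_of_continuousOn (hdχc l).continuousOn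
      refine ⟨∑ l, |B l|, Finset.sum_nonneg fun l _ => abs_nonneg _, fun l ζ hζ => ?_⟩
      exact ((hB l ζ hζ).trans (le_abs_self _)).trans
        (Finset.single_le_sum (f := fun l => |B l|) (fun l _ => abs_nonneg _) (Finset.mem_univ l))
    obtain ⟨B, hB0, hB⟩ := hB
    obtain ⟨Q, hQ⟩ := hK1.exists_bound_of_continuousOn (f := u k)
      ((hu k).continuousOn.mono hK1Ω)
    -- induction hypothesis
    have hu' : ∀ l i, AnalyticOnNhd ℂ (Function.update u k (fun ζ => ζ l) i) (ball 0 R) := by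
      intro l i
      by_cases hi : i = k
      · subst hi
        rw [Function.update_self]
        exact fun ζ _ => (ContinuousLinearMap.proj (R := ℂ) (φ := fun _ : Fin n => ℂ) l).analyticAt ζ
      · rw [Function.update_of_ne hi]; exact hu i
    choose C hC using fun l => ih (Function.update u k (fun ζ => ζ l)) (hu' l) r1 hr10 hr1R
    have hwt : ∀ l δ ζ, wt (Function.update u k (fun ζ => ζ l)) T (a - 1) δ ζ = wt u T (a - 1) δ ζ := by
      intro l δ ζ
      refine Finset.prod_congr rfl fun i hi => ?_
      have hik : i ≠ k := fun e => hk (e ▸ hi)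
      rw [Function.update_of_ne hik]
    refine ⟨(a^2)⁻¹ * (4 * ((Q^2 + 1)^a * (n * B^2 * ∑ l, C l))), fun δ hδ hδ1 => ?_⟩
    set M := dbarM (fun i ζ => (starRingEnd ℂ) (u i ζ)) with hM
    let X : (Fin n → ℂ) → ℂ := fun ζ =>
      ∑ l, dbar l (fun ζ => (χ ζ : ℂ)) ζ * (M ζ).adjugate l k
    have hSC : ∀ ζ ∈ ball (0 : Fin n → ℂ) R, ∀ i,
        ContDiffAt ℝ 2 (fun ζ => (starRingEnd ℂ) (u i ζ)) ζ := fun ζ hζ i =>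
      AnalyticAt.contDiffAt_conj (huA ζ hζ i)
    let Ψ : (Fin n → ℂ) → ℂ := fun ζ =>
      (wt u T (a - 1) δ ζ : ℂ) * ((χ ζ : ℂ) * (χ ζ : ℂ) * testF u k a δ ζ)
    have hΨC : ∀ ζ ∈ ball (0 : Fin n → ℂ) R, ContDiffAt ℝ 1 Ψ ζ := fun ζ hζ =>
      (ofReal_contDiffAt (contDiffAt_wt (huA ζ hζ) T (a - 1) hδ)).mul
        (((ofReal_contDiffAt (hχC (m := 1)).contDiffAt).mul
          (ofReal_contDiffAt (hχC (m := 1)).contDiffAt)).mul (contDiffAt_testF (huA ζ hζ) k a hδ))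
    have hχ0 : ∀ ζ ∉ closedBall (0 : Fin n → ℂ) r1, χ ζ = 0 := by
      intro ζ hζ
      refine χ.zero_of_le_dist ?_
      rw [mem_closedBall, not_le] at hζ
      exact hζ.le
    have hI := integral_det_zero (S := fun i ζ => (starRingEnd ℂ) (u i ζ))
      (T := fun i ζ => if i = k then Ψ ζ else 0) isOpen_ball hK1 hK1Ω hSC ?_ ?_
    rotate_left
    · intro ζ hζ i
      by_cases hi : i = k
      · simp only [hi, if_true]; exact hΨC ζ hζ
      · simp only [hi, if_false]; exact contDiffAt_const
    · intro ζ hζ hζK j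
      refine Finset.sum_eq_zero fun i _ => ?_
      have : Ψ ζ = 0 := by simp [Ψ, hχ0 ζ hζK]
      simp [this]
    have hIg : ∀ ζ ∈ ball (0 : Fin n → ℂ) R,
        ∑ i, ((M ζ).updateRow i (fun j => dbar j (fun ζ => if i = k then Ψ ζ else 0) ζ)).det =
        ((wt u T (a - 1) δ ζ * (χ ζ)^2 * phiF u k a δ ζ * ‖hJ u ζ‖^2 : ℝ) : ℂ) +
        2 * (χ ζ : ℂ) * (wt u T (a - 1) δ ζ : ℂ) * testF u k a δ ζ * X ζ := by
      intro ζ hζ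
      rw [Finset.sum_eq_single k]
      · simp only [if_true]
        rw [det_updateRow_eq_sum, ← step_identity (huA ζ hζ) T k hk a (a - 1) hδ
          ((hχC (m := 1)).differentiable (by norm_num) ζ)]
      · intro i _ hi
        refine Matrix.det_eq_zero_of_row_eq_zero i fun l => ?_
        simp only [hi, if_false, Matrix.updateRow_self]
        exact (HasDbar.const 0).2 l
      · simp
    set G : (Fin n → ℂ) → ℂ := fun ζ =>
      ((wt u T (a - 1) δ ζ * (χ ζ)^2 * phiF u k a δ ζ * ‖hJ u ζ‖^2 : ℝ) : ℂ) +
        2 * (χ ζ : ℂ) * (wt u T (a - 1) δ ζ : ℂ) * testF u k a δ ζ * X ζ with hG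
    have hGint : IntegrableOn G (ball 0 R) := hI.1.congr_fun hIg measurableSet_ball
    have hG0 : ∫ ζ in ball (0 : Fin n → ℂ) R, G ζ = 0 := by
      rw [← hI.2]; exact (setIntegral_congr_fun measurableSet_ball hIg).symm
    have hG1 : ∫ ζ in closedBall (0 : Fin n → ℂ) r1, G ζ = 0 := by
      rw [← hG0]
      refine setIntegral_eq_of_subset_of_forall_sdiff_eq_zero measurableSet_ball hK1Ω ?_ |>.symm
      intro ζ hζ
      simp [hG, hχ0 ζ hζ.2]
    have hre : ∫ ζ in closedBall (0 : Fin n → ℂ) r1, (G ζ).re = 0 := by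
      have := integral_re (𝕜 := ℂ) (hGint.mono_set hK1Ω)
      simp only [RCLike.re_to_complex] at this
      rw [this, hG1]; rfl
    -- continuity
    have hcw : ContinuousOn (wt u T (a - 1) δ) (closedBall 0 r1) := fun ζ hζ =>
      (contDiffAt_wt (m := 1) (huA ζ (hK1Ω hζ)) T (a - 1) hδ).continuousAt.continuousWithinAt
    have hcχ : ContinuousOn χ (closedBall 0 r1) := χ.continuous.continuousOn
    have hcφ : ContinuousOn (phiF u k a δ) (closedBall 0 r1) := fun ζ hζ =>
      (contDiffAt_phiF (m := 1) (huA ζ (hK1Ω hζ)) k a hδ).continuousAt.continuousWithinAt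
    have hcJ : ContinuousOn (hJ u) (closedBall 0 r1) := fun ζ hζ =>
      (analyticAt_hJ (huA ζ (hK1Ω hζ))).continuousAt.continuousWithinAt
    have hcadj : ∀ l, ContinuousOn (fun ζ => (M ζ).adjugate l k) (closedBall 0 r1) := fun l ζ hζ =>
      (contDiffAt_adj (hSC ζ (hK1Ω hζ)) k l).continuousAt.continuousWithinAt
    have hcX : ContinuousOn X (closedBall 0 r1) :=
      continuousOn_finsetSum _ fun l _ => (hdχc l).continuousOn.mul (hcadj l)
    have hcb : ContinuousOn (fun ζ => (‖u k ζ‖^2 + δ)^a) (closedBall 0 r1) := fun ζ hζ =>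
      (contDiffAt_rpow (m := 1) (huA ζ (hK1Ω hζ) k) hδ a).continuousAt.continuousWithinAt
    have hi1 : IntegrableOn (fun ζ => wt u T (a - 1) δ ζ * (χ ζ)^2 * phiF u k a δ ζ * ‖hJ u ζ‖^2)
        (closedBall 0 r1) :=
      ContinuousOn.integrableOn_compact hK1 (((hcw.mul (hcχ.pow 2)).mul hcφ).mul (hcJ.norm.pow 2))
    have hi2 : IntegrableOn (fun ζ => wt u T (a - 1) δ ζ * (‖u k ζ‖^2 + δ)^a * ‖X ζ‖^2)
        (closedBall 0 r1) :=
      ContinuousOn.integrableOn_compact hK1 ((hcw.mul hcb).mul (hcX.norm.pow 2))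
    have hφ0 : ∀ ζ, 0 ≤ phiF u k a δ ζ := fun ζ =>
      le_trans (by positivity) (phiF_ge u k ha ha1 hδ ζ)
    have hmain : (1/2) * ∫ ζ in closedBall (0 : Fin n → ℂ) r1,
          wt u T (a - 1) δ ζ * (χ ζ)^2 * phiF u k a δ ζ * ‖hJ u ζ‖^2 ≤
        2 * ∫ ζ in closedBall (0 : Fin n → ℂ) r1, wt u T (a - 1) δ ζ * (‖u k ζ‖^2 + δ)^a * ‖X ζ‖^2 := by
      rw [← integral_const_mul, ← integral_const_mul, ← sub_nonpos, ← integral_sub (hi1.const_mul _) (hi2.const_mul _),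
        ← hre]
      refine setIntegral_mono_on ((hi1.const_mul _).sub (hi2.const_mul _))
        (hGint.mono_set hK1Ω).re measurableSet_closedBall fun ζ hζ => ?_
      exact pointwise_ineq (wt_pos u T _ hδ ζ).le χ.nonneg (hφ0 ζ) (by positivity)
        (testF_le u k ha hδ ζ)
    -- lower bound
    have hlow : a^2 * ∫ ζ in closedBall (0 : Fin n → ℂ) r, wt u (insert k T) (a - 1) δ ζ * ‖hJ u ζ‖^2 ≤
        ∫ ζ in closedBall (0 : Fin n → ℂ) r1, wt u T (a - 1) δ ζ * (χ ζ)^2 * phiF u k a δ ζ * ‖hJ u ζ‖^2 := by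
      rw [← integral_const_mul]
      calc _ ≤ ∫ ζ in closedBall (0 : Fin n → ℂ) r, wt u T (a - 1) δ ζ * (χ ζ)^2 * phiF u k a δ ζ * ‖hJ u ζ‖^2 := by
            have hsub : closedBall (0 : Fin n → ℂ) r ⊆ closedBall 0 r1 := closedBall_subset_closedBall hrr1.le
            refine setIntegral_mono_on ?_ (hi1.mono_set hsub) measurableSet_closedBall fun ζ hζ => ?_
            · refine IntegrableOn.congr_fun (f := fun ζ => a^2 * (wt u (insert k T) (a - 1) δ ζ * ‖hJ u ζ‖^2)) ?_ (fun _ _ => rfl) measurableSet_closedBall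
              refine ContinuousOn.integrableOn_compact (isCompact_closedBall _ _) ?_
              refine continuousOn_const.mul (ContinuousOn.mul ?_ ((hcJ.mono hsub).norm.pow 2))
              exact fun ζ hζ => (contDiffAt_wt (m := 1) (huA ζ (hK1Ω (hsub hζ))) _ (a - 1) hδ).continuousAt.continuousWithinAt
            · have h1 : χ ζ = 1 := χ.one_of_mem_closedBall hζ
              rw [h1, wt, Finset.prod_insert hk]
              have := phiF_ge u k ha ha1 hδ ζ
              have hw := (wt_pos u T (a - 1) hδ ζ).le
              calc a^2 * ((‖u k ζ‖^2 + δ)^(a - 1) * wt u T (a - 1) δ ζ * ‖hJ u ζ‖^2)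
                  = wt u T (a - 1) δ ζ * (a^2 * (‖u k ζ‖^2 + δ)^(a - 1)) * ‖hJ u ζ‖^2 := by ring
                _ ≤ wt u T (a - 1) δ ζ * phiF u k a δ ζ * ‖hJ u ζ‖^2 := by gcongr
                _ = _ := by ring
        _ ≤ _ := by
            refine setIntegral_mono_set hi1 ?_ (closedBall_subset_closedBall hrr1.le).eventuallyLE
            refine ae_of_all _ fun ζ => ?_
            have hw := (wt_pos u T (a - 1) hδ ζ).le
            have := hφ0 ζ
            change 0 ≤ _
            positivity
    -- upper bound
    have hupp : ∫ ζ in closedBall (0 : Fin n → ℂ) r1, wt u T (a - 1) δ ζ * (‖u k ζ‖^2 + δ)^a * ‖X ζ‖^2 ≤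
        (Q^2 + 1)^a * (n * B^2 * ∑ l, C l) := by
      have hadj : ∀ ζ ∈ closedBall (0 : Fin n → ℂ) r1, ∀ l, ‖(M ζ).adjugate l k‖ =
          ‖hJ (Function.update u k (fun ζ => ζ l)) ζ‖ := by
        intro ζ hζ l
        rw [hM, adj_dbarM_conj (huA ζ (hK1Ω hζ)), RCLike.norm_conj]
      have hil : ∀ l, IntegrableOn (fun ζ => wt u T (a - 1) δ ζ * ‖hJ (Function.update u k (fun ζ => ζ l)) ζ‖^2)
          (closedBall 0 r1) := by
        intro l
        refine ContinuousOn.integrableOn_compact hK1 (hcw.mul (ContinuousOn.pow (ContinuousOn.norm ?_) 2))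
        exact fun ζ hζ => (analyticAt_hJ fun i => hu' l i ζ (hK1Ω hζ)).continuousAt.continuousWithinAt
      calc _ ≤ ∫ ζ in closedBall (0 : Fin n → ℂ) r1, (Q^2 + 1)^a * (n * B^2 *
            ∑ l, wt u T (a - 1) δ ζ * ‖hJ (Function.update u k (fun ζ => ζ l)) ζ‖^2) := by
            refine setIntegral_mono_on hi2 ?_ measurableSet_closedBall fun ζ hζ => ?_
            · exact ((integrable_finsetSum _ fun l _ => hil l).const_mul _).const_mul _
            · have hw := (wt_pos u T (a - 1) hδ ζ).le
              have h1 : (‖u k ζ‖^2 + δ)^a ≤ (Q^2 + 1)^a := by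
                have := hQ ζ hζ
                gcongr
              have h2 : ‖X ζ‖^2 ≤ n * B^2 * ∑ l, ‖hJ (Function.update u k (fun ζ => ζ l)) ζ‖^2 := by
                have h3 : ‖X ζ‖ ≤ ∑ l, B * ‖hJ (Function.update u k (fun ζ => ζ l)) ζ‖ := by
                  refine (norm_sum_le _ _).trans (Finset.sum_le_sum fun l _ => ?_)
                  rw [norm_mul, hadj ζ hζ]
                  gcongr
                  exact hB l ζ hζ
                calc ‖X ζ‖^2 ≤ (∑ l, B * ‖hJ (Function.update u k (fun ζ => ζ l)) ζ‖)^2 := by gcongr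
                  _ ≤ (Finset.univ : Finset (Fin n)).card * ∑ l, (B * ‖hJ (Function.update u k (fun ζ => ζ l)) ζ‖)^2 :=
                    sq_sum_le_card_mul_sum_sq
                  _ = _ := by
                    simp only [mul_pow, ← Finset.mul_sum, Finset.card_univ, Fintype.card_fin]; ring
              calc _ ≤ wt u T (a - 1) δ ζ * (Q^2 + 1)^a *
                    (n * B^2 * ∑ l, ‖hJ (Function.update u k (fun ζ => ζ l)) ζ‖^2) := by gcongr
                _ = _ := by rw [← Finset.mul_sum]; ring
        _ = (Q^2 + 1)^a * (n * B^2 * ∑ l, ∫ ζ in closedBall (0 : Fin n → ℂ) r1,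
              wt u T (a - 1) δ ζ * ‖hJ (Function.update u k (fun ζ => ζ l)) ζ‖^2) := by
            rw [integral_const_mul, integral_const_mul, integral_finsetSum _ fun l _ => hil l]
        _ ≤ _ := by
            gcongr with l _
            have := hC l δ hδ hδ1
            simpa only [hwt] using this
    rw [inv_mul_eq_div, le_div_iff₀ (by positivity), mul_comm]
    linarith

end JacIdeal

namespace JacIdeal
open MeasureTheory Metric Set Filter Topology

lemma fatou_weight {X : Type*} [TopologicalSpace X] [MeasurableSpace X] [OpensMeasurableSpace X]
    {μ : Measure X} {K : Set X} (hKm : MeasurableSet K) {h q : X → ℝ}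
    (hh : ContinuousOn h K) (hq : ContinuousOn q K) (hh0 : ∀ x ∈ K, 0 ≤ h x) (hq0 : ∀ x ∈ K, 0 ≤ q x)
    {s C : ℝ} (hs : 0 ≤ s)
    (hi : ∀ δ, 0 < δ → δ ≤ 1 → IntegrableOn (fun x => h x * (q x + δ) ^ (-s)) K μ)
    (hC : ∀ δ, 0 < δ → δ ≤ 1 → ∫ x in K, h x * (q x + δ) ^ (-s) ∂μ ≤ C) :
    IntegrableOn (fun x => h x * (q x) ^ (-s)) K μ ∧
      (0 < s → ∀ᵐ x ∂(μ.restrict K), q x = 0 → h x = 0) := by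
  let d : ℕ → ℝ := fun m => 1 / ((m : ℝ) + 1)
  have hd0 : ∀ m, 0 < d m := fun m => by positivity
  have hd1 : ∀ m, d m ≤ 1 := fun m => by
    simp only [d]
    rw [div_le_one (by positivity)]
    linarith [Nat.cast_nonneg (α := ℝ) m]
  have hdt : Tendsto d atTop (𝓝 0) := tendsto_one_div_add_atTop_nhds_zero_nat
  have hhm : AEMeasurable h (μ.restrict K) := hh.aemeasurable hKm
  have hqm : AEMeasurable q (μ.restrict K) := hq.aemeasurable hKm
  let F : ℕ → X → ENNReal := fun m x => ENNReal.ofReal (h x * (q x + d m) ^ (-s))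
  have hFm : ∀ m, AEMeasurable (F m) (μ.restrict K) := fun m =>
    (hhm.mul ((hqm.add_const _).pow_const _)).ennreal_ofReal
  have hle : ∫⁻ x in K, liminf (fun m => F m x) atTop ∂μ ≤ ENNReal.ofReal C := by
    refine (lintegral_liminf_le' hFm).trans ?_
    refine (liminf_le_liminf (v := fun _ => ENNReal.ofReal C) (Eventually.of_forall fun m => ?_)).trans ?_
    · rw [← ofReal_integral_eq_lintegral_ofReal (hi _ (hd0 m) (hd1 m))]
      · exact ENNReal.ofReal_le_ofReal (hC _ (hd0 m) (hd1 m))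
      · refine (ae_restrict_iff' hKm).2 (Eventually.of_forall fun x hx => ?_)
        exact mul_nonneg (hh0 x hx) (Real.rpow_nonneg (by linarith [hq0 x hx, hd0 m]) _)
    · simp
  have hfin : ∀ᵐ x ∂(μ.restrict K), liminf (fun m => F m x) atTop < ⊤ := by
    have hm : AEMeasurable (fun x => liminf (fun m => F m x) atTop) (μ.restrict K) := by
      simp only [liminf_eq_iSup_iInf_of_nat]
      exact AEMeasurable.iSup fun m => AEMeasurable.biInf _ (Set.to_countable _) fun i _ => hFm i
    refine ae_lt_top' hm ?_
    exact (hle.trans_lt ENNReal.ofReal_lt_top).ne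
  have hptw : ∀ x ∈ K, (0 < q x ∨ s = 0) → liminf (fun m => F m x) atTop = ENNReal.ofReal (h x * q x ^ (-s)) := by
    intro x hx hcase
    refine Tendsto.liminf_eq ?_
    refine ENNReal.tendsto_ofReal (Tendsto.const_mul _ ?_)
    rcases hcase with h1 | h1
    · have : Tendsto (fun m => q x + d m) atTop (𝓝 (q x)) := by
        simpa using hdt.const_add (q x)
      exact this.rpow_const (Or.inl h1.ne')
    · subst h1; simp
  constructor
  · refine ⟨(hhm.mul (hqm.pow_const _)).aestronglyMeasurable, ?_⟩
    rw [hasFiniteIntegral_iff_ofReal]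
    · refine lt_of_le_of_lt (lintegral_mono_ae ?_) (hle.trans_lt ENNReal.ofReal_lt_top)
      refine (ae_restrict_iff' hKm).2 (Eventually.of_forall fun x hx => ?_)
      by_cases h1 : 0 < q x ∨ s = 0
      · exact (hptw x hx h1).ge
      · push Not at h1
        have : q x = 0 := le_antisymm h1.1 (hq0 x hx)
        rw [this, Real.zero_rpow (neg_ne_zero.2 h1.2)]
        simp
    · refine (ae_restrict_iff' hKm).2 (Eventually.of_forall fun x hx => ?_)
      exact mul_nonneg (hh0 x hx) (Real.rpow_nonneg (hq0 x hx) _)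
  · intro hs0
    filter_upwards [hfin, ae_restrict_mem hKm] with x hx hxK hqx
    by_contra hne
    have hpos : 0 < h x := lt_of_le_of_ne (hh0 x hxK) (Ne.symm hne)
    have : Tendsto (fun m => F m x) atTop (𝓝 ⊤) := by
      refine ENNReal.tendsto_ofReal_nhds_top.2 ?_
      refine Tendsto.const_mul_atTop hpos ?_
      simp only [hqx, zero_add]
      have h1 : Tendsto d atTop (𝓝[>] 0) := tendsto_nhdsWithin_iff.2 ⟨hdt, Eventually.of_forall hd0⟩
      exact (tendsto_rpow_neg_nhdsGT_zero (by linarith)).comp h1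
    rw [this.liminf_eq] at hx
    exact lt_irrefl _ hx

lemma continuousOn_hJ {n : ℕ} {V : Set (Fin n → ℂ)} {u : Fin n → (Fin n → ℂ) → ℂ}
    (hu : ∀ i, AnalyticOnNhd ℂ (u i) V) : ContinuousOn (hJ u) V := fun ζ hζ =>
  (analyticAt_hJ (fun i => hu i ζ hζ)).continuousAt.continuousWithinAt

lemma weight_integrable {n : ℕ} {R r a B : ℝ} (ha : 0 < a) (ha1 : a < 1) (T : Finset (Fin n))
    (u : Fin n → (Fin n → ℂ) → ℂ) (hu : ∀ i, AnalyticOnNhd ℂ (u i) (ball 0 R))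
    (hr : 0 < r) (hrR : r < R) (q : (Fin n → ℂ) → ℝ) (hq : ContinuousOn q (closedBall 0 r))
    (hq0 : ∀ ζ, 0 ≤ q ζ) (hB : 1 ≤ B)
    (hqu : ∀ ζ ∈ closedBall (0 : Fin n → ℂ) r, ∀ i ∈ T, ‖u i ζ‖ ^ 2 ≤ B * q ζ) :
    IntegrableOn (fun ζ => ‖hJ u ζ‖ ^ 2 * q ζ ^ (-(T.card * (1 - a)))) (closedBall 0 r) ∧
      (T.Nonempty → ∀ᵐ ζ ∂(volume.restrict (closedBall (0 : Fin n → ℂ) r)), q ζ = 0 → hJ u ζ = 0) := by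
  obtain ⟨C, hC⟩ := caccioppoli ha ha1 T u hu r hr hrR
  have hsub : closedBall (0 : Fin n → ℂ) r ⊆ ball 0 R := closedBall_subset_ball hrR
  have hJc : ContinuousOn (fun ζ => ‖hJ u ζ‖ ^ 2) (closedBall 0 r) :=
    ((continuousOn_hJ hu).mono hsub).norm.pow 2
  have huc : ∀ i, ContinuousOn (u i) (closedBall 0 r) := fun i =>
    (hu i).continuousOn.mono hsub
  have hB0 : 0 < B := by linarith
  have hs : 0 ≤ (T.card : ℝ) * (1 - a) := by
    have : 0 < 1 - a := by linarith
    positivity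
  have hKc : IsCompact (closedBall (0 : Fin n → ℂ) r) := isCompact_closedBall _ _
  have hIg : ∀ δ, 0 < δ → δ ≤ 1 → IntegrableOn (fun ζ => ‖hJ u ζ‖ ^ 2 * (q ζ + δ) ^ (-(T.card * (1 - a)))) (closedBall 0 r) := by
    intro δ hδ _
    refine ContinuousOn.integrableOn_compact hKc (hJc.mul ?_)
    refine ContinuousOn.rpow_const (hq.add continuousOn_const) fun ζ _ => Or.inl ?_
    have := hq0 ζ
    positivity
  have key := fatou_weight (μ := volume) hKc.measurableSet (h := fun ζ => ‖hJ u ζ‖ ^ 2) (q := q) hJc hq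
    (fun _ _ => by positivity) (fun ζ _ => hq0 ζ) hs (C := B ^ (T.card * (1 - a)) * C) hIg ?_
  · refine ⟨key.1, fun hT => ?_⟩
    have : 0 < (T.card : ℝ) * (1 - a) := by
      have h1 : 0 < 1 - a := by linarith
      have h2 : 0 < T.card := hT.card_pos
      positivity
    filter_upwards [key.2 this] with ζ h1 h2
    simpa using h1 h2
  · intro δ hδ hδ1
    refine le_trans ?_ (mul_le_mul_of_nonneg_left (hC δ hδ hδ1) (by positivity))
    rw [← integral_const_mul]
    refine setIntegral_mono_on (hIg δ hδ hδ1) ?_ hKc.measurableSet ?_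
    · refine Integrable.const_mul ?_ _
      refine ContinuousOn.integrableOn_compact hKc (ContinuousOn.mul ?_ hJc)
      refine continuousOn_finsetProd _ fun i _ => ?_
      refine ContinuousOn.rpow_const (((huc i).norm.pow 2).add continuousOn_const) fun ζ _ => Or.inl ?_
      positivity
    · intro ζ hζ
      have hqd : 0 < q ζ + δ := by linarith [hq0 ζ]
      have h1 : (q ζ + δ) ^ (-(T.card * (1 - a))) ≤ B ^ (T.card * (1 - a)) * wt u T (a - 1) δ ζ := by
        have e1 : (q ζ + δ) ^ (-(T.card * (1 - a))) = ∏ i ∈ T, (q ζ + δ) ^ (a - 1) := by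
          rw [Finset.prod_const, ← Real.rpow_natCast, ← Real.rpow_mul hqd.le]
          congr 1; ring
        have e2 : B ^ (T.card * (1 - a)) = ∏ i ∈ T, B ^ (1 - a) := by
          rw [Finset.prod_const, ← Real.rpow_natCast, ← Real.rpow_mul hB0.le]
          congr 1; ring
        rw [e1, e2, wt, ← Finset.prod_mul_distrib]
        refine Finset.prod_le_prod (fun _ _ => by positivity) fun i hi => ?_
        have h2 : ‖u i ζ‖ ^ 2 + δ ≤ B * (q ζ + δ) := by
          nlinarith [hqu ζ hζ i hi]
        have h3 : (B * (q ζ + δ)) ^ (a - 1) ≤ (‖u i ζ‖ ^ 2 + δ) ^ (a - 1) :=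
          Real.rpow_le_rpow_of_nonpos (by positivity) h2 (by linarith)
        rw [Real.mul_rpow hB0.le hqd.le] at h3
        calc (q ζ + δ) ^ (a - 1) = B ^ (1 - a) * (B ^ (a - 1) * (q ζ + δ) ^ (a - 1)) := by
              rw [← mul_assoc, ← Real.rpow_add hB0]; simp
          _ ≤ _ := by gcongr
      calc _ ≤ ‖hJ u ζ‖ ^ 2 * (B ^ (T.card * (1 - a)) * wt u T (a - 1) δ ζ) := by gcongr
        _ = _ := by ring

end JacIdeal

namespace JacIdeal
open MeasureTheory Metric Set Filter Topology

variable {n : ℕ}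

lemma continuousOn_det {X : Type*} [TopologicalSpace X] {s : Set X} {M : X → Matrix (Fin n) (Fin n) ℂ}
    (h : ∀ i l, ContinuousOn (fun x => M x i l) s) : ContinuousOn (fun x => (M x).det) s := by
  simp only [Matrix.det_apply]
  refine continuousOn_finsetSum _ fun σ _ => ?_
  refine ContinuousOn.const_smul ?_ _
  exact continuousOn_finsetProd _ fun i _ => h _ _

lemma continuousOn_updateRow {X : Type*} [TopologicalSpace X] {s : Set X}
    {M : X → Matrix (Fin n) (Fin n) ℂ} {v : X → Fin n → ℂ} (k : Fin n)
    (h : ∀ i l, ContinuousOn (fun x => M x i l) s) (hv : ∀ l, ContinuousOn (fun x => v x l) s) (i l : Fin n) :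
    ContinuousOn (fun x => (M x).updateRow k (v x) i l) s := by
  by_cases hi : i = k
  · subst hi
    simpa only [Matrix.updateRow_self] using hv l
  · simpa only [Matrix.updateRow_ne hi] using h i l

lemma hasDerivAt_det (A B : Matrix (Fin n) (Fin n) ℂ) (t : ℝ) :
    HasDerivAt (fun t : ℝ => (A + (t : ℂ) • B).det)
      (∑ i, ((A + (t : ℂ) • B).updateRow i (B i)).det) t := by
  have h0 : HasDerivAt (fun t : ℝ => ((fun i l => A i l + (t : ℂ) * B i l) : Fin n → Fin n → ℂ))
      (fun i l => B i l) t := by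
    rw [hasDerivAt_pi]
    intro i
    rw [hasDerivAt_pi]
    intro l
    have := ((Complex.ofRealCLM.hasDerivAt (x := t)).mul_const (B i l)).const_add (A i l)
    simpa using this
  have h1 := ((detCM n).hasFDerivAt (fun i l => A i l + (t : ℂ) * B i l)).comp_hasDerivAt_of_eq t (h0) rfl
  refine h1.congr_deriv ?_
  simp only [ContinuousMultilinearMap.linearDeriv_apply]
  rfl

lemma dbar_eq_zero_of_const_on {Ω K : Set (Fin n → ℂ)} (hΩ : IsOpen Ω) (hK : IsCompact K)
    {u : (Fin n → ℂ) → ℂ} {c : ℂ} (h : ∀ ζ ∈ Ω, ζ ∉ K → u ζ = c) {ζ : Fin n → ℂ} (hζ : ζ ∈ Ω) (hζK : ζ ∉ K)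
    (j : Fin n) : dbar j u ζ = 0 := by
  have : u =ᶠ[𝓝 ζ] fun _ => c := by
    filter_upwards [hΩ.mem_nhds hζ, hK.isClosed.isOpen_compl.mem_nhds hζK] with x hx hx'
    exact h x hx hx'
  rw [dbar_congr this]; exact (HasDbar.const c).2 j

lemma vecMul_dbarM_eq_zero {Ω K : Set (Fin n → ℂ)} (hΩ : IsOpen Ω) (hK : IsCompact K) {z : Fin n → ℂ}
    {S : Fin n → (Fin n → ℂ) → ℂ} (hS : ∀ ζ ∈ Ω, ∀ i, ContDiffAt ℝ 2 (S i) ζ) {c : ℂ}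
    (h : ∀ ζ ∈ Ω, ζ ∉ K → ∑ i, S i ζ * (ζ i - z i) = c)
    {ζ : Fin n → ℂ} (hζ : ζ ∈ Ω) (hζK : ζ ∉ K) :
    Matrix.vecMul (ζ - z) (dbarM S ζ) = 0 := by
  ext j
  have h1 := dbar_eq_zero_of_const_on hΩ hK h hζ hζK j
  have hlin : ∀ i, HasDbar (fun ζ : Fin n → ℂ => ζ i - z i) (fun _ => 0) ζ := fun i =>
    HasDbar.holo (((ContinuousLinearMap.proj (R := ℂ) (φ := fun _ : Fin n => ℂ) i).differentiableAt).sub_const _)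
  have h2 : HasDbar (fun ζ => ∑ i, S i ζ * (ζ i - z i)) _ ζ := HasDbar.sum fun i _ =>
    (DifferentiableAt.hasDbar ((hS ζ hζ i).differentiableAt (by norm_num))).mul (hlin i)
  rw [h2.2 j] at h1
  simp only [Matrix.vecMul, dotProduct, dbarM, Matrix.of_apply, Pi.sub_apply, Pi.zero_apply]
  rw [← h1]
  exact Finset.sum_congr rfl fun i _ => by ring

lemma adj_mul_eq_zero {M : Matrix (Fin n) (Fin n) ℂ} {v T : Fin n → ℂ} (hv : v ≠ 0)
    (hM : Matrix.vecMul v M = 0) (hT : ∑ i, T i * v i = 0) (j : Fin n) :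
    ∑ i, M.adjugate j i * T i = 0 := by
  have h1 : ∑ i, M.adjugate j i * T i = (M.updateCol j T).det := by
    rw [← Matrix.cramer_apply, Matrix.cramer_eq_adjugate_mulVec]; rfl
  rw [h1, ← Matrix.exists_vecMul_eq_zero_iff]
  refine ⟨v, hv, ?_⟩
  ext l
  by_cases hl : l = j
  · subst hl
    simp only [Matrix.vecMul, dotProduct, Matrix.updateCol_self, Pi.zero_apply]
    rw [← hT]
    exact Finset.sum_congr rfl fun i _ => by ring
  · have := congrFun hM l
    simpa only [Matrix.vecMul, dotProduct, Matrix.updateCol_ne hl] using this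

lemma dbarM_continuousOn {Ω : Set (Fin n → ℂ)} {S : Fin n → (Fin n → ℂ) → ℂ}
    (hS : ∀ ζ ∈ Ω, ∀ i, ContDiffAt ℝ 2 (S i) ζ) (i j : Fin n) :
    ContinuousOn (fun ζ => dbar j (S i) ζ) Ω := fun ζ hζ =>
  (dbar_contDiffAt (m := 1) (by simpa [one_add_one_eq_two] using hS ζ hζ i)).continuousAt.continuousWithinAt

lemma cf_T {Ω K : Set (Fin n → ℂ)} (hΩ : IsOpen Ω) (hK : IsCompact K) (hKΩ : K ⊆ Ω) {z : Fin n → ℂ} (hz : z ∈ K)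
    {S T : Fin n → (Fin n → ℂ) → ℂ} (hS : ∀ ζ ∈ Ω, ∀ i, ContDiffAt ℝ 2 (S i) ζ)
    (hT : ∀ ζ ∈ Ω, ∀ i, ContDiffAt ℝ 2 (T i) ζ) {φ : (Fin n → ℂ) → ℂ} (hφ : AnalyticOnNhd ℂ φ Ω)
    (hS1 : ∀ ζ ∈ Ω, ζ ∉ K → ∑ i, S i ζ * (ζ i - z i) = 1)
    (hT0 : ∀ ζ ∈ Ω, ζ ∉ K → ∑ i, T i ζ * (ζ i - z i) = 0) :
    IntegrableOn (fun ζ => φ ζ * ∑ i, ((dbarM S ζ).updateRow i (fun j => dbar j (T i) ζ)).det) Ω ∧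
    ∫ ζ in Ω, φ ζ * ∑ i, ((dbarM S ζ).updateRow i (fun j => dbar j (T i) ζ)).det = 0 := by
  have hT' : ∀ ζ ∈ Ω, ∀ i, ContDiffAt ℝ 1 (fun ζ => φ ζ * T i ζ) ζ := fun ζ hζ i =>
    (AnalyticAt.contDiffAtR (hφ ζ hζ)).mul ((hT ζ hζ i).of_le (by norm_num))
  have key := integral_det_zero hΩ hK hKΩ hS hT' ?_
  · have heq : EqOn (fun ζ => ∑ i, ((dbarM S ζ).updateRow i (fun j => dbar j (fun ζ => φ ζ * T i ζ) ζ)).det)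
        (fun ζ => φ ζ * ∑ i, ((dbarM S ζ).updateRow i (fun j => dbar j (T i) ζ)).det) Ω := by
      intro ζ hζ
      simp only [Finset.mul_sum]
      refine Finset.sum_congr rfl fun i _ => ?_
      have : (fun j => dbar j (fun ζ => φ ζ * T i ζ) ζ) = φ ζ • fun j => dbar j (T i) ζ := by
        ext j
        rw [((HasDbar.holo (hφ ζ hζ).differentiableAt).mul
          (DifferentiableAt.hasDbar ((hT ζ hζ i).differentiableAt (by norm_num)))).2 j]
        simp
      rw [this, Matrix.det_updateRow_smul]
    refine ⟨key.1.congr_fun heq hΩ.measurableSet, ?_⟩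
    rw [← key.2]
    exact setIntegral_congr_fun hΩ.measurableSet heq.symm
  · intro ζ hζ hζK j
    refine adj_mul_eq_zero (v := ζ - z) ?_ (vecMul_dbarM_eq_zero hΩ hK hS hS1 hζ hζK) ?_ j
    · intro h; rw [sub_eq_zero] at h; exact hζK (h ▸ hz)
    · simp only [mul_assoc, ← Finset.mul_sum, Pi.sub_apply]
      rw [hT0 ζ hζ hζK, mul_zero]

lemma det_dbarM_eq_zero {Ω K : Set (Fin n → ℂ)} (hΩ : IsOpen Ω) (hK : IsCompact K) {z : Fin n → ℂ} (hz : z ∈ K)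
    {S : Fin n → (Fin n → ℂ) → ℂ} (hS : ∀ ζ ∈ Ω, ∀ i, ContDiffAt ℝ 2 (S i) ζ)
    (hS1 : ∀ ζ ∈ Ω, ζ ∉ K → ∑ i, S i ζ * (ζ i - z i) = 1)
    {ζ : Fin n → ℂ} (hζ : ζ ∈ Ω) (hζK : ζ ∉ K) : (dbarM S ζ).det = 0 := by
  rw [← Matrix.exists_vecMul_eq_zero_iff]
  refine ⟨ζ - z, ?_, vecMul_dbarM_eq_zero hΩ hK hS hS1 hζ hζK⟩
  intro h; rw [sub_eq_zero] at h; exact hζK (h ▸ hz)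

lemma cf_homotopy {Ω K : Set (Fin n → ℂ)} (hΩ : IsOpen Ω) (hK : IsCompact K) (hKΩ : K ⊆ Ω) {z : Fin n → ℂ} (hz : z ∈ K)
    {S T : Fin n → (Fin n → ℂ) → ℂ} (hS : ∀ ζ ∈ Ω, ∀ i, ContDiffAt ℝ 2 (S i) ζ)
    (hT : ∀ ζ ∈ Ω, ∀ i, ContDiffAt ℝ 2 (T i) ζ) {φ : (Fin n → ℂ) → ℂ} (hφ : AnalyticOnNhd ℂ φ Ω)
    (hS1 : ∀ ζ ∈ Ω, ζ ∉ K → ∑ i, S i ζ * (ζ i - z i) = 1)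
    (hT1 : ∀ ζ ∈ Ω, ζ ∉ K → ∑ i, T i ζ * (ζ i - z i) = 1) :
    ∫ ζ in Ω, φ ζ * (dbarM S ζ).det = ∫ ζ in Ω, φ ζ * (dbarM T ζ).det := by
  let D : Fin n → (Fin n → ℂ) → ℂ := fun i ζ => T i ζ - S i ζ
  let Q : ℝ → Fin n → (Fin n → ℂ) → ℂ := fun t i ζ => S i ζ + (t : ℂ) * D i ζ
  have hD : ∀ ζ ∈ Ω, ∀ i, ContDiffAt ℝ 2 (D i) ζ := fun ζ hζ i => (hT ζ hζ i).sub (hS ζ hζ i)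
  have hQ : ∀ t, ∀ ζ ∈ Ω, ∀ i, ContDiffAt ℝ 2 (Q t i) ζ := fun t ζ hζ i =>
    (hS ζ hζ i).add (contDiffAt_const.mul (hD ζ hζ i))
  have hD0 : ∀ ζ ∈ Ω, ζ ∉ K → ∑ i, D i ζ * (ζ i - z i) = 0 := by
    intro ζ hζ hζK
    simp only [D, sub_mul, Finset.sum_sub_distrib, hS1 ζ hζ hζK, hT1 ζ hζ hζK, sub_self]
  have hQ1 : ∀ t, ∀ ζ ∈ Ω, ζ ∉ K → ∑ i, Q t i ζ * (ζ i - z i) = 1 := by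
    intro t ζ hζ hζK
    simp only [Q, add_mul, Finset.sum_add_distrib, hS1 ζ hζ hζK, mul_assoc, ← Finset.mul_sum, hD0 ζ hζ hζK]
    simp
  have hQM : ∀ t, ∀ ζ ∈ Ω, dbarM (Q t) ζ = dbarM S ζ + (t : ℂ) • dbarM D ζ := by
    intro t ζ hζ
    ext i j
    simp only [dbarM, Matrix.of_apply, Matrix.add_apply, Matrix.smul_apply, smul_eq_mul]
    rw [((DifferentiableAt.hasDbar ((hS ζ hζ i).differentiableAt (by norm_num))).add
      ((HasDbar.const (t : ℂ)).mul (DifferentiableAt.hasDbar ((hD ζ hζ i).differentiableAt (by norm_num))))).2 j]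
    simp
  let F : ℝ → (Fin n → ℂ) → ℂ := fun t ζ => φ ζ * (dbarM S ζ + (t : ℂ) • dbarM D ζ).det
  let F' : ℝ → (Fin n → ℂ) → ℂ := fun t ζ => φ ζ * ∑ i,
    ((dbarM S ζ + (t : ℂ) • dbarM D ζ).updateRow i (dbarM D ζ i)).det
  have hFF' : ∀ t ζ, HasDerivAt (fun t => F t ζ) (F' t ζ) t := fun t ζ =>
    (hasDerivAt_det _ _ t).const_mul _
  have hF0 : ∀ t, ∀ ζ ∈ Ω, ζ ∉ K → F t ζ = 0 := by
    intro t ζ hζ hζK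
    simp only [F]
    rw [← hQM t ζ hζ, det_dbarM_eq_zero hΩ hK hz (hQ t) (hQ1 t) hζ hζK, mul_zero]
  have hF'0 : ∀ t, ∀ ζ ∈ Ω, ζ ∉ K → F' t ζ = 0 := by
    intro t ζ hζ hζK
    refine (hFF' t ζ).unique ?_
    simp only [hF0 _ ζ hζ hζK]
    exact hasDerivAt_const _ _
  have hentry : ∀ i l, ContinuousOn (fun p : ℝ × (Fin n → ℂ) => (dbarM S p.2 + (p.1 : ℂ) • dbarM D p.2) i l) (univ ×ˢ K) := by
    intro i l
    have e1 := ((dbarM_continuousOn hS i l).mono hKΩ).comp (continuousOn_snd (s := (univ : Set ℝ) ×ˢ K)) (fun p hp => hp.2)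
    have e2 := ((dbarM_continuousOn hD i l).mono hKΩ).comp (continuousOn_snd (s := (univ : Set ℝ) ×ˢ K)) (fun p hp => hp.2)
    have e3 : ContinuousOn (fun p : ℝ × (Fin n → ℂ) => (p.1 : ℂ)) (univ ×ˢ K) :=
      (Complex.continuous_ofReal.comp continuous_fst).continuousOn
    exact e1.add (e3.mul e2)
  have hφc : ContinuousOn (fun p : ℝ × (Fin n → ℂ) => φ p.2) (univ ×ˢ K) :=
    (hφ.continuousOn.mono hKΩ).comp continuousOn_snd (fun p hp => hp.2)
  have hFc : ContinuousOn (fun p : ℝ × (Fin n → ℂ) => F p.1 p.2) (univ ×ˢ K) :=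
    hφc.mul (continuousOn_det hentry)
  have hF'c : ContinuousOn (fun p : ℝ × (Fin n → ℂ) => F' p.1 p.2) (univ ×ˢ K) := by
    refine hφc.mul (continuousOn_finsetSum _ fun i _ => continuousOn_det (continuousOn_updateRow i hentry fun l => ?_))
    exact ((dbarM_continuousOn hD i l).mono hKΩ).comp (continuousOn_snd (s := (univ : Set ℝ) ×ˢ K)) (fun p hp => hp.2)
  have hslice : ∀ (G : ℝ → (Fin n → ℂ) → ℂ), ContinuousOn (fun p : ℝ × (Fin n → ℂ) => G p.1 p.2) (univ ×ˢ K) →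
      ∀ t, ContinuousOn (G t) K := fun G hG t =>
    hG.comp (f := fun ζ => (t, ζ)) (by fun_prop) (fun ζ hζ => ⟨mem_univ _, hζ⟩)
  have hFK : ∀ t, ∫ ζ in Ω, F t ζ = ∫ ζ in K, F t ζ := fun t =>
    setIntegral_eq_of_subset_of_forall_sdiff_eq_zero hΩ.measurableSet hKΩ fun ζ hζ => hF0 t ζ hζ.1 hζ.2
  have hF'K : ∀ t, ∫ ζ in Ω, F' t ζ = ∫ ζ in K, F' t ζ := fun t =>
    setIntegral_eq_of_subset_of_forall_sdiff_eq_zero hΩ.measurableSet hKΩ fun ζ hζ => hF'0 t ζ hζ.1 hζ.2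
  have hF'int : ∀ t, ∫ ζ in Ω, F' t ζ = 0 := by
    intro t
    rw [← (cf_T hΩ hK hKΩ hz (hQ t) hD hφ (hQ1 t) hD0).2]
    refine setIntegral_congr_fun hΩ.measurableSet fun ζ hζ => ?_
    simp only [F', hQM t ζ hζ]
    rfl
  have hder : ∀ t, HasDerivAt (fun t => ∫ ζ in K, F t ζ) 0 t := by
    intro t
    obtain ⟨C, hC⟩ := ((isCompact_closedBall t 1).prod hK).exists_bound_of_continuousOn
      (hF'c.mono (prod_mono (subset_univ _) subset_rfl))
    have := hasDerivAt_integral_of_dominated_loc_of_deriv_le (μ := volume.restrict K) (F := F) (F' := F')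
      (x₀ := t) (s := ball t 1) (bound := fun _ => C) (ball_mem_nhds t one_pos)
      (Eventually.of_forall fun t => (hslice F hFc t).aestronglyMeasurable hK.measurableSet)
      ((hslice F hFc t).integrableOn_compact hK)
      ((hslice F' hF'c t).aestronglyMeasurable hK.measurableSet)
      ((ae_restrict_iff' hK.measurableSet).2 (Eventually.of_forall fun ζ hζ s hs =>
        hC (s, ζ) ⟨ball_subset_closedBall hs, hζ⟩))
      (integrableOn_const (hK.measure_lt_top.ne))
      (Eventually.of_forall fun ζ s _ => hFF' s ζ)
    rw [← hF'int t, hF'K t]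
    exact this.2
  have hconst := is_const_of_deriv_eq_zero (f := fun t => ∫ ζ in K, F t ζ)
    (fun t => (hder t).differentiableAt) (fun t => (hder t).deriv) 0 1
  rw [← hFK, ← hFK] at hconst
  convert hconst using 1
  · refine setIntegral_congr_fun hΩ.measurableSet fun ζ hζ => ?_
    simp [F]
  · refine setIntegral_congr_fun hΩ.measurableSet fun ζ hζ => ?_
    simp only [F]
    rw [← hQM 1 ζ hζ]
    have : Q 1 = T := by ext i ζ; simp [Q, D]
    rw [this]

end JacIdeal

namespace JacIdeal
open MeasureTheory Metric Set Filter Topology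

/-- A smooth step function. -/
noncomputable def psi (ε x : ℝ) : ℝ := Real.smoothTransition (2 * x / ε ^ 2 - 1)

/-- The step function divided by the variable. -/
noncomputable def kap (ε x : ℝ) : ℝ := psi ε x / x

/-- The squared Euclidean norm. -/
noncomputable def rho {n : ℕ} (w : Fin n → ℂ) : ℝ := ∑ i, ‖w i‖ ^ 2

section
variable {ε : ℝ}

lemma psi_contDiff (m : ℕ∞) : ContDiff ℝ m (psi ε) := by
  unfold psi
  exact Real.smoothTransition.contDiff.comp (by fun_prop)

lemma psi_zero {x : ℝ} (hε : 0 < ε) (hx : x ≤ ε ^ 2 / 2) : psi ε x = 0 := by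
  refine Real.smoothTransition.zero_of_nonpos ?_
  have : 2 * x / ε ^ 2 ≤ 1 := by rw [div_le_one (by positivity)]; linarith
  linarith

lemma psi_one {x : ℝ} (hε : 0 < ε) (hx : ε ^ 2 ≤ x) : psi ε x = 1 := by
  refine Real.smoothTransition.one_of_one_le ?_
  have : 2 ≤ 2 * x / ε ^ 2 := by rw [le_div_iff₀ (by positivity)]; linarith
  linarith

lemma psi_nonneg (x : ℝ) : 0 ≤ psi ε x := Real.smoothTransition.nonneg _

lemma psi_mono : Monotone (psi ε) := by
  intro x y hxy
  refine Real.smoothTransition.monotone ?_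
  have : 0 ≤ ε ^ 2 := by positivity
  gcongr

lemma psi_eq_mul (hε : 0 < ε) (x : ℝ) : psi ε x = x * kap ε x := by
  by_cases hx : x = 0
  · subst hx; rw [psi_zero hε (by positivity)]; simp
  · rw [kap]; field_simp

lemma kap_nonneg (hε : 0 < ε) (x : ℝ) : 0 ≤ kap ε x := by
  rcases le_total 0 x with h | h
  · exact div_nonneg (psi_nonneg x) h
  · rw [kap, psi_zero hε (h.trans (by positivity))]; simp

lemma kap_contDiff (hε : 0 < ε) (m : ℕ∞) : ContDiff ℝ m (kap ε) := by
  rw [contDiff_iff_contDiffAt]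
  intro x
  by_cases hx : x < ε ^ 2 / 2
  · have : kap ε =ᶠ[𝓝 x] fun _ => 0 := by
      filter_upwards [Iio_mem_nhds hx] with y hy
      rw [kap, psi_zero hε (le_of_lt hy)]; simp
    exact contDiffAt_const.congr_of_eventuallyEq this
  · have hx0 : x ≠ 0 := by
      have : 0 < ε ^ 2 / 2 := by positivity
      intro h; subst h; exact hx this
    exact (psi_contDiff m).contDiffAt.div contDiffAt_id hx0

lemma kap_differentiable (hε : 0 < ε) : Differentiable ℝ (kap ε) :=
  (kap_contDiff hε 1).differentiable (by norm_num)

lemma deriv_psi (hε : 0 < ε) (x : ℝ) : deriv (psi ε) x = kap ε x + x * deriv (kap ε) x := by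
  have h : psi ε = fun x => x * kap ε x := funext (psi_eq_mul hε)
  have h1 := (hasDerivAt_id x).mul ((kap_differentiable hε) x).hasDerivAt
  have h2 : HasDerivAt (psi ε) (1 * kap ε x + x * deriv (kap ε) x) x := by rw [h]; exact h1
  rw [h2.deriv, one_mul]

lemma deriv_kap_zero (hε : 0 < ε) {x : ℝ} (h : kap ε x = 0) : deriv (kap ε) x = 0 := by
  refine IsLocalMin.deriv_eq_zero (Eventually.of_forall fun y => ?_)
  rw [h]; exact kap_nonneg hε y

end

section
variable {n : ℕ} {ε : ℝ}

lemma rho_eq (w : Fin n → ℂ) : ((rho w : ℝ) : ℂ) = ∑ i, w i * (starRingEnd ℂ) (w i) := by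
  rw [rho]; push_cast
  exact Finset.sum_congr rfl fun i _ => by rw [Complex.mul_conj']

lemma norm_sq_le_rho (w : Fin n → ℂ) : ‖w‖ ^ 2 ≤ rho w := by
  have h0 : 0 ≤ rho w := Finset.sum_nonneg fun i _ => by positivity
  have h1 : ‖w‖ ≤ √(rho w) := by
    rw [pi_norm_le_iff_of_nonneg (Real.sqrt_nonneg _)]
    intro i
    refine Real.le_sqrt_of_sq_le ?_
    exact Finset.single_le_sum (f := fun i => ‖w i‖ ^ 2) (fun i _ => by positivity) (Finset.mem_univ i)
  calc ‖w‖ ^ 2 ≤ √(rho w) ^ 2 := by gcongr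
    _ = rho w := Real.sq_sqrt h0

/-- The radial weight of the base kernel. -/
noncomputable def WW (ε : ℝ) (w : Fin n → ℂ) : ℝ := kap ε (rho w) ^ (n - 1) * deriv (psi ε) (rho w)

lemma rho_continuous : Continuous (rho (n := n)) := by unfold rho; fun_prop

lemma WW_continuous (hε : 0 < ε) : Continuous (WW (n := n) ε) := by
  unfold WW
  have h1 := (kap_differentiable hε).continuous.comp (rho_continuous (n := n))
  have h2 := ((psi_contDiff (ε := ε) 1).continuous_deriv (by norm_num)).comp (rho_continuous (n := n))
  exact (h1.pow _).mul h2

lemma WW_nonneg (hε : 0 < ε) (w : Fin n → ℂ) : 0 ≤ WW ε w :=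
  mul_nonneg (pow_nonneg (kap_nonneg hε _) _) psi_mono.deriv_nonneg

lemma WW_zero (hε : 0 < ε) (w : Fin n → ℂ) (hw : ε < ‖w‖) : WW ε w = 0 := by
  have h : ε ^ 2 < rho w := lt_of_lt_of_le (by gcongr) (norm_sq_le_rho w)
  have : psi ε =ᶠ[𝓝 (rho w)] fun _ => 1 := by
    filter_upwards [Ioi_mem_nhds h] with y hy
    exact psi_one hε (le_of_lt hy)
  rw [WW, this.deriv_eq]; simp

lemma WW_rot (w : Fin n → ℂ) (t : ℂ) (ht : ‖t‖ = 1) : WW ε (t • w) = WW ε w := by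
  have : rho (t • w) = rho w := by simp [rho, ht]
  simp [WW, this]

lemma WW_ne_zero (hn : 0 < n) (hε : 0 < ε) : ∃ w : Fin n → ℂ, WW ε w ≠ 0 := by
  have hlt : ε ^ 2 / 2 < ε ^ 2 := by have : 0 < ε ^ 2 := by positivity
                                     linarith
  obtain ⟨x, hx, hx'⟩ := exists_deriv_eq_slope (psi ε) hlt (psi_contDiff 1).continuous.continuousOn
    ((psi_contDiff 1).differentiable (by norm_num)).differentiableOn
  rw [psi_one hε le_rfl, psi_zero hε le_rfl] at hx'
  have hd : 0 < deriv (psi ε) x := by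
    rw [hx']; exact div_pos (by norm_num) (by linarith)
  have hx0 : 0 < x := lt_trans (by positivity) hx.1
  have hk : kap ε x ≠ 0 := by
    intro h
    have h1 := deriv_psi hε x
    rw [h, deriv_kap_zero hε h] at h1
    simp at h1; linarith
  let w : Fin n → ℂ := Pi.single ⟨0, hn⟩ ((√x : ℝ) : ℂ)
  have hw : rho w = x := by
    rw [rho, Finset.sum_eq_single ⟨0, hn⟩]
    · simp [w, Real.sq_sqrt hx0.le]
    · intro b _ hb; simp [w, Pi.single_eq_of_ne hb]
    · simp
  refine ⟨w, ?_⟩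
  rw [WW, hw]
  exact mul_ne_zero (pow_ne_zero _ hk) hd.ne'

lemma integral_WW_pos (hn : 0 < n) (hε : 0 < ε) : 0 < ∫ w in closedBall (0 : Fin n → ℂ) ε, WW ε w := by
  have h1 : ∫ w in closedBall (0 : Fin n → ℂ) ε, WW ε w = ∫ w : Fin n → ℂ, WW ε w := by
    refine setIntegral_eq_integral_of_forall_compl_eq_zero fun w hw => WW_zero hε w ?_
    simpa using hw
  rw [h1]
  obtain ⟨w, hw⟩ := WW_ne_zero (ε := ε) hn hε
  refine (WW_continuous hε).integral_pos_of_hasCompactSupport_nonneg_nonzero ?_ (WW_nonneg hε) hw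
  refine HasCompactSupport.intro (isCompact_closedBall 0 ε) fun w hw => WW_zero hε w ?_
  simpa using hw

/-- The base kernel. -/
noncomputable def S0 (ε : ℝ) (z : Fin n → ℂ) (i : Fin n) (ζ : Fin n → ℂ) : ℂ :=
  ((kap ε (rho (ζ - z)) : ℝ) : ℂ) * (starRingEnd ℂ) (ζ i - z i)

lemma analyticAt_coord_sub (z : Fin n → ℂ) (i : Fin n) (ζ : Fin n → ℂ) :
    AnalyticAt ℂ (fun ζ : Fin n → ℂ => ζ i - z i) ζ :=
  ((ContinuousLinearMap.proj (R := ℂ) (φ := fun _ : Fin n => ℂ) i).analyticAt ζ).sub analyticAt_const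

lemma S0_contDiffAt (hε : 0 < ε) (z : Fin n → ℂ) (i : Fin n) (ζ : Fin n → ℂ) : ContDiffAt ℝ 2 (S0 ε z i) ζ := by
  unfold S0
  refine ContDiffAt.mul (ofReal_contDiffAt ?_) (AnalyticAt.contDiffAt_conj (analyticAt_coord_sub z i ζ))
  refine ContDiffAt.comp ζ ((kap_contDiff hε 2).contDiffAt) ?_
  unfold rho
  refine ContDiffAt.sum fun i _ => ?_
  exact AnalyticAt.contDiffAt_normSq (analyticAt_coord_sub z i ζ)

lemma fderiv_coord_sub (z : Fin n → ℂ) (i j : Fin n) (ζ : Fin n → ℂ) :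
    fderiv ℂ (fun ζ : Fin n → ℂ => ζ i - z i) ζ (Pi.single j 1) = if i = j then 1 else 0 := by
  have h : HasFDerivAt (fun ζ : Fin n → ℂ => ζ i - z i)
      (ContinuousLinearMap.proj (R := ℂ) (φ := fun _ : Fin n => ℂ) i) ζ :=
    (ContinuousLinearMap.proj (R := ℂ) (φ := fun _ : Fin n => ℂ) i).hasFDerivAt.sub_const _
  rw [h.fderiv]
  simp [Pi.single_apply]

lemma dbarM_S0 (hε : 0 < ε) (z ζ : Fin n → ℂ) (i j : Fin n) :
    dbarM (S0 ε z) ζ i j = ((kap ε (rho (ζ - z)) : ℝ) : ℂ) * (if i = j then 1 else 0) +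
      ((deriv (kap ε) (rho (ζ - z)) : ℝ) : ℂ) * ((starRingEnd ℂ) (ζ i - z i) * (ζ j - z j)) := by
  have hr : HasDbar (fun ζ => ((rho (ζ - z) : ℝ) : ℂ)) (fun j => ζ j - z j) ζ := by
    have h1 : HasDbar (fun ζ => ∑ i, ((‖ζ i - z i‖ ^ 2 : ℝ) : ℂ)) _ ζ :=
      HasDbar.sum (s := Finset.univ) fun i _ => hasDbar_normSq (analyticAt_coord_sub z i ζ).differentiableAt
    have h2 : (fun ζ => ((rho (ζ - z) : ℝ) : ℂ)) = (fun ζ => ∑ i, ((‖ζ i - z i‖ ^ 2 : ℝ) : ℂ)) := by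
      ext ζ; simp [rho]
    rw [h2]
    refine h1.congr_D fun j => ?_
    simp [fderiv_coord_sub]
  have hk := HasDbar.comp_real hr (((kap_differentiable hε) (rho (ζ - z))).hasDerivAt.ofReal_comp)
  have h3 := hk.mul (HasDbar.conj_holo (analyticAt_coord_sub z i ζ).differentiableAt)
  have := h3.2 j
  simp only [fderiv_coord_sub] at this
  simp only [dbarM, Matrix.of_apply]
  refine this.trans ?_
  split_ifs <;> simp <;> ring

lemma det_dbarM_S0 (hn : 0 < n) (hε : 0 < ε) (z ζ : Fin n → ℂ) :
    (dbarM (S0 ε z) ζ).det = ((WW ε (ζ - z) : ℝ) : ℂ) := by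
  have : Nonempty (Fin n) := ⟨⟨0, hn⟩⟩
  set k := kap ε (rho (ζ - z)) with hk
  set k' := deriv (kap ε) (rho (ζ - z)) with hk'
  by_cases h0 : k = 0
  · have h1 : k' = 0 := deriv_kap_zero hε h0
    have h2 : dbarM (S0 ε z) ζ = 0 := by
      ext i j
      rw [dbarM_S0 hε, ← hk, ← hk', h0, h1]; simp
    rw [h2, Matrix.det_zero, WW, deriv_psi hε, ← hk, ← hk', h0, h1]
    simp
  · have hkc : (k : ℂ) ≠ 0 := by exact_mod_cast h0
    have h2 : dbarM (S0 ε z) ζ = (k : ℂ) • (1 + Matrix.replicateCol Unit (fun i => (starRingEnd ℂ) (ζ i - z i)) *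
        Matrix.replicateRow Unit (fun j => (k : ℂ)⁻¹ * k' * (ζ j - z j))) := by
      ext i j
      rw [dbarM_S0 hε, ← hk, ← hk']
      simp only [Matrix.smul_apply, Matrix.add_apply, Matrix.one_apply, Matrix.mul_apply, Matrix.replicateCol_apply,
        Matrix.replicateRow_apply, Finset.univ_unique, Finset.sum_singleton, smul_eq_mul]
      field_simp
    rw [h2, Matrix.det_smul, Matrix.det_one_add_replicateCol_mul_replicateRow, Fintype.card_fin]
    have h3 : (fun j => (k : ℂ)⁻¹ * k' * (ζ j - z j)) ⬝ᵥ (fun i => (starRingEnd ℂ) (ζ i - z i)) =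
        (k : ℂ)⁻¹ * k' * ((rho (ζ - z) : ℝ) : ℂ) := by
      rw [rho_eq, dotProduct, Finset.mul_sum]
      exact Finset.sum_congr rfl fun i _ => by simp only [Pi.sub_apply]; ring
    rw [h3, WW, deriv_psi hε, ← hk, ← hk']
    obtain ⟨m, rfl⟩ : ∃ m, n = m + 1 := ⟨n - 1, by omega⟩
    push_cast
    simp only [pow_succ]
    field_simp

lemma S0_dot (hε : 0 < ε) (z ζ : Fin n → ℂ) (h : ε ≤ ‖ζ - z‖) : ∑ i, S0 ε z i ζ * (ζ i - z i) = 1 := by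
  have h1 : ∑ i, S0 ε z i ζ * (ζ i - z i) = ((rho (ζ - z) * kap ε (rho (ζ - z)) : ℝ) : ℂ) := by
    push_cast
    rw [rho_eq, Finset.sum_mul]
    exact Finset.sum_congr rfl fun i _ => by simp only [S0, Pi.sub_apply]; ring
  rw [h1, ← psi_eq_mul hε, psi_one hε]
  · simp
  · exact le_trans (by gcongr) (norm_sq_le_rho _)

lemma integral_rot (F : (Fin n → ℂ) → ℂ) (t : ℂ) (ht : ‖t‖ = 1) (ε : ℝ) :
    ∫ w in closedBall (0 : Fin n → ℂ) ε, F (t • w) = ∫ w in closedBall (0 : Fin n → ℂ) ε, F w := by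
  let c : Circle := ⟨t, mem_sphere_zero_iff_norm.2 ht⟩
  have hmp : MeasurePreserving (fun (w : Fin n → ℂ) (i : Fin n) => rotation c (w i)) volume volume :=
    volume_preserving_pi fun _ => (rotation c).measurePreserving
  have hf : (fun (w : Fin n → ℂ) (i : Fin n) => rotation c (w i)) = fun w => t • w := by
    ext w i
    rw [rotation_apply]
    rfl
  rw [hf] at hmp
  have ht0 : t ≠ 0 := by intro h; simp [h] at ht
  have hemb : MeasurableEmbedding (fun w : Fin n → ℂ => t • w) :=
    (Homeomorph.smulOfNeZero t ht0).measurableEmbedding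
  have := hmp.setIntegral_preimage_emb hemb F (closedBall (0 : Fin n → ℂ) ε)
  rw [← this]
  congr 2
  ext w
  simp [norm_smul, ht]

lemma mean_value {r : ℝ} (hr : 0 < r) {z : Fin n → ℂ} (hz : ‖z‖ < r) {φ : (Fin n → ℂ) → ℂ} {R : ℝ}
    (hR : 2 * r < R) (hφ : AnalyticOnNhd ℂ φ (ball 0 R)) :
    ∫ w in closedBall (0 : Fin n → ℂ) r, φ (z + w) * ((WW r w : ℝ) : ℂ) =
      φ z * ((∫ w in closedBall (0 : Fin n → ℂ) r, WW r w : ℝ) : ℂ) := by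
  let η := (r - ‖z‖) / r
  have hη : 0 < η := div_pos (by linarith) hr
  have hKc : IsCompact (closedBall (0 : Fin n → ℂ) r) := isCompact_closedBall _ _
  have hin : ∀ t ∈ ball (0 : ℂ) (1 + η), ∀ w ∈ closedBall (0 : Fin n → ℂ) r, z + t • w ∈ closedBall (0 : Fin n → ℂ) (2 * r) := by
    intro t ht w hw
    simp only [mem_closedBall, mem_ball, dist_zero_right] at *
    have h1 : ‖t • w‖ ≤ (1 + η) * r := by
      rw [norm_smul]; gcongr
    have h2 : (1 + η) * r = 2 * r - ‖z‖ := by simp only [η]; field_simp; ring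
    linarith [norm_add_le z (t • w)]
  have hsub : closedBall (0 : Fin n → ℂ) (2 * r) ⊆ ball 0 R := closedBall_subset_ball hR
  obtain ⟨C, hC⟩ := (isCompact_closedBall (0 : Fin n → ℂ) (2 * r)).exists_bound_of_continuousOn
    (hφ.continuousOn.mono hsub)
  have hWi : IntegrableOn (fun w : Fin n → ℂ => WW r w) (closedBall 0 r) :=
    (WW_continuous hr).continuousOn.integrableOn_compact hKc
  let A : ℂ → ℂ := fun t => ∫ w in closedBall (0 : Fin n → ℂ) r, φ (z + t • w) * ((WW r w : ℝ) : ℂ)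
  have hA : AnalyticOnNhd ℂ A (ball 0 (1 + η)) := by
    refine analyticOnNhd_integral isOpen_ball (fun (w : Fin n → ℂ) (t : ℂ) => φ (z + t • w) * ((WW r w : ℝ) : ℂ))
      (fun w => C * WW r w) (hWi.const_mul C) ?_ ?_ ?_
    · intro t ht
      refine ContinuousOn.aestronglyMeasurable ?_ hKc.measurableSet
      refine ContinuousOn.mul ?_ (Complex.continuous_ofReal.comp (WW_continuous hr)).continuousOn
      exact (hφ.continuousOn.mono hsub).comp (by fun_prop) (fun w hw => hin t ht w hw)
    · refine (ae_restrict_iff' hKc.measurableSet).2 (Eventually.of_forall fun w hw => ?_)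
      refine DifferentiableOn.mul_const ?_ _
      exact hφ.differentiableOn.comp (by fun_prop) (fun t ht => hsub (hin t ht w hw))
    · refine (ae_restrict_iff' hKc.measurableSet).2 (Eventually.of_forall fun w hw t ht => ?_)
      rw [norm_mul, Complex.norm_real, Real.norm_of_nonneg (WW_nonneg hr w)]
      have := hC _ (hin t ht w hw)
      have := WW_nonneg hr w
      gcongr
  have hrot : ∀ t ∈ sphere (0 : ℂ) |1|, A t = A 1 := by
    intro t ht
    have ht' : ‖t‖ = 1 := by simpa using ht
    simp only [A, one_smul]
    rw [← integral_rot (fun w => φ (z + w) * ((WW r w : ℝ) : ℂ)) t ht' r]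
    simp only [WW_rot _ t ht']
  have h1 := Real.circleAverage_const_on_circle hrot
  have h2 : Real.circleAverage A 0 1 = A 0 := by
    refine DiffContOnCl.circleAverage ?_
    refine (hA.differentiableOn.mono ?_).diffContOnCl
    rw [abs_one, closure_ball _ one_ne_zero]
    exact closedBall_subset_ball (by linarith)
  have h3 : A 1 = A 0 := by rw [← h1, h2]
  simp only [A, one_smul, zero_smul, add_zero] at h3
  rw [h3, integral_const_mul]
  congr 1
  exact integral_ofReal

theorem cf_base (hn : 0 < n) {r : ℝ} (hr : 0 < r) : ∃ c : ℂ, c ≠ 0 ∧ ∀ z : Fin n → ℂ, ‖z‖ < r →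
    ∃ S : Fin n → (Fin n → ℂ) → ℂ, (∀ ζ i, ContDiffAt ℝ 2 (S i) ζ) ∧
      (∀ ζ, ζ ∉ closedBall (0 : Fin n → ℂ) (2 * r) → ∑ i, S i ζ * (ζ i - z i) = 1) ∧
      ∀ R, 2 * r < R → ∀ φ : (Fin n → ℂ) → ℂ, AnalyticOnNhd ℂ φ (ball 0 R) →
        ∫ ζ in ball (0 : Fin n → ℂ) R, φ ζ * (dbarM S ζ).det = c * φ z := by
  refine ⟨((∫ w in closedBall (0 : Fin n → ℂ) r, WW r w : ℝ) : ℂ), ?_, ?_⟩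
  · exact_mod_cast (integral_WW_pos hn hr).ne'
  · intro z hz
    refine ⟨S0 r z, fun ζ i => S0_contDiffAt hr z i ζ, ?_, ?_⟩
    · intro ζ hζ
      refine S0_dot hr z ζ ?_
      simp only [mem_closedBall, dist_zero_right, not_le] at hζ
      linarith [norm_sub_norm_le ζ z]
    · intro R hR φ hφ
      rw [mul_comm, ← mean_value hr hz hR hφ]
      simp only [det_dbarM_S0 hn hr]
      have hmp := (measurePreserving_add_left (volume : Measure (Fin n → ℂ)) z)
      have hemb : MeasurableEmbedding (fun w : Fin n → ℂ => z + w) := measurableEmbedding_addLeft z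
      have := hmp.setIntegral_preimage_emb hemb (fun ζ => φ ζ * ((WW r (ζ - z) : ℝ) : ℂ)) (closedBall z r)
      have hpre : (fun w : Fin n → ℂ => z + w) ⁻¹' (closedBall z r) = closedBall 0 r := by
        ext w; simp [dist_eq_norm]
      rw [hpre] at this
      simp only [add_sub_cancel_left] at this
      rw [this]
      refine setIntegral_eq_of_subset_of_forall_sdiff_eq_zero measurableSet_ball ?_ ?_
      · intro ζ hζ
        simp only [mem_closedBall, mem_ball, dist_eq_norm, sub_zero] at *
        have := norm_sub_norm_le ζ z
        linarith
      · intro ζ hζ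
        rw [WW_zero hr]
        · simp
        · have := hζ.2
          simpa [dist_eq_norm] using this

end

end JacIdeal

namespace JacIdeal
open MeasureTheory Metric Set Filter Topology

variable {n : ℕ}

lemma cf_integrable {Ω K : Set (Fin n → ℂ)} (hΩ : IsOpen Ω) (hK : IsCompact K) (hKΩ : K ⊆ Ω) {z : Fin n → ℂ} (hz : z ∈ K)
    {S : Fin n → (Fin n → ℂ) → ℂ} (hS : ∀ ζ ∈ Ω, ∀ i, ContDiffAt ℝ 2 (S i) ζ)
    {φ : (Fin n → ℂ) → ℂ} (hφ : AnalyticOnNhd ℂ φ Ω)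
    (hS1 : ∀ ζ ∈ Ω, ζ ∉ K → ∑ i, S i ζ * (ζ i - z i) = 1) :
    IntegrableOn (fun ζ => φ ζ * (dbarM S ζ).det) Ω := by
  have h1 : IntegrableOn (fun ζ => φ ζ * (dbarM S ζ).det) K := by
    refine ContinuousOn.integrableOn_compact hK ?_
    refine (hφ.continuousOn.mono hKΩ).mul (continuousOn_det fun i l => ?_)
    exact (dbarM_continuousOn hS i l).mono hKΩ
  refine h1.of_forall_sdiff_eq_zero hΩ.measurableSet ?_
  intro ζ hζ
  rw [det_dbarM_eq_zero hΩ hK hz hS hS1 hζ.1 hζ.2, mul_zero]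

theorem cf_formula (hn : 0 < n) {r : ℝ} (hr : 0 < r) : ∃ c : ℂ, c ≠ 0 ∧ ∀ z : Fin n → ℂ, ‖z‖ < r →
    ∀ R, 2 * r < R → ∀ φ : (Fin n → ℂ) → ℂ, AnalyticOnNhd ℂ φ (ball 0 R) →
    ∀ S s : Fin n → (Fin n → ℂ) → ℂ,
      (∀ ζ ∈ ball (0 : Fin n → ℂ) R, ∀ i, ContDiffAt ℝ 2 (S i) ζ) →
      (∀ ζ ∈ ball (0 : Fin n → ℂ) R, ∀ i, ContDiffAt ℝ 2 (s i) ζ) →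
      (∀ ζ ∈ ball (0 : Fin n → ℂ) R, ζ ∉ closedBall (0 : Fin n → ℂ) (2 * r) → ∑ i, S i ζ * (ζ i - z i) = 1) →
      (∀ ζ ∈ ball (0 : Fin n → ℂ) R, ζ ∉ closedBall (0 : Fin n → ℂ) (2 * r) → ∑ i, s i ζ * (ζ i - z i) = 1) →
      ∫ ζ in ball (0 : Fin n → ℂ) R, φ ζ * ∑ i, ((dbarM S ζ).updateRow i (fun j => dbar j (s i) ζ)).det
        = c * φ z := by
  obtain ⟨c, hc, hbase⟩ := cf_base hn hr
  have hn' : (n : ℂ) ≠ 0 := by exact_mod_cast hn.ne'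
  refine ⟨n * c, mul_ne_zero hn' hc, ?_⟩
  intro z hz R hR φ hφ S s hS hs hS1 hs1
  obtain ⟨S', hS', hS'1, hS'int⟩ := hbase z hz
  have hKΩ : closedBall (0 : Fin n → ℂ) (2 * r) ⊆ ball 0 R := closedBall_subset_ball hR
  have hzK : z ∈ closedBall (0 : Fin n → ℂ) (2 * r) := by
    simp only [mem_closedBall, dist_zero_right]; linarith
  have hKc : IsCompact (closedBall (0 : Fin n → ℂ) (2 * r)) := isCompact_closedBall _ _
  have h1 : ∫ ζ in ball (0 : Fin n → ℂ) R, φ ζ * (dbarM S ζ).det = c * φ z := by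
    rw [← hS'int R hR φ hφ]
    exact cf_homotopy isOpen_ball hKc hKΩ hzK hS (fun ζ _ => hS' ζ) hφ hS1 (fun ζ _ => hS'1 ζ)
  have hD : ∀ ζ ∈ ball (0 : Fin n → ℂ) R, ∀ i, ContDiffAt ℝ 2 (fun ζ => s i ζ - S i ζ) ζ :=
    fun ζ hζ i => (hs ζ hζ i).sub (hS ζ hζ i)
  have hD0 : ∀ ζ ∈ ball (0 : Fin n → ℂ) R, ζ ∉ closedBall (0 : Fin n → ℂ) (2 * r) →
      ∑ i, (s i ζ - S i ζ) * (ζ i - z i) = 0 := by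
    intro ζ hζ hζK
    simp only [sub_mul, Finset.sum_sub_distrib, hS1 ζ hζ hζK, hs1 ζ hζ hζK, sub_self]
  obtain ⟨h2, h3⟩ := cf_T isOpen_ball hKc hKΩ hzK hS hD hφ hS1 hD0
  have heq : EqOn (fun ζ => φ ζ * ∑ i, ((dbarM S ζ).updateRow i (fun j => dbar j (s i) ζ)).det)
      (fun ζ => φ ζ * ∑ i, ((dbarM S ζ).updateRow i (fun j => dbar j (fun ζ => s i ζ - S i ζ) ζ)).det +
        n * (φ ζ * (dbarM S ζ).det)) (ball (0 : Fin n → ℂ) R) := by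
    intro ζ hζ
    have : ∀ i, ((dbarM S ζ).updateRow i (fun j => dbar j (s i) ζ)).det =
        ((dbarM S ζ).updateRow i (fun j => dbar j (fun ζ => s i ζ - S i ζ) ζ)).det + (dbarM S ζ).det := by
      intro i
      have e1 : (fun j => dbar j (s i) ζ) = (fun j => dbar j (fun ζ => s i ζ - S i ζ) ζ) + (dbarM S ζ) i := by
        ext j
        rw [Pi.add_apply, ((DifferentiableAt.hasDbar ((hs ζ hζ i).differentiableAt (by norm_num))).sub
          (DifferentiableAt.hasDbar ((hS ζ hζ i).differentiableAt (by norm_num)))).2 j]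
        simp [dbarM]
      rw [e1, Matrix.det_updateRow_add, Matrix.updateRow_eq_self]
    simp only [this, Finset.sum_add_distrib]
    simp
    ring
  rw [setIntegral_congr_fun measurableSet_ball heq, integral_add h2
    ((cf_integrable isOpen_ball hKc hKΩ hzK hS hφ hS1).const_mul _), h3, integral_const_mul, h1]
  ring

lemma hadamard {E P : Type*} [NormedAddCommGroup E] [NormedSpace ℂ E] [FiniteDimensional ℂ E]
    [NormedAddCommGroup P] [NormedSpace ℂ P] [FiniteDimensional ℂ P]
    {O K : Set E} {V : Set P} {F : E → ℂ} (hF : AnalyticOnNhd ℂ F O) (hK : IsCompact K) (hKO : K ⊆ O)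
    (hV : IsOpen V) {p d : P → E} (hp : DifferentiableOn ℂ p V) (hd : DifferentiableOn ℂ d V)
    (hin : ∀ x ∈ V, ∀ t ∈ Icc (0 : ℝ) 1, p x + (t : ℂ) • d x ∈ K) :
    (∀ e : E, AnalyticOnNhd ℂ (fun x => ∫ t in Icc (0 : ℝ) 1, fderiv ℂ F (p x + (t : ℂ) • d x) e) V) ∧
    (∀ e : E, ∀ x ∈ V, IntegrableOn (fun t : ℝ => fderiv ℂ F (p x + (t : ℂ) • d x) e) (Icc 0 1)) ∧
    ∀ x ∈ V, ∫ t in Icc (0 : ℝ) 1, fderiv ℂ F (p x + (t : ℂ) • d x) (d x) = F (p x + d x) - F (p x) := by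
  have hFe : ∀ e, AnalyticOnNhd ℂ (fun y => fderiv ℂ F y e) O := fun e y hy =>
    ((ContinuousLinearMap.apply ℂ ℂ e).analyticAt _).comp (hF.fderiv y hy)
  have hc : ∀ e : E, ∀ x ∈ V, ContinuousOn (fun t : ℝ => fderiv ℂ F (p x + (t : ℂ) • d x) e) (Icc 0 1) := by
    intro e x hx
    refine ((hFe e).continuousOn).comp (f := fun t : ℝ => p x + (t : ℂ) • d x) ?_ (fun t ht => hKO (hin x hx t ht))
    exact (continuous_const.add (Complex.continuous_ofReal.smul continuous_const)).continuousOn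
  refine ⟨fun e => ?_, fun e x hx => (hc e x hx).integrableOn_compact isCompact_Icc, fun x hx => ?_⟩
  · obtain ⟨C, hC⟩ := hK.exists_bound_of_continuousOn ((hFe e).continuousOn.mono hKO)
    refine analyticOnNhd_integral hV (fun (t : ℝ) x => fderiv ℂ F (p x + (t : ℂ) • d x) e) (fun _ => C)
      (integrableOn_const (by simp)) ?_ ?_ ?_
    · intro x hx
      exact (hc e x hx).aestronglyMeasurable measurableSet_Icc
    · refine (ae_restrict_iff' measurableSet_Icc).2 (Eventually.of_forall fun t ht => ?_)
      refine ((hFe e).differentiableOn).comp (f := fun x => p x + (t : ℂ) • d x) ?_ (fun x hx => hKO (hin x hx t ht))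
      exact hp.add (hd.const_smul _)
    · refine (ae_restrict_iff' measurableSet_Icc).2 (Eventually.of_forall fun t ht x hx => ?_)
      exact hC _ (hin x hx t ht)
  · rw [integral_Icc_eq_integral_Ioc, ← intervalIntegral.integral_of_le zero_le_one]
    have := intervalIntegral.integral_eq_sub_of_hasDerivAt (a := 0) (b := 1)
      (f := fun t : ℝ => F (p x + (t : ℂ) • d x)) (f' := fun t : ℝ => fderiv ℂ F (p x + (t : ℂ) • d x) (d x)) ?_ ?_
    · rw [this]; simp
    · intro t ht
      rw [uIcc_of_le zero_le_one] at ht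
      have h1 : HasFDerivAt F (fderiv ℂ F (p x + (t : ℂ) • d x)) (p x + (t : ℂ) • d x) :=
        (hF _ (hKO (hin x hx t ht))).differentiableAt.hasFDerivAt
      have h2 : HasDerivAt (fun s : ℂ => p x + s • d x) (d x) (t : ℂ) := by
        simpa using ((hasDerivAt_id (t : ℂ)).smul_const (d x)).const_add (p x)
      exact (h1.comp_hasDerivAt_of_eq (t : ℂ) h2 rfl).comp_ofReal
    · refine ContinuousOn.intervalIntegrable ?_
      rw [uIcc_of_le zero_le_one]
      exact hc _ x hx

end JacIdeal

namespace JacIdeal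
open MeasureTheory Metric Set Filter Topology

variable {n ν : ℕ}

/-- Sum of squares. -/
noncomputable def gam (gv : Fin ν → ℂ) : ℝ := ∑ k, ‖gv k‖ ^ 2

/-- Coefficients of the Cauchy-Riemann derivative of the regularized quotient. -/
noncomputable def Cm (gv : Fin ν → ℂ) (δ : ℝ) (k l : Fin ν) : ℂ :=
  (if k = l then 1 else 0) / ((gam gv + δ : ℝ) : ℂ) -
    (starRingEnd ℂ) (gv k) * gv l / ((gam gv + δ : ℝ) : ℂ) ^ 2

/-- The corrected Hefer coefficients. -/
noncomputable def hh (gv y : Fin ν → ℂ) (Hm : Fin ν → Fin n → ℂ) (sv : Fin n → ℂ) (k : Fin ν) (a : Fin n) : ℂ :=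
  Hm k a + (y k - gv k) * sv a

/-- The residual factor. -/
noncomputable def rhat (gv : Fin ν → ℂ) (δ : ℝ) (y : Fin ν → ℂ) : ℂ :=
  1 + ∑ k, (y k - gv k) * ((starRingEnd ℂ) (gv k) / ((gam gv + δ : ℝ) : ℂ))

/-- Coefficients of the antiholomorphic differentials. -/
noncomputable def Ac (gv : Fin ν → ℂ) (δ : ℝ) (y : Fin ν → ℂ) (Hm : Fin ν → Fin n → ℂ) (sv : Fin n → ℂ)
    (a : Fin n) (l : Fin ν) : ℂ := ∑ k, hh gv y Hm sv k a * Cm gv δ k l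

/-- The matrix of the kernel. -/
noncomputable def Em (gv : Fin ν → ℂ) (dg : Fin ν → Fin n → ℂ) (δ : ℝ) (y : Fin ν → ℂ)
    (Hm : Fin ν → Fin n → ℂ) (sv : Fin n → ℂ) (q : Fin n → Fin n → ℂ) (i : Fin n) : Matrix (Fin n) (Fin n) ℂ :=
  Matrix.of fun a j => if a = i then q i j else
    ∑ l, Ac gv δ y Hm sv a l * (starRingEnd ℂ) (dg l j) + rhat gv δ y * q a j

/-- The kernel. -/
noncomputable def EE (gv : Fin ν → ℂ) (dg : Fin ν → Fin n → ℂ) (δ : ℝ) (y : Fin ν → ℂ)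
    (Hm : Fin ν → Fin n → ℂ) (sv : Fin n → ℂ) (q : Fin n → Fin n → ℂ) : ℂ :=
  ∑ i, (Em gv dg δ y Hm sv q i).det

lemma gam_nonneg (gv : Fin ν → ℂ) : 0 ≤ gam gv := Finset.sum_nonneg fun _ _ => by positivity

lemma gam_eq (gv : Fin ν → ℂ) : ((gam gv : ℝ) : ℂ) = ∑ k, gv k * (starRingEnd ℂ) (gv k) := by
  rw [gam]; push_cast
  exact Finset.sum_congr rfl fun i _ => by rw [Complex.mul_conj']

lemma EE_zero (hνn : ν < n) {gv : Fin ν → ℂ} (hg : gam gv ≠ 0) (dg : Fin ν → Fin n → ℂ)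
    (Hm : Fin ν → Fin n → ℂ) (sv : Fin n → ℂ) (q : Fin n → Fin n → ℂ) : EE gv dg 0 0 Hm sv q = 0 := by
  have hgc : ((gam gv : ℝ) : ℂ) ≠ 0 := by exact_mod_cast hg
  refine Finset.sum_eq_zero fun i _ => ?_
  have hr : rhat gv 0 0 = 0 := by
    have : ∑ k, ((0 : Fin ν → ℂ) k - gv k) * ((starRingEnd ℂ) (gv k) / ((gam gv + 0 : ℝ) : ℂ)) =
        - ((∑ k, gv k * (starRingEnd ℂ) (gv k)) / ((gam gv : ℝ) : ℂ)) := by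
      rw [Finset.sum_div, ← Finset.sum_neg_distrib, add_zero]
      exact Finset.sum_congr rfl fun k _ => by simp; ring
    rw [rhat, this, ← gam_eq, div_self hgc]; ring
  have hC : ∀ l, ∑ k, gv k * Cm gv 0 k l = 0 := by
    intro l
    have : ∑ k, gv k * Cm gv 0 k l = gv l / ((gam gv : ℝ) : ℂ) -
        (∑ k, gv k * (starRingEnd ℂ) (gv k)) * gv l / ((gam gv : ℝ) : ℂ) ^ 2 := by
      simp only [Cm, add_zero, mul_sub, Finset.sum_sub_distrib, Finset.sum_mul, Finset.sum_div]
      congr 1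
      · rw [Finset.sum_eq_single l]
        · simp; ring
        · intro b _ hb; simp [hb]
        · simp
      · exact Finset.sum_congr rfl fun k _ => by ring
    rw [this, ← gam_eq]; field_simp; ring
  let L : Matrix (Fin ν) (Fin n) ℂ := Matrix.of fun k a => if a = i then gv k else hh gv 0 Hm sv k a
  have hker : LinearMap.ker L.mulVecLin ≠ ⊥ := by
    refine LinearMap.ker_ne_bot_of_finrank_lt ?_
    simpa using hνn
  obtain ⟨lam, hlam, hlam0⟩ := (Submodule.ne_bot_iff _).1 hker
  have hL : ∀ k, lam i * gv k + ∑ a ∈ Finset.univ.erase i, lam a * hh gv 0 Hm sv k a = 0 := by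
    intro k
    have h1 := congrFun (LinearMap.mem_ker.1 hlam) k
    simp only [Matrix.mulVecLin_apply, Matrix.mulVec, dotProduct, L, Matrix.of_apply, Pi.zero_apply] at h1
    rw [← Finset.add_sum_erase _ _ (Finset.mem_univ i)] at h1
    rw [← h1, if_pos rfl, mul_comm]
    congr 1
    refine Finset.sum_congr rfl fun a ha => ?_
    rw [if_neg (Finset.ne_of_mem_erase ha), mul_comm]
  rw [← Matrix.exists_vecMul_eq_zero_iff]
  refine ⟨Function.update lam i 0, ?_, ?_⟩
  · intro h
    have h1 : ∀ a, a ≠ i → lam a = 0 := fun a ha => by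
      have := congrFun h a
      rwa [Function.update_of_ne ha] at this
    have h2 : lam i ≠ 0 := by
      intro h3
      refine hlam0 (funext fun a => ?_)
      by_cases ha : a = i
      · subst ha; exact h3
      · exact h1 a ha
    refine hg (Finset.sum_eq_zero fun k _ => ?_)
    have h3 := hL k
    rw [Finset.sum_eq_zero (fun a ha => by rw [h1 a (Finset.ne_of_mem_erase ha), zero_mul]), add_zero] at h3
    have := (mul_eq_zero.1 h3).resolve_left h2
    simp [this]
  · ext j
    simp only [Matrix.vecMul, dotProduct, Pi.zero_apply]
    rw [← Finset.add_sum_erase _ _ (Finset.mem_univ i), Function.update_self, zero_mul, zero_add]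
    have h1 : ∀ a ∈ Finset.univ.erase i, Function.update lam i 0 a * Em gv dg 0 0 Hm sv q i a j =
        ∑ l, ∑ k, lam a * hh gv 0 Hm sv k a * (Cm gv 0 k l * (starRingEnd ℂ) (dg l j)) := by
      intro a ha
      have ha' := Finset.ne_of_mem_erase ha
      rw [Function.update_of_ne ha']
      simp only [Em, Matrix.of_apply, if_neg ha', hr, zero_mul, add_zero, Ac, Finset.mul_sum, Finset.sum_mul]
      exact Finset.sum_congr rfl fun l _ => Finset.sum_congr rfl fun k _ => by ring
    rw [Finset.sum_congr rfl h1, Finset.sum_comm]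
    refine Finset.sum_eq_zero fun l _ => ?_
    rw [Finset.sum_comm]
    have h2 : ∀ k, ∑ a ∈ Finset.univ.erase i, lam a * hh gv 0 Hm sv k a * (Cm gv 0 k l * (starRingEnd ℂ) (dg l j)) =
        - (lam i * (starRingEnd ℂ) (dg l j)) * (gv k * Cm gv 0 k l) := by
      intro k
      rw [← Finset.sum_mul, eq_neg_of_add_eq_zero_right (hL k)]; ring
    simp only [h2]
    rw [← Finset.mul_sum, hC, mul_zero]

lemma det_expand {ι : Type*} [Fintype ι] [DecidableEq ι] (P : Fin n → ι → ℂ) (Q : ι → Fin n → ℂ) :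
    (Matrix.of fun a j => ∑ c, P a c * Q c j).det =
      ∑ c : Fin n → ι, (∏ a, P a (c a)) * (Matrix.of fun a j => Q (c a) j).det := by
  have h1 : (Matrix.of fun a j => ∑ c, P a c * Q c j) = fun a => ∑ c, P a c • Q c := by
    ext a j; simp
  rw [h1]
  have h2 := (Matrix.detRowAlternating (R := ℂ) (n := Fin n)).toMultilinearMap.map_sum
    (fun (a : Fin n) (c : ι) => P a c • Q c)
  refine h2.trans (Finset.sum_congr rfl fun c _ => ?_)
  exact (Matrix.detRowAlternating (R := ℂ) (n := Fin n)).toMultilinearMap.map_smul_univ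
    (fun a => P a (c a)) (fun a => Q (c a))

/-- Differentials of the extended system. -/
def dGG (dg : Fin ν → Fin n → ℂ) : Fin ν ⊕ Fin n → Fin n → ℂ :=
  Sum.elim dg (fun l j => if l = j then 1 else 0)

/-- Number of indices of the first kind. -/
def nL (c : Fin n → Fin ν ⊕ Fin n) : ℕ := (Finset.univ.filter fun a => (c a).isLeft = true).card

lemma Em_bound {gv : Fin ν → ℂ} (hg : 0 < gam gv) (hg1 : gam gv ≤ 1) (dg : Fin ν → Fin n → ℂ) {δ : ℝ} (hδ : 0 ≤ δ)
    {y : Fin ν → ℂ} (hy : ∀ k, ‖y k‖ ≤ 2) {Hm : Fin ν → Fin n → ℂ} {sv : Fin n → ℂ} {q : Fin n → Fin n → ℂ}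
    {B : ℝ} (hB : 0 ≤ B) (hH : ∀ k a, ‖Hm k a‖ ≤ B) (hs : ∀ a, ‖sv a‖ ≤ B) (hq : ∀ a j, ‖q a j‖ ≤ B) (i : Fin n) :
    ‖(Em gv dg δ y Hm sv q i).det‖ ≤ ((1 + 8 * ν) * B) ^ n *
      ∑ c : Fin n → Fin ν ⊕ Fin n, ((√(gam gv))⁻¹) ^ (n - 1 + nL c) *
        ‖(Matrix.of fun a j => dGG dg (c a) j).det‖ := by
  set τ := (√(gam gv))⁻¹ with hτ
  have hτ0 : 0 < τ := by positivity
  have hτ1 : 1 ≤ τ := by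
    rw [hτ]; exact (one_le_inv₀ (by positivity)).2 (Real.sqrt_le_one.2 hg1)
  have hτ2 : τ ^ 2 = (gam gv)⁻¹ := by
    rw [hτ, inv_pow, Real.sq_sqrt hg.le]
  have hN : gam gv ≤ gam gv + δ := by linarith
  have hN0 : 0 < gam gv + δ := by linarith
  have hNn : ‖((gam gv + δ : ℝ) : ℂ)‖ = gam gv + δ := by
    rw [Complex.norm_real, Real.norm_of_nonneg hN0.le]
  have hNi : (gam gv + δ)⁻¹ ≤ τ ^ 2 := by rw [hτ2]; gcongr
  have hgk : ∀ k, ‖gv k‖ ≤ τ⁻¹ := by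
    intro k
    rw [hτ, inv_inv]
    refine Real.le_sqrt_of_sq_le ?_
    exact Finset.single_le_sum (f := fun i => ‖gv i‖ ^ 2) (fun i _ => by positivity) (Finset.mem_univ k)
  have hgk1 : ∀ k, ‖gv k‖ ≤ 1 := fun k => (hgk k).trans (inv_le_one_of_one_le₀ hτ1)
  have hCm : ∀ k l, ‖Cm gv δ k l‖ ≤ 2 * τ ^ 2 := by
    intro k l
    rw [Cm]
    refine (norm_sub_le _ _).trans ?_
    have e1 : ‖(if k = l then (1 : ℂ) else 0) / ((gam gv + δ : ℝ) : ℂ)‖ ≤ τ ^ 2 := by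
      rw [norm_div, hNn, div_eq_mul_inv]
      have : ‖(if k = l then (1 : ℂ) else 0)‖ ≤ 1 := by split_ifs <;> simp
      calc _ ≤ 1 * τ ^ 2 := by gcongr
        _ = _ := one_mul _
    have e2 : ‖(starRingEnd ℂ) (gv k) * gv l / ((gam gv + δ : ℝ) : ℂ) ^ 2‖ ≤ τ ^ 2 := by
      rw [norm_div, norm_pow, hNn, norm_mul, RCLike.norm_conj, div_eq_mul_inv, ← inv_pow]
      calc _ ≤ τ⁻¹ * τ⁻¹ * (τ ^ 2) ^ 2 := by gcongr <;> apply hgk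
        _ = _ := by field_simp
    linarith
  have hhh : ∀ k a, ‖hh gv y Hm sv k a‖ ≤ 4 * B := by
    intro k a
    rw [hh]
    have e1 : ‖y k - gv k‖ ≤ 3 := (norm_sub_le _ _).trans (by linarith [hy k, hgk1 k])
    calc _ ≤ ‖Hm k a‖ + ‖(y k - gv k) * sv a‖ := norm_add_le _ _
      _ ≤ B + 3 * B := by
          rw [norm_mul]
          gcongr
          · exact hH k a
          · exact hs a
      _ = _ := by ring
  have hAc : ∀ a l, ‖Ac gv δ y Hm sv a l‖ ≤ 8 * ν * B * τ ^ 2 := by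
    intro a l
    calc _ ≤ ∑ k : Fin ν, 4 * B * (2 * τ ^ 2) := by
            refine norm_sum_le_of_le _ fun k _ => ?_
            rw [norm_mul]
            gcongr
            · exact hhh k a
            · exact hCm k l
      _ = _ := by simp; ring
  have hrh : ‖rhat gv δ y‖ ≤ (1 + 3 * ν) * τ := by
    rw [rhat]
    refine (norm_add_le _ _).trans ?_
    have e1 : ‖∑ k, (y k - gv k) * ((starRingEnd ℂ) (gv k) / ((gam gv + δ : ℝ) : ℂ))‖ ≤ ∑ k : Fin ν, 3 * τ := by
      refine norm_sum_le_of_le _ fun k _ => ?_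
      have e1 : ‖y k - gv k‖ ≤ 3 := (norm_sub_le _ _).trans (by linarith [hy k, hgk1 k])
      rw [norm_mul, norm_div, hNn, RCLike.norm_conj, div_eq_mul_inv]
      have : ‖gv k‖ * (gam gv + δ)⁻¹ ≤ τ := by
        calc _ ≤ τ⁻¹ * τ ^ 2 := by gcongr; exact hgk k
          _ = τ := by field_simp
      gcongr
    simp at e1 ⊢
    linarith
  let e : Fin n → ℕ := fun a => if a = i then 0 else 1
  let w : Fin ν ⊕ Fin n → ℕ := fun c => if c.isLeft = true then 1 else 0
  let P : Fin n → Fin ν ⊕ Fin n → ℂ := fun a => if a = i then Sum.elim (fun _ => 0) (fun l => q i l) else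
    Sum.elim (fun l => Ac gv δ y Hm sv a l) (fun l => rhat gv δ y * q a l)
  have hE : Em gv dg δ y Hm sv q i = Matrix.of fun a j => ∑ c, P a c * (starRingEnd ℂ) (dGG dg c j) := by
    ext a j
    simp only [Em, Matrix.of_apply, P, Fintype.sum_sum_type, dGG, Sum.elim_inl, Sum.elim_inr]
    by_cases ha : a = i
    · simp [ha]
    · simp [ha]
  have hP : ∀ a c, ‖P a c‖ ≤ ((1 + 8 * ν) * B) * τ ^ (e a + w c) := by
    intro a c
    have hνB : 0 ≤ (ν : ℝ) * B := by positivity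
    by_cases ha : a = i
    · rcases c with l | l
      · simp only [P, if_pos ha, Sum.elim_inl, norm_zero]; positivity
      · simp only [P, if_pos ha, Sum.elim_inr, e, w, Sum.isLeft_inr]
        simp
        refine (hq i l).trans ?_
        nlinarith
    · rcases c with l | l
      · simp only [P, if_neg ha, Sum.elim_inl, e, w, Sum.isLeft_inl, if_true]
        refine (hAc a l).trans ?_
        have h2 : (0:ℝ) ≤ B * τ ^ 2 := by positivity
        have h3 : τ ^ (1 + 1) = τ ^ 2 := rfl
        simp only [h3]
        nlinarith
      · simp only [P, if_neg ha, Sum.elim_inr, e, w, Sum.isLeft_inr]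
        simp
        calc _ ≤ ((1 + 3 * ν) * τ) * B := by gcongr; exact hq a l
          _ = ((1 + 3 * ν) * B) * τ := by ring
          _ ≤ _ := by gcongr; norm_num
  rw [hE, det_expand]
  refine (norm_sum_le _ _).trans ?_
  rw [Finset.mul_sum]
  refine Finset.sum_le_sum fun c _ => ?_
  rw [norm_mul, ← mul_assoc]
  have hdet : (Matrix.of fun a j => (starRingEnd ℂ) (dGG dg (c a) j)).det =
      (starRingEnd ℂ) (Matrix.of fun a j => dGG dg (c a) j).det := by
    rw [RingHom.map_det]; rfl
  rw [hdet, RCLike.norm_conj]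
  gcongr
  rw [norm_prod]
  calc ∏ a, ‖P a (c a)‖ ≤ ∏ a, ((1 + 8 * ν) * B) * τ ^ (e a + w (c a)) :=
        Finset.prod_le_prod (fun _ _ => norm_nonneg _) fun a _ => hP a (c a)
    _ = ((1 + 8 * ν) * B) ^ n * τ ^ (∑ a, (e a + w (c a))) := by
        rw [Finset.prod_mul_distrib, Finset.prod_const, Finset.prod_pow_eq_pow_sum]; simp
    _ = _ := by
        congr 2
        rw [Finset.sum_add_distrib]
        congr 1
        · have : ∑ a, e a = (Finset.univ.filter fun a => ¬ a = i).card := by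
            rw [Finset.card_filter]
            exact Finset.sum_congr rfl fun a _ => by simp only [e]; split_ifs <;> simp_all
          rw [this, Finset.filter_not, Finset.filter_eq' Finset.univ i, if_pos (Finset.mem_univ i), Finset.card_sdiff]
          simp
        · rw [nL, Finset.card_filter]

end JacIdeal

namespace JacIdeal
open MeasureTheory Metric Set Filter Topology

variable {n ν : ℕ}

lemma EE_measurable {T : Type*} [MeasurableSpace T] {μ : Measure T}
    {gv : T → Fin ν → ℂ} {dg : T → Fin ν → Fin n → ℂ} (δ : ℝ) (y : Fin ν → ℂ)
    {Hm : T → Fin ν → Fin n → ℂ} {sv : T → Fin n → ℂ} {q : T → Fin n → Fin n → ℂ}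
    (h1 : ∀ k, AEMeasurable (fun t => gv t k) μ) (h2 : ∀ k j, AEMeasurable (fun t => dg t k j) μ)
    (h3 : ∀ k j, AEMeasurable (fun t => Hm t k j) μ) (h4 : ∀ k, AEMeasurable (fun t => sv t k) μ)
    (h5 : ∀ i j, AEMeasurable (fun t => q t i j) μ) :
    AEMeasurable (fun t => EE (gv t) (dg t) δ y (Hm t) (sv t) (q t)) μ := by
  have hgam : AEMeasurable (fun t => gam (gv t)) μ := by
    unfold gam
    exact Finset.aemeasurable_fun_sum _ fun k _ => ((h1 k).norm.pow_const 2)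
  have hN : AEMeasurable (fun t => ((gam (gv t) + δ : ℝ) : ℂ)) μ :=
    Complex.measurable_ofReal.comp_aemeasurable (hgam.add_const δ)
  have hcj : ∀ {u : T → ℂ}, AEMeasurable u μ → AEMeasurable (fun t => (starRingEnd ℂ) (u t)) μ := fun hu =>
    (Complex.continuous_conj.measurable).comp_aemeasurable hu
  have hCm : ∀ k l, AEMeasurable (fun t => Cm (gv t) δ k l) μ := fun k l => by
    unfold Cm
    exact (aemeasurable_const.div hN).sub (((hcj (h1 k)).mul (h1 l)).div (hN.pow_const 2))
  have hhh : ∀ k a, AEMeasurable (fun t => hh (gv t) y (Hm t) (sv t) k a) μ := fun k a => by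
    unfold hh
    exact (h3 k a).add ((aemeasurable_const.sub (h1 k)).mul (h4 a))
  have hr : AEMeasurable (fun t => rhat (gv t) δ y) μ := by
    unfold rhat
    exact aemeasurable_const.add (Finset.aemeasurable_fun_sum _ fun k _ =>
      (aemeasurable_const.sub (h1 k)).mul ((hcj (h1 k)).div hN))
  have hA : ∀ a l, AEMeasurable (fun t => Ac (gv t) δ y (Hm t) (sv t) a l) μ := fun a l => by
    unfold Ac
    exact Finset.aemeasurable_fun_sum _ fun k _ => (hhh k a).mul (hCm k l)
  have hE : ∀ i a j, AEMeasurable (fun t => Em (gv t) (dg t) δ y (Hm t) (sv t) (q t) i a j) μ := fun i a j => by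
    simp only [Em, Matrix.of_apply]
    by_cases ha : a = i
    · simp only [ha, if_true]; exact h5 i j
    · simp only [ha, if_false]
      exact (Finset.aemeasurable_fun_sum _ fun l _ => (hA a l).mul (hcj (h2 l j))).add (hr.mul (h5 a j))
  unfold EE
  refine Finset.aemeasurable_fun_sum _ fun i _ => ?_
  simp only [Matrix.det_apply]
  exact Finset.aemeasurable_fun_sum _ fun σ _ =>
    (Finset.aemeasurable_fun_prod _ fun a _ => hE i _ _).const_smul _

lemma EE_differentiableOn {P : Type*} [NormedAddCommGroup P] [NormedSpace ℂ P] {V : Set P}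
    (gv : Fin ν → ℂ) (dg : Fin ν → Fin n → ℂ) (δ : ℝ) {y : P → Fin ν → ℂ}
    {Hm : P → Fin ν → Fin n → ℂ} {sv : P → Fin n → ℂ} {q : P → Fin n → Fin n → ℂ}
    (h1 : ∀ k, DifferentiableOn ℂ (fun t => y t k) V)
    (h3 : ∀ k j, DifferentiableOn ℂ (fun t => Hm t k j) V) (h4 : ∀ k, DifferentiableOn ℂ (fun t => sv t k) V)
    (h5 : ∀ i j, DifferentiableOn ℂ (fun t => q t i j) V) :
    DifferentiableOn ℂ (fun t => EE gv dg δ (y t) (Hm t) (sv t) (q t)) V := by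
  have hprod : ∀ {u : Fin n → P → ℂ}, (∀ a, DifferentiableOn ℂ (u a) V) →
      DifferentiableOn ℂ (fun x => ∏ a, u a x) V := by
    intro u hu x hx
    have := HasFDerivWithinAt.finsetProd (u := Finset.univ) (g := u) (s := V) (x := x)
      fun a _ => (hu a x hx).hasFDerivWithinAt
    exact (by simpa [Finset.prod_fn] using this.differentiableWithinAt)
  have hhh : ∀ k a, DifferentiableOn ℂ (fun t => hh gv (y t) (Hm t) (sv t) k a) V := fun k a => by
    unfold hh
    exact (h3 k a).add (((h1 k).sub_const _).mul (h4 a))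
  have hr : DifferentiableOn ℂ (fun t => rhat gv δ (y t)) V := by
    unfold rhat
    exact (DifferentiableOn.fun_sum fun k _ => ((h1 k).sub_const _).mul_const _).const_add _
  have hA : ∀ a l, DifferentiableOn ℂ (fun t => Ac gv δ (y t) (Hm t) (sv t) a l) V := fun a l => by
    unfold Ac
    exact DifferentiableOn.fun_sum fun k _ => (hhh k a).mul_const _
  have hE : ∀ i a j, DifferentiableOn ℂ (fun t => Em gv dg δ (y t) (Hm t) (sv t) (q t) i a j) V := fun i a j => by
    simp only [Em, Matrix.of_apply]
    by_cases ha : a = i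
    · simp only [ha, if_true]; exact h5 i j
    · simp only [ha, if_false]
      exact (DifferentiableOn.fun_sum fun l _ => (hA a l).mul_const _).add (hr.mul (h5 a j))
  unfold EE
  refine DifferentiableOn.fun_sum fun i _ => ?_
  simp only [Matrix.det_apply]
  exact DifferentiableOn.fun_sum fun σ _ =>
    (hprod fun a => hE i (σ a) a).const_smul (Equiv.Perm.sign σ : ℤ)

lemma EE_tendsto {gv : Fin ν → ℂ} (hg : 0 < gam gv) (dg : Fin ν → Fin n → ℂ) (y : Fin ν → ℂ)
    (Hm : Fin ν → Fin n → ℂ) (sv : Fin n → ℂ) (q : Fin n → Fin n → ℂ) :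
    ContinuousAt (fun δ => EE gv dg δ y Hm sv q) 0 := by
  have hN : ContinuousAt (fun δ : ℝ => ((gam gv + δ : ℝ) : ℂ)) 0 := by fun_prop
  have hN0 : ((gam gv + 0 : ℝ) : ℂ) ≠ 0 := by
    rw [add_zero]; exact_mod_cast hg.ne'
  have hCm : ∀ k l, ContinuousAt (fun δ => Cm gv δ k l) 0 := fun k l => by
    unfold Cm
    exact (continuousAt_const.div hN hN0).sub (continuousAt_const.div (hN.pow 2) (pow_ne_zero 2 hN0))
  have hr : ContinuousAt (fun δ => rhat gv δ y) 0 := by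
    unfold rhat
    exact continuousAt_const.add (tendsto_finsetSum _ fun k _ =>
      continuousAt_const.mul (continuousAt_const.div hN hN0))
  have hA : ∀ a l, ContinuousAt (fun δ => Ac gv δ y Hm sv a l) 0 := fun a l => by
    unfold Ac
    exact tendsto_finsetSum _ fun k _ => continuousAt_const.mul (hCm k l)
  have hE : ∀ i a j, ContinuousAt (fun δ => Em gv dg δ y Hm sv q i a j) 0 := fun i a j => by
    simp only [Em, Matrix.of_apply]
    by_cases ha : a = i
    · simp only [ha, if_true]; exact continuousAt_const
    · simp only [ha, if_false]
      exact ContinuousAt.add (tendsto_finsetSum _ fun l _ => ContinuousAt.mul (hA a l) continuousAt_const)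
        (hr.mul continuousAt_const)
  unfold EE
  refine tendsto_finsetSum _ fun i _ => ?_
  simp only [Matrix.det_apply]
  exact tendsto_finsetSum _ fun σ _ =>
    (tendsto_finsetProd _ fun a _ => hE i _ _).const_smul _

lemma EE_bound {gv : Fin ν → ℂ} (hg : 0 < gam gv) (hg1 : gam gv ≤ 1) (dg : Fin ν → Fin n → ℂ) {δ : ℝ} (hδ : 0 ≤ δ)
    {y : Fin ν → ℂ} (hy : ∀ k, ‖y k‖ ≤ 2) {Hm : Fin ν → Fin n → ℂ} {sv : Fin n → ℂ} {q : Fin n → Fin n → ℂ}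
    {B : ℝ} (hB : 0 ≤ B) (hH : ∀ k a, ‖Hm k a‖ ≤ B) (hs : ∀ a, ‖sv a‖ ≤ B) (hq : ∀ a j, ‖q a j‖ ≤ B) :
    ‖EE gv dg δ y Hm sv q‖ ≤ n * ((1 + 8 * ν) * B) ^ n *
      ∑ c : Fin n → Fin ν ⊕ Fin n, ((√(gam gv))⁻¹) ^ (n - 1 + nL c) *
        ‖(Matrix.of fun a j => dGG dg (c a) j).det‖ := by
  rw [EE]
  refine (norm_sum_le_of_le _ fun i _ => Em_bound hg hg1 dg hδ hy hB hH hs hq i).trans ?_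
  simp [mul_assoc]

/-- The extended system. -/
def GG (g : Fin ν → (Fin n → ℂ) → ℂ) : Fin ν ⊕ Fin n → (Fin n → ℂ) → ℂ :=
  Sum.elim g (fun l ζ => ζ l)

lemma hJ_GG (g : Fin ν → (Fin n → ℂ) → ℂ) (c : Fin n → Fin ν ⊕ Fin n) (ζ : Fin n → ℂ) :
    hJ (fun a => GG g (c a)) ζ =
      (Matrix.of fun a j => dGG (fun k j => fderiv ℂ (g k) ζ (Pi.single j 1)) (c a) j).det := by
  rw [hJ]
  congr 1
  ext a j
  simp only [Matrix.of_apply, dGG, GG]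
  rcases c a with l | l
  · rfl
  · simp only [Sum.elim_inr]
    have := fderiv_coord_sub (0 : Fin n → ℂ) l j ζ
    simpa using this

/-- The integrable majorant. -/
lemma majorant (hn : 0 < n) {R r B : ℝ} (f : Fin n → (Fin n → ℂ) → ℂ) (g : Fin ν → (Fin n → ℂ) → ℂ)
    (hf : ∀ i, AnalyticOnNhd ℂ (f i) (ball 0 R)) (hg : ∀ i, AnalyticOnNhd ℂ (g i) (ball 0 R))
    (hr : 0 < r) (hrR : r < R) (hB : 1 ≤ B)
    (hg1 : ∀ ζ ∈ closedBall 0 r, gam (fun k => g k ζ) ≤ 1)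
    (hfg : ∀ ζ ∈ closedBall 0 r, ∀ i, ‖f i ζ‖ ^ 2 ≤ B * gam (fun k => g k ζ)) :
    (∀ᵐ ζ ∂(volume.restrict (closedBall 0 r)), gam (fun k => g k ζ) = 0 → hJ f ζ = 0) ∧
    IntegrableOn (fun ζ => ‖hJ f ζ‖ * ∑ c : Fin n → Fin ν ⊕ Fin n, ((√(gam (fun k => g k ζ)))⁻¹) ^ (n - 1 + nL c) *
        ‖(Matrix.of fun a j => dGG (fun k j => fderiv ℂ (g k) ζ (Pi.single j 1)) (c a) j).det‖)
      (closedBall 0 r) := by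
  have hsub : closedBall (0 : Fin n → ℂ) r ⊆ ball 0 R := closedBall_subset_ball hrR
  have hgc : ∀ k, ContinuousOn (g k) (closedBall 0 r) := fun k => (hg k).continuousOn.mono hsub
  have hqc : ContinuousOn (fun ζ => gam (fun k => g k ζ)) (closedBall 0 r) := by
    unfold gam
    exact continuousOn_finsetSum _ fun k _ => ((hgc k).norm.pow 2)
  have hq0 : ∀ ζ, 0 ≤ gam (fun k => g k ζ) := fun ζ => gam_nonneg _
  set a : ℝ := 1 / (2 * n) with ha_def
  have hn' : (1:ℝ) ≤ n := by exact_mod_cast hn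
  have ha : 0 < a := by positivity
  have ha1 : a < 1 := by rw [ha_def, div_lt_one (by positivity)]; linarith
  have hna : n * a = 1 / 2 := by rw [ha_def]; field_simp
  obtain ⟨h1, h2⟩ := weight_integrable ha ha1 Finset.univ f hf hr hrR _ hqc hq0 hB
    (fun ζ hζ i _ => hfg ζ hζ i)
  have h2' := h2 ⟨⟨0, hn⟩, Finset.mem_univ _⟩
  refine ⟨h2', ?_⟩
  have hGG : ∀ c, AnalyticOnNhd ℂ (GG g c) (ball 0 R) := by
    rintro (k | l)
    · exact hg k
    · intro ζ _
      have := analyticAt_coord_sub (0 : Fin n → ℂ) l ζ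
      simpa [GG] using this
  have h3 : ∀ c : Fin n → Fin ν ⊕ Fin n, IntegrableOn (fun ζ => ‖hJ (fun a => GG g (c a)) ζ‖ ^ 2 *
      gam (fun k => g k ζ) ^ (-((nL c : ℝ) * (1 - a)))) (closedBall 0 r) := by
    intro c
    refine (weight_integrable ha ha1 (Finset.univ.filter fun a => (c a).isLeft = true) (fun a => GG g (c a))
      (fun i => hGG (c i)) hr hrR _ hqc hq0 hB ?_).1
    intro ζ hζ i hi
    rw [Finset.mem_filter] at hi
    obtain ⟨k, hk⟩ := Sum.isLeft_iff.1 hi.2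
    simp only [hk, GG, Sum.elim_inl]
    have : ‖g k ζ‖ ^ 2 ≤ gam (fun k => g k ζ) :=
      Finset.single_le_sum (f := fun i => ‖g i ζ‖ ^ 2) (fun i _ => by positivity) (Finset.mem_univ k)
    nlinarith [hq0 ζ]
  simp only [Finset.mul_sum]
  refine integrable_finsetSum _ fun c _ => ?_
  have hms : MeasurableSet (closedBall (0 : Fin n → ℂ) r) := isClosed_closedBall.measurableSet
  refine Integrable.mono' (h1.add (h3 c)) ?_ ?_
  · have m1 : ContinuousOn (fun ζ => hJ f ζ) (closedBall 0 r) := fun ζ hζ =>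
      (analyticAt_hJ fun i => hf i ζ (hsub hζ)).continuousAt.continuousWithinAt
    have m2 : ContinuousOn (fun ζ => hJ (fun a => GG g (c a)) ζ) (closedBall 0 r) := fun ζ hζ =>
      (analyticAt_hJ fun i => hGG (c i) ζ (hsub hζ)).continuousAt.continuousWithinAt
    have m3 : AEMeasurable (fun ζ => gam (fun k => g k ζ)) (volume.restrict (closedBall 0 r)) :=
      hqc.aemeasurable hms
    simp only [← hJ_GG]
    exact (((m1.aemeasurable hms).norm).mul ((((Real.continuous_sqrt.measurable).comp_aemeasurable m3).inv.pow_const _).mul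
      (m2.aemeasurable hms).norm)).aestronglyMeasurable
  · filter_upwards [h2', ae_restrict_mem hms] with ζ hζ hζm
    rw [← hJ_GG, Real.norm_of_nonneg (by positivity)]
    simp only [Pi.add_apply, Finset.card_univ, Fintype.card_fin]
    set q := gam (fun k => g k ζ) with hq
    set x := ‖hJ f ζ‖
    set y := ‖hJ (fun a => GG g (c a)) ζ‖
    have hq1 : q ≤ 1 := hg1 ζ hζm
    rcases (hq0 ζ).eq_or_lt with hz | hp
    · have : x = 0 := by simp only [x]; rw [hζ hz.symm, norm_zero]
      rw [this]
      have := Real.rpow_nonneg (hq0 ζ) (-((nL c : ℝ) * (1 - a)))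
      simp only [zero_mul]; positivity
    · have hp' : 0 < q := hp
      have e1 : ((√q)⁻¹) ^ (n - 1 + nL c) = q ^ (-(((n:ℝ) - 1 + nL c) / 2)) := by
        rw [Real.sqrt_eq_rpow, ← Real.rpow_neg hp'.le, ← Real.rpow_natCast, ← Real.rpow_mul hp'.le]
        congr 1
        rw [Nat.cast_add, Nat.cast_sub hn]; push_cast; ring
      set p1 := q ^ (-((n:ℝ) * (1 - a)) / 2) with hp1
      set p2 := q ^ (-((nL c:ℝ) * (1 - a)) / 2) with hp2
      have e2 : q ^ (-((n:ℝ) * (1 - a))) = p1 ^ 2 := by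
        rw [hp1, ← Real.rpow_natCast, ← Real.rpow_mul hp'.le]; congr 1; push_cast; ring
      have e3 : q ^ (-((nL c:ℝ) * (1 - a))) = p2 ^ 2 := by
        rw [hp2, ← Real.rpow_natCast, ← Real.rpow_mul hp'.le]; congr 1; push_cast; ring
      have hnL : (nL c : ℝ) ≤ n := by
        have : nL c ≤ n := by
          rw [nL]; exact (Finset.card_filter_le _ _).trans (by simp)
        exact_mod_cast this
      have e4 : q ^ (-(((n:ℝ) - 1 + nL c) / 2)) ≤ p1 * p2 := by
        rw [hp1, hp2, ← Real.rpow_add hp']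
        refine Real.rpow_le_rpow_of_exponent_ge hp' hq1 ?_
        have : (nL c : ℝ) * a ≤ 1 / 2 := by rw [← hna]; gcongr
        nlinarith
      rw [e1, e2, e3]
      have hp10 : 0 < p1 := by positivity
      have hp20 : 0 < p2 := by positivity
      calc x * (q ^ (-(((n:ℝ) - 1 + nL c) / 2)) * y) ≤ x * (p1 * p2 * y) := by gcongr
        _ ≤ x ^ 2 * p1 ^ 2 + y ^ 2 * p2 ^ 2 := by nlinarith [sq_nonneg (x * p1 - y * p2), sq_nonneg (x*p1), sq_nonneg (y*p2)]

end JacIdeal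

namespace JacIdeal
open MeasureTheory Metric Set Filter Topology

variable {n ν : ℕ}

/-- The denominator of the boundary kernel. -/
noncomputable def Dk (z ζ : Fin n → ℂ) : ℂ := ∑ l, (ζ l - z l) * (starRingEnd ℂ) (ζ l)

lemma Dk_lower (hn : 0 < n) {r : ℝ} (hr : 0 < r) {z ζ : Fin n → ℂ} (hz : ‖z‖ < r / (2 * n)) (hζ : r ≤ ‖ζ‖) :
    r ^ 2 / 2 ≤ ‖Dk z ζ‖ := by
  have hn' : (0:ℝ) < n := by exact_mod_cast hn
  have h1 : Dk z ζ = ((rho ζ : ℝ) : ℂ) - ∑ l, z l * (starRingEnd ℂ) (ζ l) := by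
    rw [rho_eq, Dk, ← Finset.sum_sub_distrib]
    exact Finset.sum_congr rfl fun l _ => by ring
  have h2 : ‖ζ‖ ^ 2 ≤ rho ζ := by
    have hne : Nonempty (Fin n) := ⟨⟨0, hn⟩⟩
    obtain ⟨i, hi⟩ : ∃ i, ‖ζ i‖ = ‖ζ‖ := by
      obtain ⟨i, -, hi⟩ := Finset.exists_mem_eq_sup' Finset.univ_nonempty (fun i => ‖ζ i‖)
      refine ⟨i, ?_⟩
      refine le_antisymm (norm_le_pi_norm ζ i) ?_
      rw [pi_norm_le_iff_of_nonneg (norm_nonneg _)]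
      intro b
      rw [← hi]; exact Finset.le_sup' (fun i => ‖ζ i‖) (Finset.mem_univ b)
    rw [← hi]
    exact Finset.single_le_sum (f := fun i => ‖ζ i‖ ^ 2) (fun i _ => by positivity) (Finset.mem_univ i)
  have h3 : ‖∑ l, z l * (starRingEnd ℂ) (ζ l)‖ ≤ r / 2 * ‖ζ‖ := by
    calc _ ≤ ∑ l : Fin n, r / (2 * n) * ‖ζ‖ := by
          refine norm_sum_le_of_le _ fun l _ => ?_
          rw [norm_mul, RCLike.norm_conj]
          gcongr
          · exact (norm_le_pi_norm z l).trans hz.le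
          · exact norm_le_pi_norm ζ l
      _ = _ := by simp; field_simp
  have h4 : rho ζ = ‖((rho ζ : ℝ) : ℂ)‖ := by
    rw [Complex.norm_real, Real.norm_of_nonneg]; exact (sq_nonneg _).trans h2
  have h5 := norm_sub_norm_le ((rho ζ : ℝ) : ℂ) (∑ l, z l * (starRingEnd ℂ) (ζ l))
  rw [← h1, ← h4] at h5
  nlinarith

lemma exists_skernel (hn : 0 < n) {r R : ℝ} (hr : 0 < r) (hrR : 2 * r < R) :
    ∃ (sk : (Fin n → ℂ) → (Fin n → ℂ) → Fin n → ℂ) (q : (Fin n → ℂ) → (Fin n → ℂ) → Fin n → Fin n → ℂ) (B : ℝ),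
      0 ≤ B ∧
      (∀ z ∈ ball (0 : Fin n → ℂ) (r / (2 * n)), ∀ ζ i, ContDiffAt ℝ 2 (fun ζ => sk z ζ i) ζ) ∧
      (∀ z ∈ ball (0 : Fin n → ℂ) (r / (2 * n)), ∀ ζ, ζ ∉ closedBall (0 : Fin n → ℂ) (2 * r) →
        ∑ i, sk z ζ i * (ζ i - z i) = 1) ∧
      (∀ z ∈ ball (0 : Fin n → ℂ) (r / (2 * n)), ∀ ζ i j, dbar j (fun ζ => sk z ζ i) ζ = q z ζ i j) ∧
      (∀ ζ i, DifferentiableOn ℂ (fun z => sk z ζ i) (ball (0 : Fin n → ℂ) (r / (2 * n)))) ∧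
      (∀ ζ i j, DifferentiableOn ℂ (fun z => q z ζ i j) (ball (0 : Fin n → ℂ) (r / (2 * n)))) ∧
      (∀ z ∈ ball (0 : Fin n → ℂ) (r / (2 * n)), ∀ ζ ∈ closedBall (0 : Fin n → ℂ) R, ∀ i, ‖sk z ζ i‖ ≤ B) ∧
      (∀ z ∈ ball (0 : Fin n → ℂ) (r / (2 * n)), ∀ ζ ∈ closedBall (0 : Fin n → ℂ) R, ∀ i j, ‖q z ζ i j‖ ≤ B) := by
  have hn1 : (1:ℝ) ≤ n := by exact_mod_cast hn
  have hRpos : 0 < R := by linarith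
  let b : ContDiffBump (0 : Fin n → ℂ) := ⟨r, 2 * r, hr, by linarith⟩
  let χ : (Fin n → ℂ) → ℂ := fun ζ => ((1 - b ζ : ℝ) : ℂ)
  have hχ : ContDiff ℝ 3 χ := contDiff_iff_contDiffAt.2 fun ζ =>
    ofReal_contDiffAt (contDiffAt_const.sub b.contDiff.contDiffAt)
  have hχ0 : ∀ ζ, ‖ζ‖ ≤ r → χ ζ = 0 := fun ζ hζ => by
    have : b ζ = 1 := b.one_of_mem_closedBall (by simpa [b] using hζ)
    simp [χ, this]
  have hχ1 : ∀ ζ, ζ ∉ closedBall (0 : Fin n → ℂ) (2 * r) → χ ζ = 1 := fun ζ hζ => by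
    have : b ζ = 0 := b.zero_of_le_dist (by
      simp only [mem_closedBall, not_le] at hζ
      exact hζ.le)
    simp [χ, this]
  have hχn : ∀ ζ, ‖χ ζ‖ ≤ 1 := fun ζ => by
    have h1 := b.nonneg (x := ζ)
    have h2 := b.le_one (x := ζ)
    simp only [χ, Complex.norm_real]
    rw [Real.norm_of_nonneg (by linarith)]; linarith
  have hχev : ∀ ζ, ‖ζ‖ < r → χ =ᶠ[𝓝 ζ] fun _ => 0 := fun ζ hζ => by
    filter_upwards [(isOpen_lt continuous_norm continuous_const).mem_nhds hζ] with w hw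
    exact hχ0 w (le_of_lt hw)
  have hdχc : ∀ j, Continuous (dbar j χ) := fun j => by
    refine (contDiff_iff_contDiffAt.2 fun ζ => dbar_contDiffAt (k := j) (m := 0) ?_).continuous
    exact hχ.contDiffAt.of_le (by norm_num)
  have hM : ∃ M : ℝ, 0 ≤ M ∧ ∀ j, ∀ ζ ∈ closedBall (0 : Fin n → ℂ) R, ‖dbar j χ ζ‖ ≤ M := by
    have h := fun j => (isCompact_closedBall (0 : Fin n → ℂ) R).exists_bound_of_continuousOn (hdχc j).continuousOn
    choose M hM using h
    refine ⟨∑ j, |M j|, Finset.sum_nonneg fun _ _ => abs_nonneg _, fun j ζ hζ => ?_⟩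
    exact ((hM j ζ hζ).trans (le_abs_self _)).trans
      (Finset.single_le_sum (f := fun j => |M j|) (fun _ _ => abs_nonneg _) (Finset.mem_univ j))
  obtain ⟨M, hM0, hM⟩ := hM
  have hD0 : ∀ z ∈ ball (0 : Fin n → ℂ) (r / (2 * n)), ∀ ζ, r ≤ ‖ζ‖ → Dk z ζ ≠ 0 := fun z hz ζ hζ h => by
    have := Dk_lower hn hr (mem_ball_zero_iff.1 hz) hζ
    rw [h, norm_zero] at this
    have : 0 < r ^ 2 := by positivity
    linarith
  have hDi : ∀ z ∈ ball (0 : Fin n → ℂ) (r / (2 * n)), ∀ ζ, r ≤ ‖ζ‖ → ‖(Dk z ζ)⁻¹‖ ≤ 2 / r ^ 2 := fun z hz ζ hζ => by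
    have h1 := Dk_lower hn hr (mem_ball_zero_iff.1 hz) hζ
    rw [norm_inv]
    calc _ ≤ (r ^ 2 / 2)⁻¹ := by gcongr
      _ = _ := by rw [inv_div]
  have hca : ∀ (i : Fin n) (ζ : Fin n → ℂ), AnalyticAt ℂ (fun ζ : Fin n → ℂ => ζ i) ζ := fun i ζ => by
    simpa using analyticAt_coord_sub (0 : Fin n → ℂ) i ζ
  have hcd : ∀ (i j : Fin n) (ζ : Fin n → ℂ), fderiv ℂ (fun ζ : Fin n → ℂ => ζ i) ζ (Pi.single j 1) = if i = j then 1 else 0 :=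
    fun i j ζ => by simpa using fderiv_coord_sub (0 : Fin n → ℂ) i j ζ
  have hDc : ∀ z ζ : Fin n → ℂ, ContDiffAt ℝ 2 (fun ζ => Dk z ζ) ζ := fun z ζ => by
    unfold Dk
    exact ContDiffAt.sum fun l _ => (AnalyticAt.contDiffAtR (analyticAt_coord_sub z l ζ)).mul
      (AnalyticAt.contDiffAt_conj (hca l ζ))
  have hDdb : ∀ z ζ : Fin n → ℂ, HasDbar (fun ζ => Dk z ζ) (fun j => ζ j - z j) ζ := fun z ζ => by
    unfold Dk
    refine (HasDbar.sum fun l _ => (HasDbar.holo (analyticAt_coord_sub z l ζ).differentiableAt).mul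
      (HasDbar.conj_holo (hca l ζ).differentiableAt)).congr_D fun j => ?_
    simp [hcd]
  let sk : (Fin n → ℂ) → (Fin n → ℂ) → Fin n → ℂ := fun z ζ i => χ ζ * ((starRingEnd ℂ) (ζ i) * (Dk z ζ)⁻¹)
  let q : (Fin n → ℂ) → (Fin n → ℂ) → Fin n → Fin n → ℂ := fun z ζ i j =>
    χ ζ * ((starRingEnd ℂ) (ζ i) * (-(ζ j - z j) / (Dk z ζ) ^ 2) + (Dk z ζ)⁻¹ * (if i = j then 1 else 0)) +
      ((starRingEnd ℂ) (ζ i) * (Dk z ζ)⁻¹) * dbar j χ ζ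
  have hDz : ∀ ζ, r ≤ ‖ζ‖ → DifferentiableOn ℂ (fun z => (Dk z ζ)⁻¹) (ball (0 : Fin n → ℂ) (r / (2 * n))) := by
    intro ζ hζ
    refine DifferentiableOn.inv ?_ fun z hz => hD0 z hz ζ hζ
    unfold Dk
    fun_prop
  have hq0 : ∀ z ζ i j, ‖ζ‖ < r → q z ζ i j = 0 := fun z ζ i j hζ => by
    simp only [q, hχ0 ζ hζ.le, dbar_zero_of_eventuallyEq (hχev ζ hζ) j]; simp
  have hs0 : ∀ z ζ i, ‖ζ‖ < r → sk z ζ i = 0 := fun z ζ i hζ => by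
    simp only [sk, hχ0 ζ hζ.le]; simp
  have hsev : ∀ z ζ i, ‖ζ‖ < r → (fun ζ => sk z ζ i) =ᶠ[𝓝 ζ] fun _ => 0 := fun z ζ i hζ => by
    filter_upwards [hχev ζ hζ] with w hw
    simp [sk, hw]
  refine ⟨sk, q, R * (2 / r ^ 2) + (R * (R + r) * (2 / r ^ 2) ^ 2 + (2 / r ^ 2) + R * (2 / r ^ 2) * M),
    by positivity, ?_, ?_, ?_, ?_, ?_, ?_, ?_⟩
  · intro z hz ζ i
    rcases lt_or_ge ‖ζ‖ r with h | h
    · exact contDiffAt_const.congr_of_eventuallyEq (hsev z ζ i h)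
    · exact (hχ.contDiffAt.of_le (by norm_num)).mul ((AnalyticAt.contDiffAt_conj (hca i ζ)).mul ((hDc z ζ).inv (hD0 z hz ζ h)))
  · intro z hz ζ hζ
    have hζr : r ≤ ‖ζ‖ := by
      simp only [mem_closedBall, dist_zero_right, not_le] at hζ
      linarith
    simp only [sk, hχ1 ζ hζ, one_mul]
    have : ∀ i, (starRingEnd ℂ) (ζ i) * (Dk z ζ)⁻¹ * (ζ i - z i) = (Dk z ζ)⁻¹ * ((ζ i - z i) * (starRingEnd ℂ) (ζ i)) :=
      fun i => by ring
    simp only [this]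
    rw [← Finset.mul_sum]
    exact inv_mul_cancel₀ (hD0 z hz ζ hζr)
  · intro z hz ζ i j
    rcases lt_or_ge ‖ζ‖ r with h | h
    · rw [hq0 z ζ i j h, dbar_zero_of_eventuallyEq (hsev z ζ i h)]
    · have h1 := (DifferentiableAt.hasDbar (hχ.contDiffAt.differentiableAt (x := ζ) (by norm_num))).mul
        ((HasDbar.conj_holo (hca i ζ).differentiableAt).mul ((hDdb z ζ).inv (hD0 z hz ζ h)))
      rw [h1.2 j]
      simp only [q, hcd]
      congr 3
      split_ifs <;> simp
  · intro ζ i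
    rcases lt_or_ge ‖ζ‖ r with h | h
    · simp only [hs0 _ ζ i h]; exact differentiableOn_const _
    · exact ((hDz ζ h).const_mul _).const_mul _
  · intro ζ i j
    rcases lt_or_ge ‖ζ‖ r with h | h
    · simp only [hq0 _ ζ i j h]; exact differentiableOn_const _
    · have h1 := hDz ζ h
      have h2 : ∀ z, -(ζ j - z j) / (Dk z ζ) ^ 2 = (z j - ζ j) * ((Dk z ζ)⁻¹ * (Dk z ζ)⁻¹) := fun z => by
        rw [div_eq_mul_inv, ← mul_inv, sq]; ring
      have h3 : DifferentiableOn ℂ (fun z : Fin n → ℂ => z j - ζ j) (ball (0 : Fin n → ℂ) (r / (2 * n))) := by fun_prop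
      simp only [q, h2]
      exact ((((h3.mul (h1.mul h1)).const_mul _).add (h1.mul_const _)).const_mul _).add ((h1.const_mul _).mul_const _)
  · intro z hz ζ hζ i
    rcases lt_or_ge ‖ζ‖ r with h | h
    · rw [hs0 z ζ i h, norm_zero]; positivity
    · have h1 := hDi z hz ζ h
      have h2 : ‖ζ i‖ ≤ R := (norm_le_pi_norm ζ i).trans (mem_closedBall_zero_iff.1 hζ)
      simp only [sk, norm_mul, RCLike.norm_conj]
      calc _ ≤ 1 * (R * (2 / r ^ 2)) := by gcongr; exact hχn ζ
        _ ≤ _ := by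
          rw [one_mul]
          refine le_add_of_nonneg_right (by positivity)
  · intro z hz ζ hζ i j
    rcases lt_or_ge ‖ζ‖ r with h | h
    · rw [hq0 z ζ i j h, norm_zero]; positivity
    · have h1 := hDi z hz ζ h
      have h2 : ‖ζ i‖ ≤ R := (norm_le_pi_norm ζ i).trans (mem_closedBall_zero_iff.1 hζ)
      have hzr : ‖z‖ ≤ r := by
        refine (mem_ball_zero_iff.1 hz).le.trans ?_
        rw [div_le_iff₀ (by positivity)]
        nlinarith
      have h3 : ‖-(ζ j - z j)‖ ≤ R + r := by
        rw [norm_neg]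
        exact (norm_sub_le _ _).trans (add_le_add ((norm_le_pi_norm ζ j).trans (mem_closedBall_zero_iff.1 hζ))
          ((norm_le_pi_norm z j).trans hzr))
      have h4 : ‖(if i = j then (1:ℂ) else 0)‖ ≤ 1 := by split_ifs <;> simp
      have h5 : ‖q z ζ i j‖ ≤ 1 * (R * ((R + r) * (2 / r ^ 2) ^ 2) + (2 / r ^ 2) * 1) + (R * (2 / r ^ 2)) * M := by
        simp only [q, div_eq_mul_inv (-(ζ j - z j)), ← inv_pow]
        refine (norm_add_le _ _).trans (add_le_add ?_ ?_)
        · rw [norm_mul]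
          refine mul_le_mul (hχn ζ) ?_ (norm_nonneg _) zero_le_one
          refine (norm_add_le _ _).trans (add_le_add ?_ ?_)
          · rw [norm_mul, norm_mul, RCLike.norm_conj, norm_pow]
            gcongr
          · rw [norm_mul]
            gcongr
        · rw [norm_mul, norm_mul, RCLike.norm_conj]
          gcongr
          exact hM j ζ hζ
      refine h5.trans ?_
      have : 0 ≤ R * (2 / r ^ 2) := by positivity
      linarith

end JacIdeal

namespace JacIdeal
open MeasureTheory Metric Set Filter Topology

variable {n ν : ℕ}

lemma hadamard_sum {E P : Type*} [NormedAddCommGroup E] [NormedSpace ℂ E] [FiniteDimensional ℂ E]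
    [NormedAddCommGroup P] [NormedSpace ℂ P] [FiniteDimensional ℂ P] {ι : Type*} [Fintype ι]
    {O K : Set E} {V : Set P} {F : E → ℂ} (hF : AnalyticOnNhd ℂ F O) (hK : IsCompact K) (hKO : K ⊆ O)
    (hV : IsOpen V) {p d : P → E} (hp : DifferentiableOn ℂ p V) (hd : DifferentiableOn ℂ d V)
    (hin : ∀ x ∈ V, ∀ t ∈ Icc (0 : ℝ) 1, p x + (t : ℂ) • d x ∈ K)
    (e : ι → E) (w : P → ι → ℂ) (hw : ∀ x, d x = ∑ i, w x i • e i) :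
    ∃ h : ι → P → ℂ, (∀ i, AnalyticOnNhd ℂ (h i) V) ∧
      ∀ x ∈ V, ∑ i, h i x * w x i = F (p x + d x) - F (p x) := by
  obtain ⟨h1, h2, h3⟩ := hadamard hF hK hKO hV hp hd hin
  refine ⟨fun i x => ∫ t in Icc (0 : ℝ) 1, fderiv ℂ F (p x + (t : ℂ) • d x) (e i), fun i => h1 (e i), ?_⟩
  intro x hx
  rw [← h3 x hx]
  have h4 : ∀ t : ℝ, fderiv ℂ F (p x + (t : ℂ) • d x) (d x) =
      ∑ i, fderiv ℂ F (p x + (t : ℂ) • d x) (e i) * w x i := fun t => by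
    conv_lhs => rw [hw x]
    rw [map_sum]
    refine Finset.sum_congr rfl fun i _ => ?_
    rw [map_smul, smul_eq_mul, mul_comm]
    rw [← hw x]
  simp only [h4]
  rw [integral_finsetSum _ fun i _ => (h2 (e i) x hx).mul_const _]
  exact Finset.sum_congr rfl fun i _ => (integral_mul_const _ _).symm

lemma hefer {R R' : ℝ} (hR : R' < R) (g : Fin ν → (Fin n → ℂ) → ℂ)
    (hg : ∀ i, AnalyticOnNhd ℂ (g i) (ball 0 R)) :
    ∃ (H : (Fin n → ℂ) → (Fin n → ℂ) → Fin ν → Fin n → ℂ) (B : ℝ), 0 ≤ B ∧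
      (∀ z ∈ ball (0 : Fin n → ℂ) R', ∀ ζ ∈ ball (0 : Fin n → ℂ) R', ∀ k, ∑ a, H z ζ k a * (ζ a - z a) = g k ζ - g k z) ∧
      (∀ z ∈ ball (0 : Fin n → ℂ) R', ∀ k a, AnalyticOnNhd ℂ (fun ζ => H z ζ k a) (ball 0 R')) ∧
      (∀ ζ ∈ ball (0 : Fin n → ℂ) R', ∀ k a, AnalyticOnNhd ℂ (fun z => H z ζ k a) (ball 0 R')) ∧
      (∀ z ∈ ball (0 : Fin n → ℂ) R', ∀ ζ ∈ ball (0 : Fin n → ℂ) R', ∀ k a, ‖H z ζ k a‖ ≤ B) := by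
  obtain ⟨R2, h1, h2⟩ := exists_between hR
  have hex : ∀ k, ∃ h : Fin n → (Fin n → ℂ) × (Fin n → ℂ) → ℂ,
      (∀ i, AnalyticOnNhd ℂ (h i) (ball (0 : Fin n → ℂ) R2 ×ˢ ball (0 : Fin n → ℂ) R2)) ∧
      ∀ x ∈ ball (0 : Fin n → ℂ) R2 ×ˢ ball (0 : Fin n → ℂ) R2,
        ∑ i, h i x * (x.2 i - x.1 i) = g k x.2 - g k x.1 := by
    intro k
    obtain ⟨h, hh1, hh2⟩ := hadamard_sum (hg k) (isCompact_closedBall (0 : Fin n → ℂ) R2) (closedBall_subset_ball h2)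
      (V := ball (0 : Fin n → ℂ) R2 ×ˢ ball (0 : Fin n → ℂ) R2) (isOpen_ball.prod isOpen_ball)
      (p := Prod.fst) (d := fun x => x.2 - x.1) differentiableOn_fst (differentiableOn_snd.sub differentiableOn_fst)
      (by
        intro x hx t ht
        have hc := (convex_ball (0 : Fin n → ℂ) R2) hx.1 hx.2 (sub_nonneg.2 ht.2) ht.1 (by ring)
        refine ball_subset_closedBall ?_
        convert hc using 1
        ext i
        simp
        ring)
      (fun i => (Pi.single i 1 : Fin n → ℂ)) (fun x i => x.2 i - x.1 i)
      (by
        intro x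
        ext j
        simp [Finset.sum_apply, Pi.single_apply])
    refine ⟨h, hh1, fun x hx => ?_⟩
    have := hh2 x hx
    simpa using this
  choose h hh1 hh2 using hex
  have hsub : ball (0 : Fin n → ℂ) R' ⊆ ball 0 R2 := ball_subset_ball h1.le
  have hb : ∃ B : ℝ, 0 ≤ B ∧ ∀ k a, ∀ x ∈ closedBall (0 : Fin n → ℂ) R' ×ˢ closedBall (0 : Fin n → ℂ) R', ‖h k a x‖ ≤ B := by
    have hc := fun (p : Fin ν × Fin n) => ((isCompact_closedBall (0 : Fin n → ℂ) R').prod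
      (isCompact_closedBall (0 : Fin n → ℂ) R')).exists_bound_of_continuousOn
      (f := h p.1 p.2) ((hh1 p.1 p.2).continuousOn.mono (prod_mono (closedBall_subset_ball h1) (closedBall_subset_ball h1)))
    choose M hM using hc
    refine ⟨∑ j, |M j|, Finset.sum_nonneg fun _ _ => abs_nonneg _, fun k a ζ hζ => ?_⟩
    exact ((hM (k, a) ζ hζ).trans (le_abs_self _)).trans
      (Finset.single_le_sum (f := fun j => |M j|) (fun _ _ => abs_nonneg _) (Finset.mem_univ (k, a)))
  obtain ⟨B, hB0, hB⟩ := hb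
  refine ⟨fun z ζ k a => h k a (z, ζ), B, hB0, ?_, ?_, ?_, ?_⟩
  · intro z hz ζ hζ k
    exact hh2 k (z, ζ) ⟨hsub hz, hsub hζ⟩
  · intro z hz k a ζ hζ
    exact (hh1 k a (z, ζ) ⟨hsub hz, hsub hζ⟩).comp₂ analyticAt_const analyticAt_id
  · intro ζ hζ k a z hz
    exact (hh1 k a (z, ζ) ⟨hsub hz, hsub hζ⟩).comp₂ analyticAt_id analyticAt_const
  · intro z hz ζ hζ k a
    exact hB k a _ ⟨ball_subset_closedBall hz, ball_subset_closedBall hζ⟩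

/-- The regularized quotient. -/
noncomputable def sig (g : Fin ν → (Fin n → ℂ) → ℂ) (δ : ℝ) (k : Fin ν) (ζ : Fin n → ℂ) : ℂ :=
  (starRingEnd ℂ) (g k ζ) * (((gam (fun k => g k ζ) + δ : ℝ) : ℂ))⁻¹

lemma gam_contDiffAt {g : Fin ν → (Fin n → ℂ) → ℂ} {ζ : Fin n → ℂ} (hg : ∀ k, AnalyticAt ℂ (g k) ζ) (δ : ℝ)
    {m : WithTop ℕ∞} : ContDiffAt ℝ m (fun ζ => ((gam (fun k => g k ζ) + δ : ℝ) : ℂ)) ζ := by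
  unfold gam
  exact ofReal_contDiffAt ((ContDiffAt.sum fun k _ => AnalyticAt.contDiffAt_normSq (hg k)).add contDiffAt_const)

lemma gam_ne {gv : Fin ν → ℂ} {δ : ℝ} (hδ : 0 < δ) : ((gam gv + δ : ℝ) : ℂ) ≠ 0 := by
  have := gam_nonneg gv
  have h : gam gv + δ ≠ 0 := by linarith
  exact_mod_cast h

lemma sig_contDiffAt {g : Fin ν → (Fin n → ℂ) → ℂ} {ζ : Fin n → ℂ} (hg : ∀ k, AnalyticAt ℂ (g k) ζ) {δ : ℝ}
    (hδ : 0 < δ) (k : Fin ν) {m : WithTop ℕ∞} : ContDiffAt ℝ m (sig g δ k) ζ := by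
  unfold sig
  exact (AnalyticAt.contDiffAt_conj (hg k)).mul ((gam_contDiffAt hg δ).inv (gam_ne hδ))

lemma sig_hasDbar {g : Fin ν → (Fin n → ℂ) → ℂ} {ζ : Fin n → ℂ} (hg : ∀ k, AnalyticAt ℂ (g k) ζ) {δ : ℝ}
    (hδ : 0 < δ) (k : Fin ν) : HasDbar (sig g δ k) (fun j => ∑ l, Cm (fun k => g k ζ) δ k l *
      (starRingEnd ℂ) (fderiv ℂ (g l) ζ (Pi.single j 1))) ζ := by
  have h1 : HasDbar (fun ζ => ((gam (fun k => g k ζ) + δ : ℝ) : ℂ))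
      (fun j => ∑ l, g l ζ * (starRingEnd ℂ) (fderiv ℂ (g l) ζ (Pi.single j 1))) ζ := by
    have h2 : (fun ζ => ((gam (fun k => g k ζ) + δ : ℝ) : ℂ)) =
        fun ζ => ∑ k, g k ζ * (starRingEnd ℂ) (g k ζ) + (δ : ℂ) := by
      ext ζ; push_cast; rw [gam_eq]
    rw [h2]
    refine ((HasDbar.sum fun l _ => (HasDbar.holo (hg l).differentiableAt).mul
      (HasDbar.conj_holo (hg l).differentiableAt)).add (HasDbar.const _)).congr_D fun j => ?_
    simp
  refine ((HasDbar.conj_holo (hg k).differentiableAt).mul (h1.inv (gam_ne hδ))).congr_D fun j => ?_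
  have hN := gam_ne (gv := fun k => g k ζ) hδ
  set N := ((gam (fun k => g k ζ) + δ : ℝ) : ℂ)
  have : ∀ l, Cm (fun k => g k ζ) δ k l * (starRingEnd ℂ) (fderiv ℂ (g l) ζ (Pi.single j 1)) =
      (if k = l then N⁻¹ * (starRingEnd ℂ) (fderiv ℂ (g l) ζ (Pi.single j 1)) else 0) -
      (starRingEnd ℂ) (g k ζ) / N ^ 2 * (g l ζ * (starRingEnd ℂ) (fderiv ℂ (g l) ζ (Pi.single j 1))) := by
    intro l
    simp only [Cm, N]
    split_ifs <;> ring
  simp only [this, Finset.sum_sub_distrib, ← Finset.mul_sum, Finset.sum_ite_eq, Finset.mem_univ, if_true]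
  ring

/-- The interpolated section. -/
noncomputable def SS (g : Fin ν → (Fin n → ℂ) → ℂ) (δ : ℝ) (y : Fin ν → ℂ) (H : (Fin n → ℂ) → Fin ν → Fin n → ℂ)
    (s : (Fin n → ℂ) → Fin n → ℂ) (i : Fin n) (ζ : Fin n → ℂ) : ℂ :=
  ∑ k, sig g δ k ζ * H ζ k i + (1 + ∑ k, (y k - g k ζ) * sig g δ k ζ) * s ζ i

lemma SS_spec {g : Fin ν → (Fin n → ℂ) → ℂ} {ζ : Fin n → ℂ} (hg : ∀ k, AnalyticAt ℂ (g k) ζ) {δ : ℝ}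
    (hδ : 0 < δ) (y : Fin ν → ℂ) {H : (Fin n → ℂ) → Fin ν → Fin n → ℂ} (hH : ∀ k a, AnalyticAt ℂ (fun ζ => H ζ k a) ζ)
    {s : (Fin n → ℂ) → Fin n → ℂ} (hs : ∀ i, ContDiffAt ℝ 2 (fun ζ => s ζ i) ζ)
    {q : Fin n → Fin n → ℂ} (hq : ∀ i j, dbar j (fun ζ => s ζ i) ζ = q i j) :
    (∀ i, ContDiffAt ℝ 2 (SS g δ y H s i) ζ) ∧
    ∑ i, ((dbarM (SS g δ y H s) ζ).updateRow i (fun j => dbar j (fun ζ => s ζ i) ζ)).det =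
      EE (fun k => g k ζ) (fun k j => fderiv ℂ (g k) ζ (Pi.single j 1)) δ y (H ζ) (s ζ) q := by
  constructor
  · intro i
    unfold SS
    exact (ContDiffAt.sum fun k _ => (sig_contDiffAt hg hδ k).mul (AnalyticAt.contDiffAtR (hH k i))).add
      ((contDiffAt_const.add (ContDiffAt.sum fun k _ => (contDiffAt_const.sub (AnalyticAt.contDiffAtR (hg k))).mul
        (sig_contDiffAt hg hδ k))).mul (hs i))
  · have hd : ∀ i j, dbar j (SS g δ y H s i) ζ = ∑ l, Ac (fun k => g k ζ) δ y (H ζ) (s ζ) i l *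
        (starRingEnd ℂ) (fderiv ℂ (g l) ζ (Pi.single j 1)) + rhat (fun k => g k ζ) δ y * q i j := by
      intro i j
      have h1 : HasDbar (fun ζ => ∑ k, sig g δ k ζ * H ζ k i) _ ζ := HasDbar.sum fun k _ =>
        (sig_hasDbar hg hδ k).mul (HasDbar.holo (hH k i).differentiableAt)
      have h2 : HasDbar (fun ζ => 1 + ∑ k, (y k - g k ζ) * sig g δ k ζ) _ ζ := (HasDbar.const 1).add
        (HasDbar.sum fun k _ => ((HasDbar.const (y k)).sub (HasDbar.holo (hg k).differentiableAt)).mul (sig_hasDbar hg hδ k))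
      have h3 := h1.add (h2.mul (DifferentiableAt.hasDbar ((hs i).differentiableAt (by norm_num))))
      refine (h3.2 j).trans ?_
      simp only [hq]
      have e1 : 1 + ∑ k, (y k - g k ζ) * sig g δ k ζ = rhat (fun k => g k ζ) δ y := by
        simp only [rhat, sig, div_eq_mul_inv]
      rw [e1]
      have e2 : ∀ l, Ac (fun k => g k ζ) δ y (H ζ) (s ζ) i l * (starRingEnd ℂ) (fderiv ℂ (g l) ζ (Pi.single j 1)) =
          ∑ k, (H ζ k i * (Cm (fun k => g k ζ) δ k l * (starRingEnd ℂ) (fderiv ℂ (g l) ζ (Pi.single j 1))) +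
            s ζ i * ((y k - g k ζ) * (Cm (fun k => g k ζ) δ k l * (starRingEnd ℂ) (fderiv ℂ (g l) ζ (Pi.single j 1))))) := by
        intro l
        rw [Ac, Finset.sum_mul]
        refine Finset.sum_congr rfl fun k _ => ?_
        rw [hh]; ring
      simp only [e2]
      rw [Finset.sum_comm]
      simp only [Finset.sum_add_distrib, ← Finset.mul_sum]
      simp only [mul_zero, zero_add, sub_self, Finset.sum_const_zero, add_zero]
      ring
    rw [EE]
    refine Finset.sum_congr rfl fun i _ => ?_
    congr 1
    ext a j
    rw [Matrix.updateRow_apply, Em, Matrix.of_apply]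
    by_cases ha : a = i
    · simp only [ha, if_true]; exact hq i j
    · simp only [ha, if_false]
      exact hd a j

lemma SS_sum {g : Fin ν → (Fin n → ℂ) → ℂ} {ζ z : Fin n → ℂ} {δ : ℝ} {H : (Fin n → ℂ) → Fin ν → Fin n → ℂ}
    {s : (Fin n → ℂ) → Fin n → ℂ} (hs : ∑ i, s ζ i * (ζ i - z i) = 1)
    (hH : ∀ k, ∑ a, H ζ k a * (ζ a - z a) = g k ζ - g k z) :
    ∑ i, SS g δ (fun k => g k z) H s i ζ * (ζ i - z i) = 1 := by
  have h1 : ∀ i, SS g δ (fun k => g k z) H s i ζ * (ζ i - z i) = ∑ k, sig g δ k ζ * (H ζ k i * (ζ i - z i)) +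
      (1 + ∑ k, (g k z - g k ζ) * sig g δ k ζ) * (s ζ i * (ζ i - z i)) := by
    intro i
    rw [SS, add_mul, Finset.sum_mul]
    congr 1
    · exact Finset.sum_congr rfl fun k _ => by ring
    · ring
  simp only [h1]
  rw [Finset.sum_add_distrib, Finset.sum_comm, ← Finset.mul_sum, hs]
  simp only [← Finset.mul_sum, hH]
  have : ∑ k, sig g δ k ζ * (g k ζ - g k z) = - ∑ k, (g k z - g k ζ) * sig g δ k ζ := by
    rw [← Finset.sum_neg_distrib]
    exact Finset.sum_congr rfl fun k _ => by ring
  rw [this]; ring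

end JacIdeal

namespace JacIdeal
open MeasureTheory Metric Set Filter Topology

variable {n ν : ℕ}

theorem local_main (hn : 0 < n) (hνn : ν < n) {R B : ℝ} (hR : 0 < R) (hB : 1 ≤ B)
    (f : Fin n → (Fin n → ℂ) → ℂ) (g : Fin ν → (Fin n → ℂ) → ℂ)
    (hf : ∀ i, AnalyticOnNhd ℂ (f i) (ball 0 R)) (hg : ∀ i, AnalyticOnNhd ℂ (g i) (ball 0 R))
    (hg1 : ∀ ζ ∈ ball 0 R, gam (fun k => g k ζ) ≤ 1)
    (hfg : ∀ ζ ∈ ball 0 R, ∀ i, ‖f i ζ‖ ^ 2 ≤ B * gam (fun k => g k ζ)) :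
    ∃ ρ, 0 < ρ ∧ ρ ≤ R ∧ ∃ b : Fin ν → (Fin n → ℂ) → ℂ, (∀ k, AnalyticOnNhd ℂ (b k) (ball 0 ρ)) ∧
      ∀ z ∈ ball 0 ρ, hJ f z = ∑ k, b k z * g k z := by
  have hn1 : (1:ℝ) ≤ n := by exact_mod_cast hn
  set R' := R / 2 with hR'
  set r := R / 8 with hr_def
  have hr : 0 < r := by positivity
  have hrR' : 2 * r < R' := by rw [hr_def, hR']; linarith
  have hR'0 : 0 < R' := by positivity
  have hR'R : R' < R := by rw [hR']; linarith
  set ρ := r / (2 * n) with hρ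
  have hρ0 : 0 < ρ := by positivity
  have hρr : ρ < r := by
    rw [hρ, div_lt_iff₀ (by positivity)]; nlinarith
  have hsub' : closedBall (0 : Fin n → ℂ) R' ⊆ ball 0 R := closedBall_subset_ball hR'R
  have hsub : ball (0 : Fin n → ℂ) R' ⊆ ball 0 R := ball_subset_ball hR'R.le
  have hρs : ball (0 : Fin n → ℂ) ρ ⊆ ball 0 R' := ball_subset_ball (by linarith)
  obtain ⟨c, hc0, hcf⟩ := cf_formula hn hr
  obtain ⟨sk, q, B1, hB1, s1, s2, s3, s4, s5, s6, s7⟩ := exists_skernel hn hr hrR'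
  obtain ⟨H, B2, hB2, H1, H2, H3, H4⟩ := hefer hR'R g hg
  set B3 := B1 + B2 with hB3
  have hB30 : 0 ≤ B3 := by positivity
  obtain ⟨m1, m2⟩ := majorant hn f g hf hg hR'0 hR'R hB (fun ζ hζ => hg1 ζ (hsub' hζ)) (fun ζ hζ => hfg ζ (hsub' hζ))
  have m1' := ae_restrict_of_ae_restrict_of_subset (ball_subset_closedBall (x := (0 : Fin n → ℂ)) (ε := R')) m1
  have m2' := m2.mono_set (ball_subset_closedBall (x := (0 : Fin n → ℂ)) (ε := R'))
  set μ : Measure (Fin n → ℂ) := volume.restrict (ball 0 R') with hμ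
  have hmem : ∀ᵐ ζ ∂μ, ζ ∈ ball (0 : Fin n → ℂ) R' := ae_restrict_mem isOpen_ball.measurableSet
  set V : Set ((Fin n → ℂ) × (Fin ν → ℂ)) := ball 0 ρ ×ˢ ball 0 2 with hV
  have hVo : IsOpen V := isOpen_ball.prod isOpen_ball
  let dg : (Fin n → ℂ) → Fin ν → Fin n → ℂ := fun ζ k j => fderiv ℂ (g k) ζ (Pi.single j 1)
  let gv : (Fin n → ℂ) → Fin ν → ℂ := fun ζ k => g k ζ
  let Fc : ℝ → (Fin n → ℂ) → ((Fin n → ℂ) × (Fin ν → ℂ)) → ℂ := fun δ ζ x =>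
    hJ f ζ * EE (gv ζ) (dg ζ) δ x.2 (H x.1 ζ) (sk x.1 ζ) (q x.1 ζ)
  let W : (Fin n → ℂ) → ℝ := fun ζ => (n * ((1 + 8 * ν) * B3) ^ n) *
    (‖hJ f ζ‖ * ∑ c : Fin n → Fin ν ⊕ Fin n, ((√(gam (gv ζ)))⁻¹) ^ (n - 1 + nL c) *
        ‖(Matrix.of fun a j => dGG (dg ζ) (c a) j).det‖)
  have hW : Integrable W μ := Integrable.const_mul m2' _
  have hbound : ∀ᵐ ζ ∂μ, ∀ δ, 0 ≤ δ → ∀ x ∈ V, ‖Fc δ ζ x‖ ≤ W ζ := by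
    filter_upwards [m1', hmem] with ζ h1 h2 δ hδ x hx
    rcases (gam_nonneg (gv ζ)).eq_or_lt with h | h
    · have hJ0 : hJ f ζ = 0 := h1 h.symm
      simp [Fc, W, hJ0]
    · have hx1 : x.1 ∈ ball (0 : Fin n → ℂ) ρ := hx.1
      have hx2 : ‖x.2‖ < 2 := mem_ball_zero_iff.1 hx.2
      have := EE_bound (n := n) h (hg1 ζ (hsub h2)) (dg ζ) hδ (y := x.2) (fun k => (norm_le_pi_norm x.2 k).trans hx2.le)
        hB30 (fun k a => (H4 x.1 (hρs hx1) ζ h2 k a).trans (by linarith))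
        (fun a => (s6 x.1 hx1 ζ (ball_subset_closedBall h2) a).trans (by linarith))
        (fun a j => (s7 x.1 hx1 ζ (ball_subset_closedBall h2) a j).trans (by linarith))
      simp only [Fc, W, norm_mul]
      calc _ ≤ ‖hJ f ζ‖ * _ := mul_le_mul_of_nonneg_left this (norm_nonneg _)
        _ = _ := by ring
  have hms : MeasurableSet (ball (0 : Fin n → ℂ) R') := isOpen_ball.measurableSet
  have hmeas : ∀ δ, ∀ x ∈ V, AEStronglyMeasurable (fun ζ => Fc δ ζ x) μ := by
    intro δ x hx
    refine AEMeasurable.aestronglyMeasurable ?_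
    have hx1 : x.1 ∈ ball (0 : Fin n → ℂ) ρ := hx.1
    refine AEMeasurable.mul (ContinuousOn.aemeasurable (fun ζ hζ =>
      (analyticAt_hJ fun i => hf i ζ (hsub hζ)).continuousAt.continuousWithinAt) hms) ?_
    refine EE_measurable δ x.2 ?_ ?_ ?_ ?_ ?_
    · exact fun k => ((hg k).continuousOn.mono hsub).aemeasurable hms
    · exact fun k j => ContinuousOn.aemeasurable (fun ζ hζ =>
        (analyticAt_partial (hg k ζ (hsub hζ)) (Pi.single j 1)).continuousAt.continuousWithinAt) hms
    · exact fun k a => (H2 x.1 (hρs hx1) k a).continuousOn.aemeasurable hms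
    · exact fun a => ContinuousOn.aemeasurable (fun ζ _ => (s1 x.1 hx1 ζ a).continuousAt.continuousWithinAt) hms
    · intro i j
      simp only [← s3 x.1 hx1]
      exact ContinuousOn.aemeasurable (fun ζ _ => (dbar_contDiffAt (k := j) (m := 0)
        ((s1 x.1 hx1 ζ i).of_le (by norm_num))).continuousAt.continuousWithinAt) hms
  have hdiff : ∀ᵐ ζ ∂μ, DifferentiableOn ℂ (Fc 0 ζ) V := by
    filter_upwards [hmem] with ζ hζ
    have hfst : DifferentiableOn ℂ (Prod.fst : (Fin n → ℂ) × (Fin ν → ℂ) → _) V := differentiableOn_fst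
    have hmt : MapsTo (Prod.fst : (Fin n → ℂ) × (Fin ν → ℂ) → _) V (ball 0 ρ) := fun x hx => hx.1
    refine DifferentiableOn.const_mul (EE_differentiableOn _ _ _ ?_ ?_ ?_ ?_) _
    · intro k; fun_prop
    · exact fun k a => ((H3 ζ hζ k a).differentiableOn.mono hρs).comp hfst hmt
    · exact fun a => (s4 ζ a).comp hfst hmt
    · exact fun i j => (s5 ζ i j).comp hfst hmt
  let B0 : ((Fin n → ℂ) × (Fin ν → ℂ)) → ℂ := fun x => ∫ ζ, Fc 0 ζ x ∂μ
  have hB0 : AnalyticOnNhd ℂ B0 V := analyticOnNhd_integral hVo (Fc 0) W hW (hmeas 0) hdiff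
    (by filter_upwards [hbound] with ζ h x hx using h 0 le_rfl x hx)
  have hgz : ∀ z ∈ ball (0 : Fin n → ℂ) R, ‖gv z‖ ≤ 1 := by
    intro z hz
    rw [pi_norm_le_iff_of_nonneg zero_le_one]
    intro k
    have h1 : ‖g k z‖ ^ 2 ≤ gam (gv z) :=
      Finset.single_le_sum (f := fun i => ‖g i z‖ ^ 2) (fun i _ => by positivity) (Finset.mem_univ k)
    have h2 := hg1 z hz
    have h3 : ‖g k z‖ ^ 2 ≤ 1 := h1.trans h2
    exact (sq_le_one_iff₀ (norm_nonneg _)).1 h3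
  have hzV : ∀ z ∈ ball (0 : Fin n → ℂ) ρ, (z, gv z) ∈ V := fun z hz =>
    ⟨hz, mem_ball_zero_iff.2 (lt_of_le_of_lt (hgz z (hsub (hρs hz))) (by norm_num))⟩
  have hJan : AnalyticOnNhd ℂ (fun ζ => hJ f ζ) (ball 0 R') := fun ζ hζ => analyticAt_hJ fun i => hf i ζ (hsub hζ)
  have hval : ∀ z ∈ ball (0 : Fin n → ℂ) ρ, ∀ δ, 0 < δ → ∫ ζ, Fc δ ζ (z, gv z) ∂μ = c * hJ f z := by
    intro z hz δ hδ
    have hspec := fun ζ (hζ : ζ ∈ ball (0 : Fin n → ℂ) R') => SS_spec (fun k => hg k ζ (hsub hζ)) hδ (gv z)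
      (H := H z) (fun k a => H2 z (hρs hz) k a ζ hζ) (s := sk z) (fun i => s1 z hz ζ i) (s3 z hz ζ)
    rw [← hcf z ((mem_ball_zero_iff.1 hz).trans hρr) R' hrR' (fun ζ => hJ f ζ) hJan (SS g δ (gv z) (H z) (sk z))
      (fun i ζ => sk z ζ i) (fun ζ hζ => (hspec ζ hζ).1) (fun ζ _ i => s1 z hz ζ i)
      (fun ζ hζ hζ2 => SS_sum (s2 z hz ζ hζ2) (H1 z (hρs hz) ζ hζ))
      (fun ζ _ hζ2 => s2 z hz ζ hζ2)]
    refine setIntegral_congr_fun hms fun ζ hζ => ?_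
    simp only [Fc]
    rw [(hspec ζ hζ).2]
  have hlim : ∀ z ∈ ball (0 : Fin n → ℂ) ρ, B0 (z, gv z) = c * hJ f z := by
    intro z hz
    have hpos : ∀ m : ℕ, (0:ℝ) < 1 / ((m:ℝ) + 1) := fun m => Nat.one_div_pos_of_nat
    have ht := tendsto_integral_of_dominated_convergence (μ := μ) (F := fun (m : ℕ) ζ => Fc (1 / ((m:ℝ) + 1)) ζ (z, gv z))
      (f := fun ζ => Fc 0 ζ (z, gv z)) W (fun m => hmeas _ _ (hzV z hz)) hW
      (fun m => by filter_upwards [hbound] with ζ h using h _ (hpos m).le _ (hzV z hz))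
      (by
        filter_upwards [m1'] with ζ h1
        rcases (gam_nonneg (gv ζ)).eq_or_lt with h | h
        · have hJ0 : hJ f ζ = 0 := h1 h.symm
          simp [Fc, hJ0]
        · exact Tendsto.const_mul _ ((EE_tendsto h (dg ζ) _ _ _ _).tendsto.comp tendsto_one_div_add_atTop_nhds_zero_nat))
    simp only [fun m => hval z hz _ (hpos m)] at ht
    exact tendsto_nhds_unique ht tendsto_const_nhds
  have hB00 : ∀ z, B0 (z, 0) = 0 := by
    intro z
    refine integral_eq_zero_of_ae ?_
    filter_upwards [m1'] with ζ h1
    rcases (gam_nonneg (gv ζ)).eq_or_lt with h | h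
    · have hJ0 : hJ f ζ = 0 := h1 h.symm
      simp [Fc, hJ0]
    · simp only [Fc]
      rw [EE_zero hνn h.ne']; simp
  have hρ2 : ball (0 : Fin n → ℂ) (ρ / 2) ⊆ ball 0 ρ := ball_subset_ball (by linarith)
  have hgd : DifferentiableOn ℂ gv (ball 0 (ρ / 2)) := by
    rw [differentiableOn_pi]
    exact fun k => (hg k).differentiableOn.mono (hρ2.trans (hρs.trans hsub))
  obtain ⟨h, hh1, hh2⟩ := hadamard_sum (ι := Fin ν) (P := Fin n → ℂ) hB0
    (K := closedBall 0 (ρ / 2) ×ˢ closedBall 0 1)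
    ((isCompact_closedBall (0 : Fin n → ℂ) (ρ / 2)).prod (isCompact_closedBall (0 : Fin ν → ℂ) 1))
    (prod_mono (closedBall_subset_ball (by linarith)) (closedBall_subset_ball (by norm_num)))
    (V := ball (0 : Fin n → ℂ) (ρ / 2)) isOpen_ball
    (p := fun z => (z, 0)) (d := fun z => (0, gv z)) (differentiableOn_id.prodMk (differentiableOn_const _))
    ((differentiableOn_const _).prodMk hgd)
    (by
      intro z hz t ht
      refine ⟨?_, ?_⟩
      · simpa using (mem_ball_zero_iff.1 hz).le
      · simp only [Prod.snd_add, Prod.smul_snd, zero_add, mem_closedBall_zero_iff, norm_smul, Complex.norm_real]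
        have h1 := hgz z (hsub (hρs (hρ2 hz)))
        rw [Real.norm_of_nonneg ht.1]
        exact mul_le_one₀ ht.2 (norm_nonneg _) h1)
    (fun k => ((0 : Fin n → ℂ), (Pi.single k 1 : Fin ν → ℂ))) (fun z k => g k z)
    (by
      intro z
      refine Prod.ext ?_ ?_
      · simp [Prod.fst_sum]
      · ext j
        simp [Prod.snd_sum, Finset.sum_apply, Pi.single_apply, gv])
  refine ⟨ρ / 2, by positivity, by linarith, fun k z => c⁻¹ * h k z, fun k => analyticOnNhd_const.mul (hh1 k), ?_⟩
  intro z hz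
  have h1 := hh2 z hz
  have h2 : ((z, 0) : (Fin n → ℂ) × (Fin ν → ℂ)) + (0, gv z) = (z, gv z) := by simp
  rw [h2, hlim z (hρ2 hz), hB00, sub_zero] at h1
  simp only [mul_assoc]
  rw [← Finset.mul_sum, h1, inv_mul_cancel_left₀ hc0]

end JacIdeal

/-- If the ideal generated by `f_1, …, f_n` at `0` admits a reduction generated by
`ν < n` elements `g_1, …, g_ν` (each a holomorphic combination of the `f_j`, with each
`f_j` in the integral closure: `|f_j| ≤ C (|g_1| + ⋯ + |g_ν|)` near `0`), then the
Jacobian `z ↦ det (∂f_i/∂z_j (z))` lies in the ideal `(f_1, …, f_n)` locally at `0`. -/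
theorem jacobian_mem_ideal_of_analytic_spread_lt
    (n : ℕ) (hn : 0 < n) (U : Set (Fin n → ℂ)) (hU : IsOpen U)
    (h0U : (0 : Fin n → ℂ) ∈ U)
    (f : Fin n → (Fin n → ℂ) → ℂ) (hf : ∀ i, AnalyticOnNhd ℂ (f i) U)
    (ν : ℕ) (hν : 0 < ν) (hνn : ν < n)
    (g : Fin ν → (Fin n → ℂ) → ℂ)
    (hred : ∃ W' : Set (Fin n → ℂ), W' ⊆ U ∧ IsOpen W' ∧ (0 : Fin n → ℂ) ∈ W' ∧
      (∀ k, AnalyticOnNhd ℂ (g k) W') ∧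
      ∃ c : Fin ν → Fin n → (Fin n → ℂ) → ℂ,
        (∀ k j, AnalyticOnNhd ℂ (c k j) W') ∧
        ∀ z ∈ W', ∀ k, g k z = ∑ j, c k j z * f j z)
    (hintcl : ∃ C : ℝ, 0 < C ∧ ∃ W : Set (Fin n → ℂ), IsOpen W ∧ (0 : Fin n → ℂ) ∈ W ∧
      ∀ z ∈ W, ∀ j : Fin n, ‖f j z‖ ≤ C * ∑ k, ‖g k z‖) :
    ∃ U' ⊆ U, IsOpen U' ∧ (0 : Fin n → ℂ) ∈ U' ∧
      ∃ a : Fin n → (Fin n → ℂ) → ℂ,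
        (∀ i, AnalyticOnNhd ℂ (a i) U') ∧
        ∀ z ∈ U', Matrix.det (Matrix.of fun i j : Fin n =>
            fderiv ℂ (f i) z (Pi.single j 1)) = ∑ i, a i z * f i z := by
  obtain ⟨W', hW'U, hW'o, h0W', hg, c, hc, hgc⟩ := hred
  obtain ⟨C, hC, W, hWo, h0W, hfC⟩ := hintcl
  have hgcont : ContinuousAt (fun ζ => JacIdeal.gam (fun k => g k ζ)) 0 := by
    unfold JacIdeal.gam
    exact tendsto_finsetSum _ fun k _ => ((hg k 0 h0W').continuousAt.norm.pow 2)
  set M := JacIdeal.gam (fun k => g k 0) + 1 with hM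
  have hM0 : 0 < M := by
    have := JacIdeal.gam_nonneg (fun k => g k 0)
    rw [hM]; linarith
  have hev : ∀ᶠ ζ in nhds (0 : Fin n → ℂ), ζ ∈ W' ∧ ζ ∈ W ∧ JacIdeal.gam (fun k => g k ζ) < M :=
    (hW'o.eventually_mem h0W').and ((hWo.eventually_mem h0W).and
      (hgcont.eventually (gt_mem_nhds (by rw [hM]; linarith))))
  obtain ⟨R, hR, hball⟩ := Metric.eventually_nhds_iff_ball.1 hev
  set ε : ℝ := (√M)⁻¹ with hε
  have hε2 : ε ^ 2 * M = 1 := by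
    rw [hε, inv_pow, Real.sq_sqrt hM0.le]; exact inv_mul_cancel₀ hM0.ne'
  let gt : Fin ν → (Fin n → ℂ) → ℂ := fun k ζ => (ε : ℂ) * g k ζ
  have hgt : ∀ ζ, JacIdeal.gam (fun k => gt k ζ) = ε ^ 2 * JacIdeal.gam (fun k => g k ζ) := by
    intro ζ
    simp only [JacIdeal.gam, gt, norm_mul, mul_pow, Complex.norm_real, Real.norm_eq_abs, sq_abs, ← Finset.mul_sum]
  have hf' : ∀ i, AnalyticOnNhd ℂ (f i) (Metric.ball 0 R) := fun i => (hf i).mono fun ζ hζ => hW'U (hball ζ hζ).1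
  have hg' : ∀ k, AnalyticOnNhd ℂ (gt k) (Metric.ball 0 R) := fun k =>
    analyticOnNhd_const.mul ((hg k).mono fun ζ hζ => (hball ζ hζ).1)
  obtain ⟨ρ, hρ0, hρR, b, hb, hJb⟩ := JacIdeal.local_main hn hνn hR (B := 1 + C ^ 2 * ν * M)
    (le_add_of_nonneg_right (by positivity)) f gt hf' hg'
    (by
      intro ζ hζ
      rw [hgt, ← hε2]
      exact mul_le_mul_of_nonneg_left (hball ζ hζ).2.2.le (sq_nonneg _))
    (by
      intro ζ hζ i
      rw [hgt]
      have h1 := hfC ζ (hball ζ hζ).2.1 i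
      have h2 : (∑ k, ‖g k ζ‖) ^ 2 ≤ ν * JacIdeal.gam (fun k => g k ζ) := by
        have := sq_sum_le_card_mul_sum_sq (s := (Finset.univ : Finset (Fin ν))) (f := fun k => ‖g k ζ‖)
        simpa [JacIdeal.gam] using this
      have h3 := JacIdeal.gam_nonneg (fun k => g k ζ)
      calc ‖f i ζ‖ ^ 2 ≤ (C * ∑ k, ‖g k ζ‖) ^ 2 := by gcongr
        _ = C ^ 2 * (∑ k, ‖g k ζ‖) ^ 2 := by ring
        _ ≤ C ^ 2 * (ν * JacIdeal.gam (fun k => g k ζ)) := by gcongr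
        _ = (C ^ 2 * ν * JacIdeal.gam (fun k => g k ζ)) * (ε ^ 2 * M) := by rw [hε2, mul_one]; ring
        _ = (C ^ 2 * ν * M) * (ε ^ 2 * JacIdeal.gam (fun k => g k ζ)) := by ring
        _ ≤ _ := by
          have : 0 ≤ ε ^ 2 * JacIdeal.gam (fun k => g k ζ) := by positivity
          nlinarith)
  have hρW : Metric.ball (0 : Fin n → ℂ) ρ ⊆ W' := fun ζ hζ => (hball ζ (Metric.ball_subset_ball hρR hζ)).1
  refine ⟨Metric.ball 0 ρ, hρW.trans hW'U, Metric.isOpen_ball, Metric.mem_ball_self hρ0,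
    fun i z => ∑ k, b k z * ((ε : ℂ) * c k i z), ?_, ?_⟩
  · intro i
    exact Finset.analyticOnNhd_fun_sum _ fun k _ => (hb k).mul (analyticOnNhd_const.mul ((hc k i).mono hρW))
  · intro z hz
    refine (hJb z hz).trans ?_
    simp only [gt, hgc z (hρW hz), Finset.mul_sum, Finset.sum_mul]
    rw [Finset.sum_comm]
    exact Finset.sum_congr rfl fun i _ => Finset.sum_congr rfl fun k _ => by ring
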